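/- There exist an integer k0 and a sequence (eps_k) of positive reals with eps_k -> 0 as k -> infinity such that for every k >= k0 and every clause density r with 0 < r <= 2^k * ln 2 - (3/2) * ln 2 - eps_k, the random k-CNF formula Phi_k(n, floor(r*n)) is satisfiable with high probability as n -> infinity. (In particular, the k-SAT threshold sequence r_k(n) satisfies r_k >= 2^k ln 2 - (3/2) ln 2 - eps_k.) -/

import Mathlib

open Classical Finset Filter

noncomputable section

/-- A literal: a variable index together with a sign (`true` = positive occurrence). -/
abbrev Lit (n : ℕ) := Fin n × Bool

/-- A clause: an ordered `k`-tuple of literals. -/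
abbrev Clause (n k : ℕ) := Fin k → Lit n

/-- A `k`-CNF formula with `m` clauses over `n` variables. -/
abbrev Formula (n k m : ℕ) := Fin m → Clause n k

/-- A truth assignment. -/
abbrev Assignment (n : ℕ) := Fin n → Bool

/-- The truth value of a literal under an assignment. -/
def litVal {n : ℕ} (σ : Assignment n) (l : Lit n) : Bool :=
  if l.2 then σ l.1 else !(σ l.1)

/-- `σ` satisfies `Φ` if every clause contains at least one true literal. -/
def Satisfies {n k m : ℕ} (σ : Assignment n) (Φ : Formula n k m) : Prop :=
  ∀ i : Fin m, ∃ j : Fin k, litVal σ (Φ i j) = true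

/-- The set of satisfying assignments of `Φ`. -/
def satSet (n k m : ℕ) (Φ : Formula n k m) : Finset (Assignment n) :=
  univ.filter fun σ => Satisfies σ Φ

/-- The number of satisfying assignments of `Φ`. -/
def satCount (n k m : ℕ) (Φ : Formula n k m) : ℕ := (satSet n k m Φ).card

/-- Probability of an event under the uniformly random formula `Φ_k(n,m)`. -/
def prF (n k m : ℕ) (E : Formula n k m → Prop) : ℝ :=
  ((univ.filter fun Φ : Formula n k m => E Φ).card : ℝ) / (Fintype.card (Formula n k m) : ℝ)

/-- Expectation of a function of the uniformly random formula `Φ_k(n,m)`. -/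
def expF (n k m : ℕ) (f : Formula n k m → ℝ) : ℝ :=
  (∑ Φ : Formula n k m, f Φ) / (Fintype.card (Formula n k m) : ℝ)

/-- The number of occurrences of the literal `l` in `Φ`. -/
def occ (n k m : ℕ) (Φ : Formula n k m) (l : Lit n) : ℕ :=
  (univ.filter fun p : Fin m × Fin k => Φ p.1 p.2 = l).card

/-- The (signed) degree sequence of `Φ`. -/
def degSeq (n k m : ℕ) (Φ : Formula n k m) : Lit n → ℕ := occ n k m Φ

/-- Hamming distance between two assignments. -/
def hdist {n : ℕ} (σ τ : Assignment n) : ℕ :=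
  (univ.filter fun x => σ x ≠ τ x).card

/-- The majority-vote assignment: `x ↦ true` iff `x` occurs more often positively
than negatively. -/
def sigmaMaj (n k m : ℕ) (Φ : Formula n k m) : Assignment n :=
  fun x => decide (occ n k m Φ (x, false) < occ n k m Φ (x, true))

namespace KS

/-! ### Averages over finite types -/

def avg {α : Type*} [Fintype α] (f : α → ℝ) : ℝ := (∑ a, f a) / (Fintype.card α : ℝ)

def ind (p : Prop) : ℝ := if p then 1 else 0

lemma ind_nonneg (p : Prop) : 0 ≤ ind p := by unfold ind; split_ifs <;> norm_num
lemma ind_le_one (p : Prop) : ind p ≤ 1 := by unfold ind; split_ifs <;> norm_num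
lemma ind_true {p : Prop} (h : p) : ind p = 1 := if_pos h
lemma ind_false {p : Prop} (h : ¬ p) : ind p = 0 := if_neg h
lemma ind_mono {p q : Prop} (h : p → q) : ind p ≤ ind q := by
  by_cases hp : p <;> by_cases hq : q <;> simp_all [ind]
lemma ind_or {p q : Prop} : ind (p ∨ q) ≤ ind p + ind q := by
  by_cases hp : p <;> by_cases hq : q <;> simp_all [ind]
lemma ind_and {p q : Prop} : ind (p ∧ q) = ind p * ind q := by
  by_cases hp : p <;> by_cases hq : q <;> simp_all [ind]
lemma ind_not {p : Prop} : ind (¬ p) = 1 - ind p := by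
  by_cases hp : p <;> simp_all [ind]
lemma ind_le_of {p : Prop} {x : ℝ} (h : p → 1 ≤ x) (h0 : 0 ≤ x) : ind p ≤ x := by
  unfold ind; split_ifs with hp
  · exact h hp
  · exact h0
lemma ind_forall {ι : Type*} [Fintype ι] (p : ι → Prop) : ind (∀ i, p i) = ∏ i, ind (p i) := by
  by_cases h : ∀ i, p i
  · rw [ind_true h]; symm; exact Finset.prod_eq_one fun i _ => ind_true (h i)
  · rw [ind_false h]; push Not at h; obtain ⟨i, hi⟩ := h
    symm; exact Finset.prod_eq_zero (Finset.mem_univ i) (ind_false hi)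
lemma ind_exists_le {ι : Type*} (s : Finset ι) (p : ι → Prop) :
    ind (∃ i ∈ s, p i) ≤ ∑ i ∈ s, ind (p i) := by
  apply ind_le_of
  · rintro ⟨i, hi, hp⟩
    calc (1:ℝ) = ind (p i) := (ind_true hp).symm
      _ ≤ _ := Finset.single_le_sum (f := fun i => ind (p i)) (fun i _ => ind_nonneg _) hi
  · exact Finset.sum_nonneg fun i _ => ind_nonneg _

section avg
variable {α β : Type*} [Fintype α] [Fintype β]

lemma avg_mono {f g : α → ℝ} (h : ∀ a, f a ≤ g a) : avg f ≤ avg g := by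
  unfold avg; gcongr with a; exact h a

lemma avg_nonneg {f : α → ℝ} (h : ∀ a, 0 ≤ f a) : 0 ≤ avg f := by
  unfold avg; exact div_nonneg (Finset.sum_nonneg fun a _ => h a) (Nat.cast_nonneg _)

lemma avg_add (f g : α → ℝ) : avg (fun a => f a + g a) = avg f + avg g := by
  unfold avg; rw [Finset.sum_add_distrib, add_div]

lemma avg_sub (f g : α → ℝ) : avg (fun a => f a - g a) = avg f - avg g := by
  unfold avg; rw [Finset.sum_sub_distrib, sub_div]

lemma avg_neg (f : α → ℝ) : avg (fun a => - f a) = - avg f := by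
  unfold avg; rw [Finset.sum_neg_distrib, neg_div]

lemma avg_mul (c : ℝ) (f : α → ℝ) : avg (fun a => c * f a) = c * avg f := by
  unfold avg; rw [← Finset.mul_sum, mul_div_assoc]

lemma avg_mul_right (c : ℝ) (f : α → ℝ) : avg (fun a => f a * c) = avg f * c := by
  simp_rw [mul_comm _ c]; exact avg_mul c f

lemma avg_div (c : ℝ) (f : α → ℝ) : avg (fun a => f a / c) = avg f / c := by
  simp_rw [div_eq_mul_inv]; exact avg_mul_right _ f

lemma avg_sum {ι : Type*} (s : Finset ι) (f : ι → α → ℝ) :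
    avg (fun a => ∑ i ∈ s, f i a) = ∑ i ∈ s, avg (f i) := by
  unfold avg; rw [Finset.sum_comm, Finset.sum_div]

lemma avg_const [Nonempty α] (c : ℝ) : avg (fun _ : α => c) = c := by
  unfold avg
  have : (Fintype.card α : ℝ) ≠ 0 := by exact_mod_cast Fintype.card_ne_zero
  simp only [Finset.sum_const, Finset.card_univ, nsmul_eq_mul]
  field_simp

lemma avg_le_const {f : α → ℝ} {c : ℝ} (hc : 0 ≤ c) (h : ∀ a, f a ≤ c) : avg f ≤ c := by
  rcases isEmpty_or_nonempty α with h0 | h0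
  · simp [avg, hc]
  · calc avg f ≤ avg (fun _ : α => c) := avg_mono h
      _ = c := avg_const c

lemma avg_comm (f : α → β → ℝ) :
    avg (fun a => avg (fun b => f a b)) = avg fun b => avg fun a => f a b := by
  unfold avg
  rw [← Finset.sum_div, ← Finset.sum_div, Finset.sum_comm, div_div, div_div, mul_comm]

lemma avg_prod (f : α × β → ℝ) : avg f = avg fun a => avg fun b => f (a, b) := by
  unfold avg
  rw [← Finset.sum_div, div_div, Fintype.sum_prod_type, Fintype.card_prod, Nat.cast_mul, mul_comm (Fintype.card β : ℝ)]

lemma avg_equiv (e : α ≃ β) (f : β → ℝ) : avg (fun a => f (e a)) = avg f := by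
  unfold avg
  rw [Fintype.card_congr e, Equiv.sum_comp e f]

lemma avg_pi_prod {ι C : Type*} [Fintype ι] [DecidableEq ι] [Fintype C] (g : ι → C → ℝ) :
    avg (fun Φ : ι → C => ∏ i, g i (Φ i)) = ∏ i, avg (g i) := by
  unfold avg
  rw [Finset.prod_div_distrib, Finset.prod_univ_sum, Fintype.card_pi, Nat.cast_prod]
  simp

lemma avg_update {ι C : Type*} [Fintype ι] [DecidableEq ι] [Fintype C] (i : ι) (f : (ι → C) → ℝ) :
    avg (fun Φ => avg fun c => f (Function.update Φ i c)) = avg f := by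
  rcases isEmpty_or_nonempty C with hC | hC
  · have : IsEmpty (ι → C) := ⟨fun Φ => hC.elim (Φ i)⟩
    simp [avg]
  rw [← avg_prod (fun p : (ι → C) × C => f (Function.update p.1 i p.2))]
  let e : (ι → C) × C ≃ (ι → C) × C :=
    { toFun := fun p => (Function.update p.1 i p.2, p.1 i)
      invFun := fun p => (Function.update p.1 i p.2, p.1 i)
      left_inv := by rintro ⟨a, b⟩; simp
      right_inv := by rintro ⟨a, b⟩; simp }
  have := avg_equiv e (fun p => f p.1)
  change avg (fun p : (ι → C) × C => f (Function.update p.1 i p.2)) = _ at this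
  rw [this, avg_prod]
  simp_rw [avg_const]

/-- pushing forward along a map with uniform fibres -/
lemma avg_fiber {α β : Type*} [Fintype α] [Fintype β] [DecidableEq β] (π : α → β) (K : ℕ) (hK : 0 < K)
    (h : ∀ b, (univ.filter fun a => π a = b).card = K) (f : β → ℝ) :
    avg (fun a => f (π a)) = avg f := by
  unfold avg
  have h1 : ∑ a, f (π a) = K * ∑ b, f b := by
    rw [← Finset.sum_fiberwise (s := univ) (g := π), Finset.mul_sum]
    apply Finset.sum_congr rfl
    intro b _
    rw [Finset.sum_congr rfl (g := fun _ => f b)]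
    · rw [Finset.sum_const, h, nsmul_eq_mul]
    · intro a ha; rw [(Finset.mem_filter.1 ha).2]
  have h2 : (Fintype.card α : ℝ) = K * Fintype.card β := by
    have := Finset.card_eq_sum_card_fiberwise (f := π) (s := univ) (t := univ) (by intro x _; simp)
    simp only [h, Finset.sum_const, smul_eq_mul, Finset.card_univ] at this
    rw [this]; push_cast; ring
  rw [h1, h2]
  have : (K:ℝ) ≠ 0 := by positivity
  rw [mul_div_mul_left _ _ this]

lemma avg_ind_not [Nonempty α] (p : α → Prop) : avg (fun a => ind (¬ p a)) = 1 - avg (fun a => ind (p a)) := by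
  simp_rw [ind_not]; rw [avg_sub, avg_const]

/-- Markov -/
lemma avg_markov {f : α → ℝ} {p : α → Prop} {c : ℝ} (hc : 0 < c) (h0 : ∀ a, 0 ≤ f a)
    (h : ∀ a, p a → c ≤ f a) : avg (fun a => ind (p a)) ≤ avg f / c := by
  rw [← avg_div]
  apply avg_mono; intro a
  apply ind_le_of
  · intro hp; rw [le_div_iff₀ hc, one_mul]; exact h a hp
  · exact div_nonneg (h0 a) hc.le

end avg

/-! ### Azuma -/

lemma exp_le_cosh_sinh {t x S : ℝ} (hS : 0 < S) (hx : |x| ≤ S) :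
    Real.exp (t * x) ≤ Real.cosh (t * S) + x * (Real.sinh (t * S) / S) := by
  have h := abs_le.1 hx
  obtain ⟨_, hc⟩ := convexOn_exp
  have h1 := hc (Set.mem_univ (t * S)) (Set.mem_univ (-(t * S)))
    (show 0 ≤ (S + x) / (2 * S) from div_nonneg (by linarith) (by linarith)) (show 0 ≤ (S - x) / (2 * S) from div_nonneg (by linarith) (by linarith))
    (by field_simp; ring)
  simp only [smul_eq_mul] at h1
  have e1 : (S + x) / (2 * S) * (t * S) + (S - x) / (2 * S) * -(t * S) = t * x := by
    field_simp; ring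
  rw [e1] at h1
  refine h1.trans (le_of_eq ?_)
  rw [Real.cosh_eq, Real.sinh_eq]
  field_simp; ring

lemma hoeffding {C : Type*} [Fintype C] [Nonempty C] {f : C → ℝ} {S t : ℝ} (hS : 0 < S)
    (h0 : avg f = 0) (hb : ∀ c, |f c| ≤ S) : avg (fun c => Real.exp (t * f c)) ≤ Real.exp (t ^ 2 * S ^ 2 / 2) := by
  calc avg (fun c => Real.exp (t * f c)) ≤ avg (fun c => Real.cosh (t * S) + f c * (Real.sinh (t * S) / S)) :=
        avg_mono fun c => exp_le_cosh_sinh hS (hb c)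
    _ = Real.cosh (t * S) := by rw [avg_add, avg_const, avg_mul_right, h0]; ring
    _ ≤ _ := by
      have := Real.cosh_le_exp_half_sq (t * S)
      rwa [mul_pow] at this

lemma azuma {ι C : Type*} [Fintype ι] [DecidableEq ι] [Fintype C] [Nonempty C] {S : ℝ} (hS : 0 < S) (t : ℝ)
    (A : Finset ι) : ∀ f : (ι → C) → ℝ,
    (∀ Φ Ψ : ι → C, (∀ i ∈ A, Φ i = Ψ i) → f Φ = f Ψ) →
    (∀ i Φ c, |f (Function.update Φ i c) - f Φ| ≤ S) →
    avg (fun Φ => Real.exp (t * (f Φ - avg f))) ≤ Real.exp (t ^ 2 * S ^ 2 / 2 * A.card) := by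
  induction A using Finset.induction_on with
  | empty =>
    intro f h1 _
    obtain ⟨Φ₀⟩ : Nonempty (ι → C) := inferInstance
    have : f = fun _ => f Φ₀ := by funext Φ; exact h1 _ _ (by simp)
    rw [this]; simp [avg_const]
  | insert i A hi ih =>
    intro f h1 h2
    set g : (ι → C) → ℝ := fun Φ => avg fun c => f (Function.update Φ i c) with hg
    have hgf : avg g = avg f := avg_update i f
    have hdep : ∀ Φ Ψ : ι → C, (∀ j ∈ A, Φ j = Ψ j) → g Φ = g Ψ := by
      intro Φ Ψ h
      simp only [hg]; congr 1; funext c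
      apply h1
      intro j hj
      by_cases hji : j = i
      · subst hji; simp
      · rw [Function.update_of_ne hji, Function.update_of_ne hji]
        exact h j (Finset.mem_of_mem_insert_of_ne hj hji)
    have hdiff : ∀ j Φ c, |g (Function.update Φ j c) - g Φ| ≤ S := by
      intro j Φ c
      by_cases hji : j = i
      · subst hji; simp [hg, hS.le]
      · simp only [hg]; rw [← avg_sub]
        rw [abs_le]; constructor
        · rw [← neg_neg (avg _), neg_le_neg_iff, ← avg_neg]
          apply avg_le_const hS.le; intro c'
          rw [Function.update_comm hji]
          have := abs_le.1 (h2 j (Function.update Φ i c') c); linarith [this.1]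
        · apply avg_le_const hS.le; intro c'
          rw [Function.update_comm hji]
          have := abs_le.1 (h2 j (Function.update Φ i c') c); linarith [this.2]
    have hmain := ih g hdep hdiff
    calc avg (fun Φ => Real.exp (t * (f Φ - avg f)))
        = avg (fun Φ => avg fun c => Real.exp (t * (f (Function.update Φ i c) - avg f))) :=
          (avg_update i _).symm
      _ ≤ avg (fun Φ => Real.exp (t * (g Φ - avg g)) * Real.exp (t ^ 2 * S ^ 2 / 2)) := by
          apply avg_mono; intro Φ
          have : ∀ c, Real.exp (t * (f (Function.update Φ i c) - avg f))
              = Real.exp (t * (g Φ - avg g)) * Real.exp (t * (f (Function.update Φ i c) - g Φ)) := by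
            intro c; rw [← Real.exp_add, hgf]; ring_nf
          simp_rw [this]
          rw [avg_mul]
          gcongr
          apply hoeffding hS
          · rw [avg_sub, avg_const]; simp [hg]
          · intro c
            have e1 : f (Function.update Φ i c) - g Φ
              = avg fun c' => (f (Function.update (Function.update Φ i c') i c) - f (Function.update Φ i c')) := by
              rw [avg_sub]; simp [hg, avg_const]
            rw [e1, abs_le]; constructor
            · rw [← neg_neg (avg _), neg_le_neg_iff, ← avg_neg]
              apply avg_le_const hS.le; intro c'
              have := abs_le.1 (h2 i (Function.update Φ i c') c); linarith [this.1]
            · apply avg_le_const hS.le; intro c'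
              have := abs_le.1 (h2 i (Function.update Φ i c') c); linarith [this.2]
      _ ≤ Real.exp (t ^ 2 * S ^ 2 / 2 * A.card) * Real.exp (t ^ 2 * S ^ 2 / 2) := by
          rw [avg_mul_right]; gcongr
      _ = _ := by
          rw [← Real.exp_add, Finset.card_insert_of_notMem hi]; push_cast; ring_nf

lemma azuma_tail {ι C : Type*} [Fintype ι] [DecidableEq ι] [Fintype C] [Nonempty C] {S : ℝ} (hS : 0 < S)
    {t x : ℝ} (ht : 0 ≤ t) (A : Finset ι) (f : (ι → C) → ℝ)
    (h1 : ∀ Φ Ψ : ι → C, (∀ i ∈ A, Φ i = Ψ i) → f Φ = f Ψ)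
    (h2 : ∀ i Φ c, |f (Function.update Φ i c) - f Φ| ≤ S) :
    avg (fun Φ => ind (f Φ < avg f - x)) ≤ Real.exp (t ^ 2 * S ^ 2 / 2 * A.card - t * x) := by
  have := azuma hS (-t) A f h1 h2
  calc avg (fun Φ => ind (f Φ < avg f - x)) ≤ avg (fun Φ => Real.exp (-t * (f Φ - avg f)) * Real.exp (- (t * x))) := by
        apply avg_mono; intro Φ
        apply ind_le_of
        · intro h; rw [← Real.exp_add]; apply Real.one_le_exp; nlinarith
        · positivity
    _ ≤ Real.exp ((-t) ^ 2 * S ^ 2 / 2 * A.card) * Real.exp (- (t * x)) := by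
        rw [avg_mul_right]; gcongr
    _ = _ := by rw [← Real.exp_add]; ring_nf

end KS

namespace KS

/-! ### The soft model -/

abbrev Cl (V : Type) (k : ℕ) := Fin k → V × Bool

section model
variable {V : Type} [Fintype V] {k m : ℕ}

def sat (σ : V → Bool) (J : Finset (Fin k)) (c : Cl V k) : Prop := ∃ j ∈ J, σ (c j).1 = (c j).2

def wt (κ : ℝ) (σ : V → Bool) (J : Finset (Fin k)) (c : Cl V k) : ℝ := if sat σ J c then 1 else κ

def W (κ : ℝ) (P : Finset (Fin m)) (J : Fin m → Finset (Fin k)) (Φ : Fin m → Cl V k) (σ : V → Bool) : ℝ :=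
  ∏ i ∈ P, wt κ σ (J i) (Φ i)

def Z (κ : ℝ) (P : Finset (Fin m)) (J : Fin m → Finset (Fin k)) (Φ : Fin m → Cl V k) : ℝ :=
  ∑ σ : V → Bool, W κ P J Φ σ

def Zl (κ : ℝ) (P : Finset (Fin m)) (J : Fin m → Finset (Fin k)) (Φ : Fin m → Cl V k) (l : V × Bool) : ℝ :=
  ∑ σ : V → Bool, ind (σ l.1 = l.2) * W κ P J Φ σ

/-- frozen literals -/
def frz (κ : ℝ) (P : Finset (Fin m)) (J : Fin m → Finset (Fin k)) (Φ : Fin m → Cl V k) (s : ℝ) :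
    Finset (V × Bool) :=
  univ.filter fun l => Zl κ P J Φ l < Real.exp (-s) * Z κ P J Φ

def rho (κ : ℝ) (P : Finset (Fin m)) (J : Fin m → Finset (Fin k)) (Φ : Fin m → Cl V k) (s : ℝ) : ℝ :=
  avg fun l : V × Bool => ind (l ∈ frz κ P J Φ s)

variable {κ : ℝ} (h0 : 0 < κ) (h1 : κ ≤ 1)

include h0 in
lemma wt_pos (σ : V → Bool) (J : Finset (Fin k)) (c : Cl V k) : 0 < wt κ σ J c := by
  unfold wt; split_ifs <;> linarith
include h1 in
lemma wt_le_one (σ : V → Bool) (J : Finset (Fin k)) (c : Cl V k) : wt κ σ J c ≤ 1 := by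
  unfold wt; split_ifs <;> linarith
include h1 in
lemma le_wt (σ : V → Bool) (J : Finset (Fin k)) (c : Cl V k) : κ ≤ wt κ σ J c := by
  unfold wt; split_ifs <;> linarith
lemma wt_of_sat {σ : V → Bool} {J : Finset (Fin k)} {c : Cl V k} (h : sat σ J c) : wt κ σ J c = 1 := if_pos h
lemma wt_eq (σ : V → Bool) (J : Finset (Fin k)) (c : Cl V k) : wt κ σ J c = 1 - (1 - κ) * ind (¬ sat σ J c) := by
  unfold wt ind; split_ifs <;> simp_all

include h0 in
lemma W_pos (P : Finset (Fin m)) (J : Fin m → Finset (Fin k)) (Φ : Fin m → Cl V k) (σ : V → Bool) : 0 < W κ P J Φ σ :=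
  Finset.prod_pos fun _ _ => wt_pos h0 _ _ _
include h0 h1 in
lemma W_le_one (P : Finset (Fin m)) (J : Fin m → Finset (Fin k)) (Φ : Fin m → Cl V k) (σ : V → Bool) : W κ P J Φ σ ≤ 1 :=
  Finset.prod_le_one (fun _ _ => (wt_pos h0 _ _ _).le) fun _ _ => wt_le_one h1 _ _ _
include h0 in
lemma Z_pos (P : Finset (Fin m)) (J : Fin m → Finset (Fin k)) (Φ : Fin m → Cl V k) : 0 < Z κ P J Φ :=
  Finset.sum_pos (fun σ _ => W_pos h0 P J Φ σ) Finset.univ_nonempty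

lemma W_insert {P : Finset (Fin m)} {i : Fin m} (hi : i ∉ P) (J : Fin m → Finset (Fin k)) (Φ : Fin m → Cl V k) (σ : V → Bool) :
    W κ (insert i P) J Φ σ = wt κ σ (J i) (Φ i) * W κ P J Φ σ := Finset.prod_insert hi

lemma W_congr {P : Finset (Fin m)} {J J' : Fin m → Finset (Fin k)} {Φ Ψ : Fin m → Cl V k}
    (h : ∀ i ∈ P, Φ i = Ψ i) (hJ : ∀ i ∈ P, J i = J' i) (σ : V → Bool) : W κ P J Φ σ = W κ P J' Ψ σ := by
  unfold W; apply Finset.prod_congr rfl; intro i hi; rw [h i hi, hJ i hi]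

lemma Z_congr {P : Finset (Fin m)} {J J' : Fin m → Finset (Fin k)} {Φ Ψ : Fin m → Cl V k}
    (h : ∀ i ∈ P, Φ i = Ψ i) (hJ : ∀ i ∈ P, J i = J' i) : Z κ P J Φ = Z κ P J' Ψ := by
  unfold Z; apply Finset.sum_congr rfl; intro σ _; exact W_congr h hJ σ

lemma Zl_congr {P : Finset (Fin m)} {J J' : Fin m → Finset (Fin k)} {Φ Ψ : Fin m → Cl V k}
    (h : ∀ i ∈ P, Φ i = Ψ i) (hJ : ∀ i ∈ P, J i = J' i) (l : V × Bool) : Zl κ P J Φ l = Zl κ P J' Ψ l := by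
  unfold Zl; apply Finset.sum_congr rfl; intro σ _; rw [W_congr h hJ σ]

lemma frz_congr {P : Finset (Fin m)} {J J' : Fin m → Finset (Fin k)} {Φ Ψ : Fin m → Cl V k}
    (h : ∀ i ∈ P, Φ i = Ψ i) (hJ : ∀ i ∈ P, J i = J' i) (s : ℝ) : frz κ P J Φ s = frz κ P J' Ψ s := by
  unfold frz; apply Finset.filter_congr; intro l _; rw [Zl_congr h hJ, Z_congr h hJ]

lemma rho_congr {P : Finset (Fin m)} {J J' : Fin m → Finset (Fin k)} {Φ Ψ : Fin m → Cl V k}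
    (h : ∀ i ∈ P, Φ i = Ψ i) (hJ : ∀ i ∈ P, J i = J' i) (s : ℝ) : rho κ P J Φ s = rho κ P J' Ψ s := by
  unfold rho; rw [frz_congr h hJ]

include h0 h1 in
lemma Z_insert_le {P : Finset (Fin m)} {i : Fin m} (hi : i ∉ P) (J : Fin m → Finset (Fin k)) (Φ : Fin m → Cl V k) :
    Z κ (insert i P) J Φ ≤ Z κ P J Φ := by
  unfold Z; apply Finset.sum_le_sum; intro σ _
  rw [W_insert hi]
  exact mul_le_of_le_one_left (W_pos h0 _ _ _ _).le (wt_le_one h1 _ _ _)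

include h0 h1 in
lemma le_Z_insert {P : Finset (Fin m)} {i : Fin m} (hi : i ∉ P) (J : Fin m → Finset (Fin k)) (Φ : Fin m → Cl V k) :
    κ * Z κ P J Φ ≤ Z κ (insert i P) J Φ := by
  unfold Z; rw [Finset.mul_sum]; apply Finset.sum_le_sum; intro σ _
  rw [W_insert hi]
  exact mul_le_mul_of_nonneg_right (le_wt h1 _ _ _) (W_pos h0 _ _ _ _).le

include h0 in
lemma Zl_le_Z_insert {P : Finset (Fin m)} {i : Fin m} (hi : i ∉ P) (J : Fin m → Finset (Fin k)) (Φ : Fin m → Cl V k)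
    {j : Fin k} (hj : j ∈ J i) : Zl κ P J Φ (Φ i j) ≤ Z κ (insert i P) J Φ := by
  unfold Z Zl; apply Finset.sum_le_sum; intro σ _
  rw [W_insert hi]
  apply mul_le_mul_of_nonneg_right _ (W_pos h0 _ _ _ _).le
  apply ind_le_of
  · intro h; rw [wt_of_sat ⟨j, hj, h⟩]
  · exact (wt_pos h0 _ _ _).le

include h0 in
lemma mem_frz_of_lt {P : Finset (Fin m)} {i : Fin m} (hi : i ∉ P) (J : Fin m → Finset (Fin k)) (Φ : Fin m → Cl V k)
    {s : ℝ} (h : Z κ (insert i P) J Φ < Real.exp (-s) * Z κ P J Φ) {j : Fin k} (hj : j ∈ J i) :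
    Φ i j ∈ frz κ P J Φ s := by
  unfold frz; rw [Finset.mem_filter]
  exact ⟨Finset.mem_univ _, (Zl_le_Z_insert h0 hi J Φ hj).trans_lt h⟩

lemma avg_all_mem (J : Finset (Fin k)) (A : Finset (V × Bool)) [Nonempty V] :
    avg (fun c : Cl V k => ind (∀ j ∈ J, c j ∈ A)) = (avg fun l => ind (l ∈ A)) ^ J.card := by
  have : ∀ c : Cl V k, ind (∀ j ∈ J, c j ∈ A) = ∏ j, (if j ∈ J then ind (c j ∈ A) else 1) := by
    intro c
    have := ind_forall (fun j => j ∈ J → c j ∈ A)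
    rw [show ind (∀ j ∈ J, c j ∈ A) = ind (∀ j, (j ∈ J → c j ∈ A)) from rfl, this]
    apply Finset.prod_congr rfl; intro j _
    by_cases hj : j ∈ J <;> simp [hj, ind]
  simp_rw [this]
  rw [avg_pi_prod (fun j l => if j ∈ J then ind (l ∈ A) else 1)]
  have : ∀ j : Fin k, (avg fun l : V × Bool => if j ∈ J then ind (l ∈ A) else 1)
      = if j ∈ J then avg (fun l => ind (l ∈ A)) else 1 := by
    intro j; split_ifs
    · rfl
    · exact avg_const 1
  simp_rw [this]
  rw [Finset.prod_ite]; simp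

lemma rho_nonneg (P : Finset (Fin m)) (J : Fin m → Finset (Fin k)) (Φ : Fin m → Cl V k) (s : ℝ) : 0 ≤ rho κ P J Φ s :=
  avg_nonneg fun _ => ind_nonneg _
lemma rho_le_one (P : Finset (Fin m)) (J : Fin m → Finset (Fin k)) (Φ : Fin m → Cl V k) (s : ℝ) : rho κ P J Φ s ≤ 1 :=
  avg_le_const zero_le_one fun _ => ind_le_one _

include h0 in
lemma step_prob [Nonempty V] {P : Finset (Fin m)} {i : Fin m} (hi : i ∉ P) (J : Fin m → Finset (Fin k)) (s : ℝ) :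
    avg (fun Φ : Fin m → Cl V k => ind (Z κ (insert i P) J Φ < Real.exp (-s) * Z κ P J Φ))
      ≤ avg fun Φ : Fin m → Cl V k => rho κ P J Φ s ^ (J i).card := by
  rw [← avg_update i]
  apply avg_mono; intro Φ
  unfold rho
  rw [← avg_all_mem]
  apply avg_mono; intro c
  apply ind_mono
  intro h j hj
  have := mem_frz_of_lt h0 hi J (Function.update Φ i c) h hj
  rw [Function.update_self] at this
  rwa [frz_congr (Φ := Function.update Φ i c) (Ψ := Φ) (J' := J) _ (fun _ _ => rfl)] at this
  intro i' hi'
  rw [Function.update_of_ne]; rintro rfl; exact hi hi'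

/-! ### Gibbs weights: overlaps -/

def sg (b : Bool) : ℝ := if b then 1 else -1
lemma sg_sq (b : Bool) : sg b * sg b = 1 := by cases b <;> simp [sg]

def ovl (σ τ : V → Bool) : ℝ := avg fun x => sg (σ x) * sg (τ x)

lemma ovl_le_one (σ τ : V → Bool) : ovl σ τ ≤ 1 :=
  avg_le_const zero_le_one fun x => by cases σ x <;> cases τ x <;> simp [sg]
lemma neg_one_le_ovl (σ τ : V → Bool) : -1 ≤ ovl σ τ := by
  unfold ovl; rw [← neg_neg (avg _), neg_le_neg_iff, ← avg_neg]
  exact avg_le_const zero_le_one fun x => by cases σ x <;> cases τ x <;> simp [sg]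

def far (η : ℝ) (w : (V → Bool) → ℝ) : ℝ := ∑ σ, ∑ τ, ind (η < ovl σ τ) * (w σ * w τ)

lemma avg_bool (f : Bool → ℝ) : avg f = (f true + f false) / 2 := by
  unfold avg; simp

section gibbs
variable {w : (V → Bool) → ℝ} (hw : ∀ σ, 0 ≤ w σ) (hw1 : ∑ σ, w σ = 1) {η : ℝ} (hη : 0 ≤ η)

include hw hw1 hη in
lemma frozen_bound {s : ℝ} (hs : 3 ≤ s) [Nonempty V] :
    avg (fun l : V × Bool => ind ((∑ σ, ind (σ l.1 = l.2) * w σ) < Real.exp (-s))) ≤ η + far η w := by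
  set M : V → ℝ := fun x => ∑ σ, sg (σ x) * w σ with hM
  have hM2 : avg (fun x => M x * M x) ≤ η + far η w := by
    have e : avg (fun x => M x * M x) = ∑ σ, ∑ τ, ovl σ τ * (w σ * w τ) := by
      simp only [hM]
      simp_rw [Finset.sum_mul_sum]
      rw [avg_sum]
      apply Finset.sum_congr rfl; intro σ _
      rw [avg_sum]
      apply Finset.sum_congr rfl; intro τ _
      unfold ovl; rw [← avg_mul_right]
      congr 1; funext x; ring
    rw [e]
    have e2 : η = ∑ σ, ∑ τ, η * (w σ * w τ) := by
      simp_rw [← Finset.mul_sum]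
      simp [hw1]
    unfold far
    conv_rhs => lhs; rw [e2]
    rw [← Finset.sum_add_distrib]
    apply Finset.sum_le_sum; intro σ _
    rw [← Finset.sum_add_distrib]
    apply Finset.sum_le_sum; intro τ _
    rw [← add_mul]
    apply mul_le_mul_of_nonneg_right _ (mul_nonneg (hw σ) (hw τ))
    by_cases h : η < ovl σ τ
    · rw [ind_true h]; linarith [ovl_le_one σ τ]
    · rw [ind_false h]; linarith
  refine le_trans ?_ hM2
  rw [avg_prod]
  apply avg_mono; intro x
  rw [avg_bool]
  have hs' : Real.exp (-s) ≤ 1/8 := by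
    have : Real.exp (-s) ≤ Real.exp (-3) := Real.exp_le_exp.2 (by linarith)
    refine this.trans ?_
    rw [Real.exp_neg, show (1/8:ℝ) = 8⁻¹ by norm_num]
    apply inv_anti₀ (by norm_num)
    have := Real.exp_one_gt_d9
    have h3 : Real.exp 3 = Real.exp 1 ^ 3 := by rw [← Real.exp_nat_mul]; norm_num
    rw [h3]
    calc (8:ℝ) = 2 ^ 3 := by norm_num
      _ ≤ _ := by gcongr; linarith
  set a := ∑ σ, ind (σ x = true) * w σ
  set b := ∑ σ, ind (σ x = false) * w σ
  have hab : a + b = 1 := by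
    rw [← hw1, ← Finset.sum_add_distrib]
    apply Finset.sum_congr rfl; intro σ _
    cases σ x <;> simp [ind]
  have hMx : M x = a - b := by
    simp only [hM, a, b]; rw [← Finset.sum_sub_distrib]
    apply Finset.sum_congr rfl; intro σ _
    cases σ x <;> simp [ind, sg]
  have ha : 0 ≤ a := Finset.sum_nonneg fun σ _ => mul_nonneg (ind_nonneg _) (hw σ)
  have hb : 0 ≤ b := Finset.sum_nonneg fun σ _ => mul_nonneg (ind_nonneg _) (hw σ)
  rw [hMx]
  by_cases ca : a < Real.exp (-s)
  · have cb : ¬ b < Real.exp (-s) := by intro h; linarith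
    rw [ind_true ca, ind_false cb]; nlinarith
  · rw [ind_false ca]
    by_cases cb : b < Real.exp (-s)
    · rw [ind_true cb]; nlinarith
    · rw [ind_false cb]; nlinarith [mul_self_nonneg (a - b)]

lemma viol_eq (σ : V → Bool) (c : Cl V k) : ind (¬ sat σ univ c) = ∏ j, ind (σ (c j).1 ≠ (c j).2) := by
  rw [← ind_forall]; unfold sat; congr 1; simp

lemma avg_viol1 [Nonempty V] (σ : V → Bool) : avg (fun c : Cl V k => ind (¬ sat σ univ c)) = (1/2) ^ k := by
  simp_rw [viol_eq]
  rw [avg_pi_prod (fun (_ : Fin k) (l : V × Bool) => ind (σ l.1 ≠ l.2))]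
  have : avg (fun l : V × Bool => ind (σ l.1 ≠ l.2)) = 1/2 := by
    rw [avg_prod]
    have : ∀ x, (avg fun b => ind (σ x ≠ b)) = 1/2 := by
      intro x; rw [avg_bool]; cases σ x <;> simp [ind]
    simp_rw [this]; exact avg_const _
  rw [this]; simp

lemma avg_viol2 [Nonempty V] (σ τ : V → Bool) : avg (fun c : Cl V k => ind (¬ sat σ univ c) * ind (¬ sat τ univ c))
    = ((1 + ovl σ τ)/4) ^ k := by
  simp_rw [viol_eq, ← Finset.prod_mul_distrib]
  rw [avg_pi_prod (fun (_ : Fin k) (l : V × Bool) => ind (σ l.1 ≠ l.2) * ind (τ l.1 ≠ l.2))]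
  have : avg (fun l : V × Bool => ind (σ l.1 ≠ l.2) * ind (τ l.1 ≠ l.2)) = (1 + ovl σ τ)/4 := by
    rw [avg_prod]
    have : ∀ x, (avg fun b => ind (σ x ≠ b) * ind (τ x ≠ b)) = (1 + sg (σ x) * sg (τ x))/4 := by
      intro x; rw [avg_bool]; cases σ x <;> cases τ x <;> norm_num [ind, sg]
    simp_rw [this]; rw [avg_div, avg_add, avg_const]; rfl
  rw [this]; simp [div_pow]

lemma avg_viol3 [Nonempty V] (σ τ υ : V → Bool) :
    avg (fun c : Cl V k => ind (¬ sat σ univ c) * ind (¬ sat τ univ c) * ind (¬ sat υ univ c))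
    = ((1 + ovl σ τ + ovl σ υ + ovl τ υ)/8) ^ k ∧ 0 ≤ 1 + ovl σ τ + ovl σ υ + ovl τ υ := by
  have key : avg (fun l : V × Bool => ind (σ l.1 ≠ l.2) * ind (τ l.1 ≠ l.2) * ind (υ l.1 ≠ l.2))
      = (1 + ovl σ τ + ovl σ υ + ovl τ υ)/8 := by
    rw [avg_prod]
    have : ∀ x, (avg fun b => ind (σ x ≠ b) * ind (τ x ≠ b) * ind (υ x ≠ b))
        = (1 + sg (σ x) * sg (τ x) + sg (σ x) * sg (υ x) + sg (τ x) * sg (υ x))/8 := by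
      intro x; rw [avg_bool]; cases σ x <;> cases τ x <;> cases υ x <;> norm_num [ind, sg]
    simp_rw [this]; rw [avg_div, avg_add, avg_add, avg_add, avg_const]; rfl
  constructor
  · simp_rw [viol_eq, ← Finset.prod_mul_distrib]
    rw [avg_pi_prod (fun (_ : Fin k) (l : V × Bool) => ind (σ l.1 ≠ l.2) * ind (τ l.1 ≠ l.2) * ind (υ l.1 ≠ l.2)), key]; simp [div_pow]
  · have : 0 ≤ (1 + ovl σ τ + ovl σ υ + ovl τ υ)/8 := by
      rw [← key]; exact avg_nonneg fun l => mul_nonneg (mul_nonneg (ind_nonneg _) (ind_nonneg _)) (ind_nonneg _)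
    linarith

/-- Gibbs probability that a clause is violated -/
def pv (w : (V → Bool) → ℝ) (c : Cl V k) : ℝ := ∑ σ, w σ * ind (¬ sat σ univ c)

include hw in
lemma pv_nonneg (c : Cl V k) : 0 ≤ pv w c := Finset.sum_nonneg fun σ _ => mul_nonneg (hw σ) (ind_nonneg _)
include hw hw1 in
lemma pv_le_one (c : Cl V k) : pv w c ≤ 1 := by
  rw [← hw1]; exact Finset.sum_le_sum fun σ _ => mul_le_of_le_one_right (hw σ) (ind_le_one _)

include hw1 in
lemma avg_pv [Nonempty V] : avg (fun c : Cl V k => pv w c) = (1/2) ^ k := by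
  unfold pv; rw [avg_sum]
  simp_rw [avg_mul, avg_viol1]
  rw [← Finset.sum_mul, hw1, one_mul]

include hw hw1 hη in
lemma avg_pv2 [Nonempty V] : avg (fun c : Cl V k => pv w c ^ 2) ≤ ((1+η)/4) ^ k + far η w := by
  have e : avg (fun c : Cl V k => pv w c ^ 2) = ∑ σ, ∑ τ, ((1 + ovl σ τ)/4) ^ k * (w σ * w τ) := by
    simp_rw [sq, pv, Finset.sum_mul_sum]
    rw [avg_sum]; apply Finset.sum_congr rfl; intro σ _
    rw [avg_sum]; apply Finset.sum_congr rfl; intro τ _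
    rw [← avg_viol2, ← avg_mul_right]
    congr 1; funext c; ring
  have e2 : ((1+η)/4) ^ k = ∑ σ, ∑ τ, ((1+η)/4) ^ k * (w σ * w τ) := by
    simp_rw [← Finset.mul_sum]
    simp [hw1]
  rw [e, e2]; unfold far
  rw [← Finset.sum_add_distrib]
  apply Finset.sum_le_sum; intro σ _
  rw [← Finset.sum_add_distrib]
  apply Finset.sum_le_sum; intro τ _
  rw [← add_mul]
  apply mul_le_mul_of_nonneg_right _ (mul_nonneg (hw σ) (hw τ))
  have h1 := neg_one_le_ovl σ τ
  have h2 := ovl_le_one σ τ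
  by_cases h : η < ovl σ τ
  · rw [ind_true h]
    have : ((1 + ovl σ τ)/4) ^ k ≤ 1 := pow_le_one₀ (by linarith) (by linarith)
    have : 0 ≤ ((1 + η)/4) ^ k := by positivity
    linarith
  · rw [ind_false h]
    push Not at h
    have : ((1 + ovl σ τ)/4) ^ k ≤ ((1 + η)/4) ^ k := by
      apply pow_le_pow_left₀ <;> linarith
    linarith

include hw hw1 hη in
lemma avg_pv3 [Nonempty V] : avg (fun c : Cl V k => pv w c ^ 3) ≤ ((1+3*η)/8) ^ k + 3 * far η w := by
  have e : avg (fun c : Cl V k => pv w c ^ 3)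
      = ∑ σ, ∑ τ, ∑ υ, ((1 + ovl σ τ + ovl σ υ + ovl τ υ)/8) ^ k * (w σ * w τ * w υ) := by
    have : ∀ c : Cl V k, pv w c ^ 3 = pv w c * pv w c * pv w c := fun c => by ring
    simp_rw [this, pv, Finset.sum_mul_sum, Finset.sum_mul]
    rw [avg_sum]; apply Finset.sum_congr rfl; intro σ _
    rw [avg_sum]; apply Finset.sum_congr rfl; intro τ _
    rw [avg_sum]; apply Finset.sum_congr rfl; intro υ _
    rw [← (avg_viol3 σ τ υ).1, ← avg_mul_right]
    congr 1; funext c; ring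
  have m1 : ∀ f : (V → Bool) → ℝ, ∑ σ, f σ * w σ = ∑ σ, f σ * w σ * ∑ τ, w τ := by intro f; rw [hw1]; simp
  have e2 : ((1+3*η)/8) ^ k = ∑ σ, ∑ τ, ∑ υ, ((1+3*η)/8) ^ k * (w σ * w τ * w υ) := by
    simp_rw [← Finset.mul_sum]
    simp [hw1, ← Finset.mul_sum]
  have f1 : far η w = ∑ σ, ∑ τ, ∑ υ, ind (η < ovl σ τ) * (w σ * w τ * w υ) := by
    unfold far
    simp [hw1, ← Finset.mul_sum]
  have f2 : far η w = ∑ σ, ∑ τ, ∑ υ, ind (η < ovl σ υ) * (w σ * w τ * w υ) := by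
    unfold far
    apply Finset.sum_congr rfl; intro σ _
    rw [Finset.sum_comm]
    apply Finset.sum_congr rfl; intro τ _
    have : ∀ y, ind (η < ovl σ τ) * (w σ * w y * w τ) = ind (η < ovl σ τ) * (w σ * w τ) * w y := fun y => by ring
    simp_rw [this]
    rw [← Finset.mul_sum, hw1, mul_one]
  have f3 : far η w = ∑ σ, ∑ τ, ∑ υ, ind (η < ovl τ υ) * (w σ * w τ * w υ) := by
    have : ∀ σ τ υ, ind (η < ovl τ υ) * (w σ * w τ * w υ) = w σ * (ind (η < ovl τ υ) * (w τ * w υ)) := fun _ _ _ => by ring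
    simp_rw [this, ← Finset.mul_sum]
    rw [← Finset.sum_mul, hw1, one_mul]; rfl
  have f0 : 3 * far η w = far η w + far η w + far η w := by ring
  rw [e, e2, f0]
  conv_rhs => rw [← add_assoc, ← add_assoc]
  nth_rewrite 1 [f1]
  nth_rewrite 1 [f2]
  rw [f3]
  simp_rw [← Finset.sum_add_distrib]
  apply Finset.sum_le_sum; intro σ _
  apply Finset.sum_le_sum; intro τ _
  apply Finset.sum_le_sum; intro υ _
  simp_rw [← add_mul]
  apply mul_le_mul_of_nonneg_right _ (mul_nonneg (mul_nonneg (hw σ) (hw τ)) (hw υ))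
  have h1 := ovl_le_one σ τ
  have h2 := ovl_le_one σ υ
  have h3 := ovl_le_one τ υ
  have hn := (avg_viol3 (k := k) σ τ υ).2
  have i1 := ind_nonneg (η < ovl σ τ)
  have i2 := ind_nonneg (η < ovl σ υ)
  have i3 := ind_nonneg (η < ovl τ υ)
  have b1 : ((1 + ovl σ τ + ovl σ υ + ovl τ υ)/8) ^ k ≤ 1 := pow_le_one₀ (by linarith) (by linarith)
  have b2 : 0 ≤ ((1 + 3*η)/8) ^ k := by positivity
  by_cases c1 : η < ovl σ τ
  · rw [ind_true c1]; linarith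
  by_cases c2 : η < ovl σ υ
  · rw [ind_true c2]; linarith
  by_cases c3 : η < ovl τ υ
  · rw [ind_true c3]; linarith
  push Not at c1 c2 c3
  have : ((1 + ovl σ τ + ovl σ υ + ovl τ υ)/8) ^ k ≤ ((1 + 3*η)/8) ^ k := by
    apply pow_le_pow_left₀ <;> linarith
  linarith

end gibbs
end model
end KS

namespace KS

section drift
variable {V : Type} [Fintype V] {k m : ℕ}

def gw (κ : ℝ) (P : Finset (Fin m)) (J : Fin m → Finset (Fin k)) (Φ : Fin m → Cl V k) (σ : V → Bool) : ℝ :=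
  W κ P J Φ σ / Z κ P J Φ

def Fr (η κ : ℝ) (P : Finset (Fin m)) (J : Fin m → Finset (Fin k)) (Φ : Fin m → Cl V k) : ℝ := far η (gw κ P J Φ)

lemma gw_nonneg {κ : ℝ} (h0 : 0 < κ) (P : Finset (Fin m)) (J : Fin m → Finset (Fin k)) (Φ : Fin m → Cl V k) (σ : V → Bool) :
    0 ≤ gw κ P J Φ σ := div_nonneg (W_pos h0 _ _ _ _).le (Z_pos h0 _ _ _).le

lemma gw_sum {κ : ℝ} (h0 : 0 < κ) (P : Finset (Fin m)) (J : Fin m → Finset (Fin k)) (Φ : Fin m → Cl V k) :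
    ∑ σ, gw κ P J Φ σ = 1 := by
  unfold gw; rw [← Finset.sum_div]; exact div_self (Z_pos h0 _ _ _).ne'

lemma Fr_nonneg {κ : ℝ} (h0 : 0 < κ) (η : ℝ) (P : Finset (Fin m)) (J : Fin m → Finset (Fin k)) (Φ : Fin m → Cl V k) :
    0 ≤ Fr η κ P J Φ := by
  unfold Fr far
  exact Finset.sum_nonneg fun σ _ => Finset.sum_nonneg fun τ _ =>
    mul_nonneg (ind_nonneg _) (mul_nonneg (gw_nonneg h0 _ _ _ _) (gw_nonneg h0 _ _ _ _))

lemma Fr_le_one {κ : ℝ} (h0 : 0 < κ) (η : ℝ) (P : Finset (Fin m)) (J : Fin m → Finset (Fin k)) (Φ : Fin m → Cl V k) :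
    Fr η κ P J Φ ≤ 1 := by
  unfold Fr far
  have : ∑ σ, ∑ τ, gw κ P J Φ σ * gw κ P J Φ τ = 1 := by
    rw [← Finset.sum_mul_sum, gw_sum h0, one_mul]
  rw [← this]
  exact Finset.sum_le_sum fun σ _ => Finset.sum_le_sum fun τ _ =>
    mul_le_of_le_one_left (mul_nonneg (gw_nonneg h0 _ _ _ _) (gw_nonneg h0 _ _ _ _)) (ind_le_one _)

lemma rho_le {κ : ℝ} (h0 : 0 < κ) [Nonempty V] {η : ℝ} (hη : 0 ≤ η) {s : ℝ} (hs : 3 ≤ s)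
    (P : Finset (Fin m)) (J : Fin m → Finset (Fin k)) (Φ : Fin m → Cl V k) :
    rho κ P J Φ s ≤ η + Fr η κ P J Φ := by
  have := frozen_bound (gw_nonneg h0 P J Φ) (gw_sum h0 P J Φ) hη hs
  unfold Fr
  refine le_trans (le_of_eq ?_) this
  unfold rho; congr 1; funext l
  unfold frz gw; rw [Finset.mem_filter]
  congr 1
  simp only [Finset.mem_univ, true_and]
  have e : ∑ σ, ind (σ l.1 = l.2) * (W κ P J Φ σ / Z κ P J Φ) = Zl κ P J Φ l / Z κ P J Φ := by
    unfold Zl; rw [Finset.sum_div]; apply Finset.sum_congr rfl; intro σ _; ring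
  rw [e, div_lt_iff₀ (Z_pos h0 _ _ _)]

lemma Z_insert_pv {κ : ℝ} (h0 : 0 < κ) {P : Finset (Fin m)} {i : Fin m} (hi : i ∉ P) (J : Fin m → Finset (Fin k))
    (hJ : J i = univ) (Φ : Fin m → Cl V k) :
    Z κ (insert i P) J Φ = Z κ P J Φ * (1 - (1 - κ) * pv (gw κ P J Φ) (Φ i)) := by
  have hz := (Z_pos h0 P J Φ).ne'
  have e : Z κ P J Φ * pv (gw κ P J Φ) (Φ i) = ∑ σ, W κ P J Φ σ * ind (¬ sat σ univ (Φ i)) := by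
    unfold pv gw; rw [Finset.mul_sum]; apply Finset.sum_congr rfl; intro σ _; field_simp
  have : Z κ P J Φ * (1 - (1 - κ) * pv (gw κ P J Φ) (Φ i)) = Z κ P J Φ - (1 - κ) * (Z κ P J Φ * pv (gw κ P J Φ) (Φ i)) := by ring
  rw [this, e, Finset.mul_sum]
  unfold Z; rw [← Finset.sum_sub_distrib]
  apply Finset.sum_congr rfl; intro σ _
  rw [W_insert hi, wt_eq, hJ]; ring

lemma neglog_le {p : ℝ} (hp : 0 ≤ p) (hp1 : p < 1) (h3 : -Real.log (1 - p) ≤ 3) :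
    -Real.log (1 - p) ≤ p + p ^ 2 / 2 + 24 * p ^ 3 := by
  by_cases h : p ≤ 1/2
  · have := Real.abs_log_sub_add_sum_range_le (x := p) (by rw [abs_of_nonneg hp]; exact hp1) 2
    rw [abs_of_nonneg hp] at this
    simp only [Finset.sum_range_succ, Finset.sum_range_zero] at this
    have h2 := (abs_le.1 this).1
    have h4 : p ^ (2+1) / (1 - p) ≤ 2 * p ^ 3 := by
      rw [div_le_iff₀ (by linarith)]
      have h5 : 0 ≤ p ^ 3 := by positivity
      have h6 : p ^ (2 + 1) = p ^ 3 := rfl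
      rw [h6]
      nlinarith
    have : 0 ≤ p ^ 3 := by positivity
    norm_num at h2 h4
    linarith
  · push Not at h
    have : (1/2)^3 ≤ p ^ 3 := by gcongr
    nlinarith [sq_nonneg p]

lemma dyadic_tail {x : ℝ} (J : ℕ) (hx : x ≤ 3 * 2 ^ J) :
    x * ind (3 < x) ≤ ∑ j ∈ range J, 3 * 2 ^ (j+1) * ind (3 * 2 ^ j < x) := by
  induction J with
  | zero => simp at hx; rw [ind_false (by linarith)]; simp
  | succ J ih =>
    rw [Finset.sum_range_succ]
    by_cases h : x ≤ 3 * 2 ^ J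
    · have := ih h
      have := ind_nonneg (3 * 2 ^ J < x)
      have : 0 ≤ 3 * 2 ^ (J+1) * ind (3 * 2 ^ J < x) := by positivity
      linarith
    · push Not at h
      rw [ind_true h, mul_one]
      have h3 : 3 < x := by
        have : (1:ℝ) ≤ 2 ^ J := one_le_pow₀ (by norm_num)
        linarith
      rw [ind_true h3, mul_one]
      have : 0 ≤ ∑ j ∈ range J, 3 * 2 ^ (j+1) * ind (3 * 2 ^ j < x) :=
        Finset.sum_nonneg fun j _ => mul_nonneg (by positivity) (ind_nonneg _)
      linarith

lemma drift [Nonempty V] {S : ℝ} (hS : 0 < S) {η : ℝ} (hη : 0 ≤ η) (L : ℕ) (hL : S ≤ 3 * 2 ^ L)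
    {P : Finset (Fin m)} {i : Fin m} (hi : i ∉ P) (J : Fin m → Finset (Fin k)) (hJ : J i = univ) :
    avg (fun Φ : Fin m → Cl V k => Real.log (Z (Real.exp (-S)) P J Φ))
      - avg (fun Φ : Fin m → Cl V k => Real.log (Z (Real.exp (-S)) (insert i P) J Φ))
    ≤ (1/2) ^ k + ((1+η)/4) ^ k / 2 + 24 * ((1+3*η)/8) ^ k
      + 73 * avg (fun Φ : Fin m → Cl V k => Fr η (Real.exp (-S)) P J Φ)
      + ∑ j ∈ range L, 3 * 2 ^ (j+1) * avg (fun Φ : Fin m → Cl V k => rho (Real.exp (-S)) P J Φ (3 * 2 ^ j) ^ k) := by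
  set κ := Real.exp (-S) with hκ
  have h0 : 0 < κ := Real.exp_pos _
  have h1 : κ < 1 := by rw [hκ, Real.exp_lt_one_iff]; linarith
  -- pointwise
  have key : ∀ Φ : Fin m → Cl V k, Real.log (Z κ P J Φ) - Real.log (Z κ (insert i P) J Φ)
      ≤ (pv (gw κ P J Φ) (Φ i) + pv (gw κ P J Φ) (Φ i) ^ 2 / 2 + 24 * pv (gw κ P J Φ) (Φ i) ^ 3)
        + ∑ j ∈ range L, 3 * 2 ^ (j+1) * ind (Z κ (insert i P) J Φ < Real.exp (-(3 * 2 ^ j)) * Z κ P J Φ) := by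
    intro Φ
    have hz := Z_pos h0 P J Φ
    have hz' := Z_pos h0 (insert i P) J Φ
    set p := pv (gw κ P J Φ) (Φ i) with hp
    have hp0 : 0 ≤ p := pv_nonneg (gw_nonneg h0 P J Φ) _
    have hp1 : p ≤ 1 := pv_le_one (gw_nonneg h0 P J Φ) (gw_sum h0 P J Φ) _
    have hZi := Z_insert_pv h0 hi J hJ Φ
    rw [← hp] at hZi
    set p' := (1 - κ) * p with hp'
    have q0 : 0 ≤ p' := mul_nonneg (by linarith) hp0
    have q1 : p' ≤ p := by rw [hp']; nlinarith
    have q2 : p' < 1 := by rw [hp']; nlinarith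
    set Λ := -Real.log (1 - p') with hΛ
    have eΛ : Real.log (Z κ P J Φ) - Real.log (Z κ (insert i P) J Φ) = Λ := by
      rw [hZi, Real.log_mul hz.ne' (by linarith)]; ring
    have eind : ∀ s : ℝ, (Z κ (insert i P) J Φ < Real.exp (-s) * Z κ P J Φ) ↔ s < Λ := by
      intro s
      rw [hZi, mul_comm, mul_lt_mul_iff_left₀ hz, hΛ, ← Real.log_lt_iff_lt_exp (by linarith)]
      constructor <;> intro h <;> linarith
    have hΛS : Λ ≤ S := by
      rw [← eΛ]
      have := le_Z_insert h0 h1.le hi J Φ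
      have := Real.log_le_log (mul_pos h0 hz) this
      rw [Real.log_mul h0.ne' hz.ne', hκ, Real.log_exp] at this
      linarith
    rw [eΛ]
    simp_rw [eind]
    have hd := dyadic_tail L (hΛS.trans hL)
    have hb : p' + p' ^ 2 / 2 + 24 * p' ^ 3 ≤ p + p ^ 2 / 2 + 24 * p ^ 3 := by gcongr
    have hb0 : 0 ≤ p' + p' ^ 2 / 2 + 24 * p' ^ 3 := by positivity
    by_cases h3 : 3 < Λ
    · rw [ind_true h3] at hd; linarith
    · rw [ind_false h3] at hd
      push Not at h3
      have := neglog_le q0 q2 h3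
      linarith
  rw [← avg_sub]
  refine (avg_mono key).trans ?_
  rw [avg_add]
  apply add_le_add
  · rw [← avg_update i]
    have hgw : ∀ (Φ : Fin m → Cl V k) c, gw κ P J (Function.update Φ i c) = gw κ P J Φ := by
      intro Φ c
      have h : ∀ i' ∈ P, (Function.update Φ i c) i' = Φ i' := by
        intro i' hi'; rw [Function.update_of_ne]; rintro rfl; exact hi hi'
      funext σ; unfold gw
      rw [W_congr h (fun _ _ => rfl), Z_congr h (fun _ _ => rfl)]
    simp_rw [hgw, Function.update_self]
    rw [show (1/2:ℝ) ^ k + ((1+η)/4) ^ k / 2 + 24 * ((1+3*η)/8) ^ k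
      + 73 * avg (fun Φ : Fin m → Cl V k => Fr η κ P J Φ) =
      avg (fun Φ : Fin m → Cl V k => ((1/2:ℝ) ^ k + ((1+η)/4) ^ k / 2 + 24 * ((1+3*η)/8) ^ k) + 73 * Fr η κ P J Φ) by
        rw [avg_add, avg_const, avg_mul]]
    apply avg_mono; intro Φ
    rw [avg_add, avg_add, avg_pv (gw_sum h0 P J Φ), avg_div, avg_mul]
    have a2 := avg_pv2 (k := k) (gw_nonneg h0 P J Φ) (gw_sum h0 P J Φ) hη
    have a3 := avg_pv3 (k := k) (gw_nonneg h0 P J Φ) (gw_sum h0 P J Φ) hη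
    have a4 := Fr_nonneg h0 η P J Φ
    unfold Fr at *
    linarith
  · rw [avg_sum]
    apply Finset.sum_le_sum; intro j _
    rw [avg_mul]
    apply mul_le_mul_of_nonneg_left _ (by positivity)
    have := step_prob (V := V) h0 hi J (3 * 2 ^ j)
    rw [hJ] at this
    simpa using this

lemma Fr_compare {κ : ℝ} (h0 : 0 < κ) (h1 : κ ≤ 1) (η : ℝ) {P Q : Finset (Fin m)} (hQ : Q ⊆ P) {e : ℕ} (he : (P \ Q).card ≤ e)
    {J J' : Fin m → Finset (Fin k)} (hJ : ∀ i ∈ Q, J i = J' i) (Φ : Fin m → Cl V k) :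
    Fr η κ P J Φ ≤ (κ ^ (2 * e))⁻¹ * Fr η κ Q J' Φ := by
  have hW : ∀ σ, W κ P J Φ σ = W κ (P \ Q) J Φ σ * W κ Q J' Φ σ := by
    intro σ
    rw [← W_congr (J := J) (J' := J') (Φ := Φ) (Ψ := Φ) (fun _ _ => rfl) hJ]
    unfold W; rw [Finset.prod_sdiff hQ]
  have hle : ∀ σ, W κ P J Φ σ ≤ W κ Q J' Φ σ := fun σ => by
    rw [hW]; exact mul_le_of_le_one_left (W_pos h0 _ _ _ _).le (W_le_one h0 h1 _ _ _ _)
  have hge : ∀ σ, κ ^ e * W κ Q J' Φ σ ≤ W κ P J Φ σ := fun σ => by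
    rw [hW]; apply mul_le_mul_of_nonneg_right _ (W_pos h0 _ _ _ _).le
    calc κ ^ e ≤ κ ^ (P \ Q).card := pow_le_pow_of_le_one h0.le h1 he
      _ ≤ _ := by
        unfold W; rw [← Finset.prod_const]
        exact Finset.prod_le_prod (fun _ _ => h0.le) fun _ _ => le_wt h1 _ _ _
  have hZ : κ ^ e * Z κ Q J' Φ ≤ Z κ P J Φ := by
    unfold Z; rw [Finset.mul_sum]; exact Finset.sum_le_sum fun σ _ => hge σ
  have zq := Z_pos h0 Q J' Φ
  have zp := Z_pos h0 P J Φ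
  have hg : ∀ σ, gw κ P J Φ σ ≤ (κ ^ e)⁻¹ * gw κ Q J' Φ σ := fun σ => by
    unfold gw
    have hk : 0 < κ ^ e := by positivity
    calc W κ P J Φ σ / Z κ P J Φ ≤ W κ Q J' Φ σ / (κ ^ e * Z κ Q J' Φ) := by
          apply div_le_div₀ (W_pos h0 _ _ _ _).le (hle σ) (by positivity) hZ
      _ = _ := by field_simp
  unfold Fr far
  rw [Finset.mul_sum]; apply Finset.sum_le_sum; intro σ _
  rw [Finset.mul_sum]; apply Finset.sum_le_sum; intro τ _
  calc ind (η < ovl σ τ) * (gw κ P J Φ σ * gw κ P J Φ τ)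
      ≤ ind (η < ovl σ τ) * (((κ ^ e)⁻¹ * gw κ Q J' Φ σ) * ((κ ^ e)⁻¹ * gw κ Q J' Φ τ)) := by
        apply mul_le_mul_of_nonneg_left _ (ind_nonneg _)
        apply mul_le_mul (hg σ) (hg τ) (gw_nonneg h0 _ _ _ _)
        exact mul_nonneg (by positivity) (gw_nonneg h0 _ _ _ _)
    _ = _ := by rw [two_mul, pow_add, mul_inv]; ring

/-- log Z is Lipschitz -/
lemma logZ_lip {S : ℝ} (hS : 0 ≤ S) (P : Finset (Fin m)) (J : Fin m → Finset (Fin k)) (i : Fin m)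
    (Φ : Fin m → Cl V k) (c : Cl V k) :
    |Real.log (Z (Real.exp (-S)) P J (Function.update Φ i c)) - Real.log (Z (Real.exp (-S)) P J Φ)| ≤ S := by
  set κ := Real.exp (-S) with hκ
  have h0 : 0 < κ := Real.exp_pos _
  have h1 : κ ≤ 1 := Real.exp_le_one_iff.2 (by linarith)
  by_cases hi : i ∈ P
  · have hP : P = insert i (P.erase i) := (Finset.insert_erase hi).symm
    have hn : i ∉ P.erase i := Finset.notMem_erase _ _
    have hc : Z κ (P.erase i) J (Function.update Φ i c) = Z κ (P.erase i) J Φ :=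
      Z_congr (fun i' hi' => by rw [Function.update_of_ne (Finset.ne_of_mem_erase hi')]) (fun _ _ => rfl)
    have a1 := le_Z_insert h0 h1 hn J Φ
    have a2 := Z_insert_le h0 h1 hn J Φ
    have b1 := le_Z_insert h0 h1 hn J (Function.update Φ i c)
    have b2 := Z_insert_le h0 h1 hn J (Function.update Φ i c)
    rw [← hP] at a1 a2 b1 b2
    rw [hc] at b1 b2
    have z0 := Z_pos h0 (P.erase i) J Φ
    have z1 := Z_pos h0 P J Φ
    have z2 := Z_pos h0 P J (Function.update Φ i c)
    have la1 := Real.log_le_log (mul_pos h0 z0) a1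
    have lb1 := Real.log_le_log (mul_pos h0 z0) b1
    have la2 := Real.log_le_log z1 a2
    have lb2 := Real.log_le_log z2 b2
    rw [Real.log_mul h0.ne' z0.ne', hκ, Real.log_exp] at la1 lb1
    rw [abs_le]; constructor <;> linarith
  · rw [Z_congr (Φ := Function.update Φ i c) (Ψ := Φ) (J' := J) _ (fun _ _ => rfl)]
    · simpa using hS
    · intro i' hi'; rw [Function.update_of_ne]; rintro rfl; exact hi hi'

end drift
end KS

namespace KS

section annealed
variable {V : Type} [Fintype V] {k m : ℕ}

abbrev JF (m k : ℕ) : Fin m → Finset (Fin k) := fun _ => univ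

lemma sum_ind {α : Type*} (s : Finset α) (p : α → Prop) [DecidablePred p] :
    ∑ x ∈ s, ind (p x) = ((s.filter p).card : ℝ) := by
  rw [Finset.card_filter]; push_cast
  apply Finset.sum_congr rfl; intro x _
  by_cases h : p x
  · rw [ind_true h, if_pos h]
  · rw [ind_false h, if_neg h]

def dst (σ τ : V → Bool) : ℕ := (univ.filter fun x => σ x ≠ τ x).card

lemma dst_le (σ τ : V → Bool) : dst σ τ ≤ Fintype.card V := by
  unfold dst; exact (Finset.card_filter_le _ _)

lemma dst_avg (σ τ : V → Bool) : avg (fun x => ind (σ x ≠ τ x)) = dst σ τ / Fintype.card V := by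
  unfold avg dst; rw [sum_ind]

lemma ovl_dst [Nonempty V] (σ τ : V → Bool) : ovl σ τ = 1 - 2 * (dst σ τ / Fintype.card V) := by
  rw [← dst_avg]; unfold ovl
  rw [← avg_mul, ← avg_const (α := V) 1, ← avg_sub]
  congr 1; funext x; cases σ x <;> cases τ x <;> norm_num [ind, sg]

/-- generating function of distances -/
lemma sum_dst (σ : V → Bool) (u : ℝ) : ∑ τ : V → Bool, u ^ dst σ τ = (1 + u) ^ Fintype.card V := by
  have : ∀ τ : V → Bool, u ^ dst σ τ = ∏ x, (if σ x ≠ τ x then u else 1) := by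
    intro τ; rw [Finset.prod_ite]; simp [dst]
  simp_rw [this]
  have h := Finset.prod_univ_sum (fun _ : V => (univ : Finset Bool)) (fun x b => if σ x ≠ b then u else 1)
  simp only [Fintype.piFinset_univ] at h
  rw [← h]
  rw [Finset.prod_congr rfl (g := fun _ => 1 + u)]
  · simp
  · intro x _; rw [Fintype.sum_bool]; cases σ x <;> simp [add_comm]

lemma count_dst (σ : V → Bool) {u : ℝ} (hu : 0 < u) (d : ℕ) :
    ∑ τ : V → Bool, ind (dst σ τ = d) ≤ (1 + u) ^ Fintype.card V / u ^ d := by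
  rw [le_div_iff₀ (by positivity), ← sum_dst σ u, Finset.sum_mul]
  apply Finset.sum_le_sum; intro τ _
  by_cases h : dst σ τ = d
  · rw [ind_true h, h, one_mul]
  · rw [ind_false h, zero_mul]; positivity

lemma avg_W_prod (Q : Finset (Fin m)) (g : Cl V k → ℝ) [Nonempty V] :
    avg (fun Φ : Fin m → Cl V k => ∏ i ∈ Q, g (Φ i)) = (avg g) ^ Q.card := by
  have : ∀ Φ : Fin m → Cl V k, ∏ i ∈ Q, g (Φ i) = ∏ i, (if i ∈ Q then g (Φ i) else 1) := by
    intro Φ; rw [Finset.prod_ite_mem]; simp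
  simp_rw [this]
  rw [avg_pi_prod (fun i c => if i ∈ Q then g c else 1)]
  have : ∀ i : Fin m, (avg fun c : Cl V k => if i ∈ Q then g c else 1)
      = if i ∈ Q then avg g else 1 := by
    intro j; split_ifs
    · rfl
    · exact avg_const 1
  simp_rw [this]
  rw [Finset.prod_ite]; simp

lemma avg_wt [Nonempty V] (κ : ℝ) (σ : V → Bool) : avg (fun c : Cl V k => wt κ σ univ c) = 1 - (1-κ) * (1/2)^k := by
  simp_rw [wt_eq]; rw [avg_sub, avg_const, avg_mul, avg_viol1]

lemma avg_wt2 [Nonempty V] {κ : ℝ} (h0 : 0 < κ) (h1 : κ ≤ 1) (σ τ : V → Bool) :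
    avg (fun c : Cl V k => wt κ σ univ c * wt κ τ univ c)
      ≤ Real.exp (-2 * (1/2)^k + 2 * κ + ((1 + ovl σ τ)/4) ^ k) := by
  have e : ∀ c : Cl V k, wt κ σ univ c * wt κ τ univ c
    = 1 - (1-κ) * ind (¬ sat σ univ c) - (1-κ) * ind (¬ sat τ univ c)
      + (1-κ)^2 * (ind (¬ sat σ univ c) * ind (¬ sat τ univ c)) := by
    intro c; rw [wt_eq, wt_eq]; ring
  simp_rw [e]
  rw [avg_add, avg_sub, avg_sub, avg_const, avg_mul, avg_mul, avg_mul, avg_viol1, avg_viol1, avg_viol2]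
  have hx : 0 ≤ ((1 + ovl σ τ)/4) ^ k := by
    have := neg_one_le_ovl σ τ
    exact pow_nonneg (by linarith) _
  have hp : (1/2:ℝ)^k ≤ 1 := pow_le_one₀ (by norm_num) (by norm_num)
  have hp0 : 0 ≤ (1/2:ℝ)^k := by positivity
  refine le_trans ?_ (Real.add_one_le_exp _)
  have q1 : (1-κ)^2 ≤ 1 := by nlinarith
  have q2 : (1-κ)^2 * ((1 + ovl σ τ)/4) ^ k ≤ ((1 + ovl σ τ)/4) ^ k := mul_le_of_le_one_left hx q1
  nlinarith

def X1 (κ η δ : ℝ) (Q : Finset (Fin m)) (Φ : Fin m → Cl V k) : ℝ :=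
  ∑ σ : V → Bool, ∑ τ : V → Bool, ind (η < ovl σ τ ∧ δ * Fintype.card V < dst σ τ)
    * (W κ Q (JF m k) Φ σ * W κ Q (JF m k) Φ τ)

lemma avg_X1 [Nonempty V] {κ : ℝ} (h0 : 0 < κ) (h1 : κ ≤ 1) (η δ B : ℝ) (Q : Finset (Fin m))
    (hB : ∀ d : ℕ, d ≤ Fintype.card V → η < 1 - 2 * ((d:ℝ) / Fintype.card V) → δ * Fintype.card V < d →
      ∃ u : ℝ, 0 < u ∧ (Fintype.card V : ℝ) * Real.log (1 + u) - d * Real.log u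
        + Q.card * (-2 * (1/2)^k + 2 * κ + ((1 + (1 - 2 * ((d:ℝ) / Fintype.card V)))/4) ^ k) ≤ B) :
    avg (fun Φ : Fin m → Cl V k => X1 κ η δ Q Φ)
      ≤ 2 ^ Fintype.card V * ((Fintype.card V + 1) * Real.exp B) := by
  set n := Fintype.card V with hn
  unfold X1
  rw [avg_sum]
  have hσ : ∀ σ : V → Bool, avg (fun Φ : Fin m → Cl V k => ∑ τ : V → Bool, ind (η < ovl σ τ ∧ δ * n < dst σ τ)
    * (W κ Q (JF m k) Φ σ * W κ Q (JF m k) Φ τ)) ≤ (n + 1) * Real.exp B := by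
    intro σ
    rw [avg_sum]
    set G : ℕ → ℝ := fun d => Q.card * (-2 * (1/2)^k + 2 * κ + ((1 + (1 - 2 * ((d:ℝ) / n)))/4) ^ k) with hG
    have b1 : ∀ τ : V → Bool, avg (fun Φ : Fin m → Cl V k => ind (η < ovl σ τ ∧ δ * n < dst σ τ)
      * (W κ Q (JF m k) Φ σ * W κ Q (JF m k) Φ τ))
      ≤ ∑ d ∈ range (n+1), ind (dst σ τ = d) * (ind (η < 1 - 2 * ((d:ℝ) / n) ∧ δ * n < d) * Real.exp (G d)) := by
      intro τ
      rw [avg_mul]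
      have e1 : avg (fun Φ : Fin m → Cl V k => W κ Q (JF m k) Φ σ * W κ Q (JF m k) Φ τ) ≤ Real.exp (G (dst σ τ)) := by
        simp_rw [W, ← Finset.prod_mul_distrib]
        rw [avg_W_prod Q (fun c : Cl V k => wt κ σ univ c * wt κ τ univ c)]
        have := avg_wt2 (k := k) h0 h1 σ τ
        calc _ ≤ (Real.exp (-2 * (1/2)^k + 2 * κ + ((1 + ovl σ τ)/4) ^ k)) ^ Q.card := by
              apply pow_le_pow_left₀ _ this
              exact avg_nonneg fun c => mul_nonneg (wt_pos h0 _ _ _).le (wt_pos h0 _ _ _).le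
          _ = _ := by rw [← Real.exp_nat_mul, ovl_dst]
      have hm : dst σ τ ∈ range (n+1) := by rw [Finset.mem_range]; have := dst_le σ τ; omega
      refine le_trans ?_ (Finset.single_le_sum (f := fun d : ℕ => ind (dst σ τ = d) * (ind (η < 1 - 2 * ((d:ℝ) / n) ∧ δ * n < d) * Real.exp (G d)))
        (fun d _ => mul_nonneg (ind_nonneg _) (mul_nonneg (ind_nonneg _) (Real.exp_pos _).le)) hm)
      rw [ind_true (rfl : dst σ τ = dst σ τ), one_mul, ovl_dst]
      exact mul_le_mul_of_nonneg_left e1 (ind_nonneg _)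
    refine (Finset.sum_le_sum fun τ _ => b1 τ).trans ?_
    rw [Finset.sum_comm]
    have : ((n:ℝ) + 1) * Real.exp B = ∑ d ∈ range (n+1), Real.exp B := by simp
    rw [this]
    apply Finset.sum_le_sum; intro d hd
    rw [← Finset.sum_mul]
    by_cases hc : η < 1 - 2 * ((d:ℝ) / n) ∧ δ * n < d
    · rw [ind_true hc, one_mul]
      obtain ⟨u, hu, hB'⟩ := hB d (by rw [Finset.mem_range] at hd; omega) hc.1 hc.2
      calc _ ≤ (1 + u) ^ n / u ^ d * Real.exp (G d) :=
            mul_le_mul_of_nonneg_right (count_dst σ hu d) (Real.exp_pos _).le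
        _ = Real.exp (n * Real.log (1 + u) - d * Real.log u + G d) := by
            rw [Real.exp_add, Real.exp_sub, Real.exp_nat_mul (Real.log (1 + u)), Real.exp_nat_mul (Real.log u), Real.exp_log hu, Real.exp_log (by linarith)]
        _ ≤ _ := Real.exp_le_exp.2 hB'
    · rw [ind_false hc]; simp [(Real.exp_pos B).le]
  refine (Finset.sum_le_sum fun σ _ => hσ σ).trans ?_
  simp [hn]

/-! ### the second part -/

lemma fiber_compare {ι C T : Type*} [Fintype ι] [DecidableEq ι] [Fintype C] [Fintype T] (t : C → T)
    (w w' : ι → C → ℝ) (hw : ∀ i c, 0 ≤ w i c)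
    (h : ∀ i a, ∑ c ∈ univ.filter (fun c => t c = a), w i c ≤ ∑ c ∈ univ.filter (fun c => t c = a), w' i c)
    (g : (ι → T) → ℝ) (hg : ∀ T, 0 ≤ g T) :
    ∑ Φ : ι → C, g (fun i => t (Φ i)) * ∏ i, w i (Φ i) ≤ ∑ Φ : ι → C, g (fun i => t (Φ i)) * ∏ i, w' i (Φ i) := by
  have key : ∀ w : ι → C → ℝ, ∑ Φ : ι → C, g (fun i => t (Φ i)) * ∏ i, w i (Φ i)
      = ∑ T, g T * ∏ i, ∑ c ∈ univ.filter (fun c => t c = T i), w i c := by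
    intro w
    rw [← Finset.sum_fiberwise (s := univ) (g := fun Φ : ι → C => fun i => t (Φ i))]
    apply Finset.sum_congr rfl; intro T _
    rw [Finset.prod_univ_sum, Finset.mul_sum]
    have : univ.filter (fun Φ : ι → C => (fun i => t (Φ i)) = T) = Fintype.piFinset fun i => univ.filter (fun c => t c = T i) := by
      ext Φ; simp [funext_iff]
    rw [this]
    apply Finset.sum_congr rfl; intro Φ hΦ
    congr 2
    rw [Fintype.mem_piFinset] at hΦ
    funext i; exact (Finset.mem_filter.1 (hΦ i)).2
  rw [key, key]
  apply Finset.sum_le_sum; intro T _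
  apply mul_le_mul_of_nonneg_left _ (hg T)
  exact Finset.prod_le_prod (fun i _ => Finset.sum_nonneg fun c _ => hw i c) fun i _ => h i _

def crit (σ : V → Bool) (j : Fin k) (c : Cl V k) : Prop :=
  σ (c j).1 = (c j).2 ∧ ∀ j', j' ≠ j → σ (c j').1 ≠ (c j').2

def typ (σ : V → Bool) (c : Cl V k) : Option V := if h : ∃ j, crit σ j c then some (c (Classical.choose h)).1 else none

lemma typ_of_crit {σ : V → Bool} {j : Fin k} {c : Cl V k} (h : crit σ j c) : typ σ c = some (c j).1 := by
  have h' : ∃ j, crit σ j c := ⟨j, h⟩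
  unfold typ; rw [dif_pos h']
  have hs := Classical.choose_spec h'
  set j' := Classical.choose h'
  by_cases e : j' = j
  · rw [e]
  · exact absurd hs.1 (h.2 j' e)

lemma typ_some {σ : V → Bool} {c : Cl V k} {x : V} (h : typ σ c = some x) : ∃ j, crit σ j c ∧ (c j).1 = x := by
  by_cases h' : ∃ j, crit σ j c
  · obtain ⟨j, hj⟩ := h'
    rw [typ_of_crit hj] at h
    exact ⟨j, hj, by simpa using h⟩
  · unfold typ at h; rw [dif_neg h'] at h; simp at h

lemma sat_of_typ {σ : V → Bool} {c : Cl V k} {x : V} (h : typ σ c = some x) : sat σ univ c := by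
  obtain ⟨j, hj, _⟩ := typ_some h
  exact ⟨j, mem_univ _, hj.1⟩

lemma ind_typ (σ : V → Bool) (c : Cl V k) (x : V) : ind (typ σ c = some x) = ∑ j, ind (crit σ j c ∧ (c j).1 = x) := by
  by_cases h : typ σ c = some x
  · rw [ind_true h]
    obtain ⟨j, hj, hx⟩ := typ_some h
    rw [Finset.sum_eq_single j]
    · rw [ind_true ⟨hj, hx⟩]
    · intro j' _ hne
      rw [ind_false]; rintro ⟨h', _⟩; exact hj.2 j' hne h'.1
    · simp
  · rw [ind_false h]; symm
    apply Finset.sum_eq_zero; intro j _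
    rw [ind_false]; rintro ⟨h1, h2⟩; apply h; rw [typ_of_crit h1, h2]

lemma crit_prod (σ : V → Bool) (c : Cl V k) (x : V) (j : Fin k) :
    ind (crit σ j c ∧ (c j).1 = x) = ∏ j', (if j' = j then ind (c j' = (x, σ x)) else ind (σ (c j').1 ≠ (c j').2)) := by
  have : (crit σ j c ∧ (c j).1 = x) ↔ ∀ j', (if j' = j then c j' = (x, σ x) else σ (c j').1 ≠ (c j').2) := by
    constructor
    · rintro ⟨⟨h1, h2⟩, h3⟩ j'
      split_ifs with e
      · subst e; ext1
        · exact h3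
        · rw [← h1, h3]
      · exact h2 j' e
    · intro h
      have hj := h j
      rw [if_pos rfl] at hj
      refine ⟨⟨by rw [hj], fun j' e => ?_⟩, by rw [hj]⟩
      have := h j'; rwa [if_neg e] at this
  rw [show ind (crit σ j c ∧ (c j).1 = x) = ind (∀ j', (if j' = j then c j' = (x, σ x) else σ (c j').1 ≠ (c j').2)) by simp only [this], ind_forall]
  apply Finset.prod_congr rfl; intro j' _
  split_ifs <;> rfl

lemma avg_eq_lit (l₀ : V × Bool) : avg (fun l => ind (l = l₀)) = 1 / (2 * Fintype.card V) := by
  unfold avg; rw [sum_ind]; simp [Finset.filter_eq', mul_comm]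

lemma avg_false [Nonempty V] (σ : V → Bool) : avg (fun l : V × Bool => ind (σ l.1 ≠ l.2)) = 1/2 := by
  rw [avg_prod]
  have : ∀ x, (avg fun b => ind (σ x ≠ b)) = 1/2 := by
    intro x; rw [avg_bool]; cases σ x <;> simp [ind]
  simp_rw [this]; exact avg_const _

lemma avg_false_diff [Nonempty V] (σ τ : V → Bool) : avg (fun l : V × Bool => ind (σ l.1 ≠ l.2) * ind (σ l.1 ≠ τ l.1))
    = 1/2 * (dst σ τ / Fintype.card V) := by
  rw [avg_prod, ← dst_avg, ← avg_mul]
  congr 1; funext x; rw [avg_bool]; cases σ x <;> cases τ x <;> norm_num [ind]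

/-- common value of critical probabilities -/
def pcrit (V : Type) [Fintype V] (k : ℕ) : ℝ := 1 / (2 * Fintype.card V) * (1/2)^(k-1)

lemma avg_crit [Nonempty V] (σ : V → Bool) (x : V) (j : Fin k) :
    avg (fun c : Cl V k => ind (crit σ j c ∧ (c j).1 = x)) = pcrit V k := by
  simp_rw [crit_prod]
  rw [avg_pi_prod (fun j' l => if j' = j then ind (l = (x, σ x)) else ind (σ l.1 ≠ l.2))]
  have : ∀ j' : Fin k, (avg fun l : V × Bool => if j' = j then ind (l = (x, σ x)) else ind (σ l.1 ≠ l.2))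
    = if j' = j then 1 / (2 * Fintype.card V : ℝ) else 1/2 := by
    intro j'; split_ifs
    · exact avg_eq_lit _
    · exact avg_false σ
  simp_rw [this]
  rw [Finset.prod_ite, Finset.prod_const, Finset.prod_const]
  have c1 : (univ.filter fun j' : Fin k => j' = j).card = 1 := by rw [Finset.filter_eq']; simp
  have c2 : (univ.filter fun j' : Fin k => ¬ j' = j).card = k - 1 := by
    rw [Finset.filter_ne', Finset.card_erase_of_mem (mem_univ j), Finset.card_univ, Fintype.card_fin]
  rw [c1, c2, pow_one]; rfl

lemma avg_crit_diff [Nonempty V] (σ τ : V → Bool) (x : V) (j j₂ : Fin k) (hj : j₂ ≠ j) :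
    avg (fun c : Cl V k => ind (crit σ j c ∧ (c j).1 = x) * ind (σ (c j₂).1 ≠ τ (c j₂).1))
      = pcrit V k * (dst σ τ / Fintype.card V) := by
  have e : ∀ c : Cl V k, ind (crit σ j c ∧ (c j).1 = x) * ind (σ (c j₂).1 ≠ τ (c j₂).1)
    = ∏ j', (if j' = j then ind (c j' = (x, σ x)) else ind (σ (c j').1 ≠ (c j').2))
        * (if j' = j₂ then ind (σ (c j').1 ≠ τ (c j').1) else 1) := by
    intro c
    rw [crit_prod, Finset.prod_mul_distrib]
    congr 1
    rw [Finset.prod_ite_eq' univ j₂]; simp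
  simp_rw [e]
  rw [avg_pi_prod (fun j' l => (if j' = j then ind (l = (x, σ x)) else ind (σ l.1 ≠ l.2))
        * (if j' = j₂ then ind (σ l.1 ≠ τ l.1) else 1))]
  have : ∀ j' : Fin k, (avg fun l : V × Bool => (if j' = j then ind (l = (x, σ x)) else ind (σ l.1 ≠ l.2))
        * (if j' = j₂ then ind (σ l.1 ≠ τ l.1) else 1))
    = (if j' = j then 1 / (2 * Fintype.card V : ℝ) else 1/2) * (if j' = j₂ then (dst σ τ / Fintype.card V : ℝ) else 1) := by
    intro j'; by_cases h1 : j' = j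
    · have h2 : j' ≠ j₂ := by rw [h1]; exact hj.symm
      simp only [h1, if_true, if_neg hj.symm, mul_one]
      exact avg_eq_lit _
    · by_cases h2 : j' = j₂
      · simp only [h2, if_true, if_neg hj]; exact avg_false_diff σ τ
      · simp only [h1, h2, if_false, mul_one]; exact avg_false σ
  simp_rw [this]
  rw [Finset.prod_mul_distrib, Finset.prod_ite_eq' univ j₂, if_pos (mem_univ _)]
  congr 1
  rw [Finset.prod_ite, Finset.prod_const, Finset.prod_const]
  have c1 : (univ.filter fun j' : Fin k => j' = j).card = 1 := by rw [Finset.filter_eq']; simp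
  have c2 : (univ.filter fun j' : Fin k => ¬ j' = j).card = k - 1 := by
    rw [Finset.filter_ne', Finset.card_erase_of_mem (mem_univ j), Finset.card_univ, Fintype.card_fin]
  rw [c1, c2, pow_one]; rfl

lemma crit_wt_le {κ : ℝ} (h0 : 0 < κ) (h1 : κ ≤ 1) (σ τ : V → Bool) {x : V} (hx : σ x ≠ τ x) (j : Fin k) (c : Cl V k) :
    ind (crit σ j c ∧ (c j).1 = x) * wt κ τ univ c
      ≤ ind (crit σ j c ∧ (c j).1 = x) * κ
        + ∑ j₂ ∈ univ.erase j, ind (crit σ j c ∧ (c j).1 = x) * ind (σ (c j₂).1 ≠ τ (c j₂).1) := by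
  by_cases h : crit σ j c ∧ (c j).1 = x
  · rw [ind_true h]; simp only [one_mul]
    have hn : 0 ≤ ∑ j₂ ∈ univ.erase j, ind (σ (c j₂).1 ≠ τ (c j₂).1) := Finset.sum_nonneg fun _ _ => ind_nonneg _
    by_cases hs : sat τ univ c
    · rw [wt_of_sat hs]
      obtain ⟨j', _, hj'⟩ := hs
      have hne : j' ≠ j := by
        rintro rfl; apply hx; rw [← h.2, h.1.1, hj']
      have : ind (σ (c j').1 ≠ τ (c j').1) = 1 := ind_true (by rw [hj']; exact h.1.2 j' hne)
      have := Finset.single_le_sum (f := fun j₂ => ind (σ (c j₂).1 ≠ τ (c j₂).1)) (fun _ _ => ind_nonneg _)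
        (Finset.mem_erase.2 ⟨hne, mem_univ j'⟩)
      linarith
    · unfold wt; rw [if_neg hs]; linarith
  · rw [ind_false h]; simp

lemma avg_typ_wt [Nonempty V] {κ β δ : ℝ} (h0 : 0 < κ) (h1 : κ ≤ 1) (hβ : κ + k * δ ≤ β) (σ τ : V → Bool)
    (hd : (dst σ τ : ℝ) ≤ δ * Fintype.card V) {x : V} (hx : σ x ≠ τ x) :
    avg (fun c : Cl V k => ind (typ σ c = some x) * wt κ τ univ c) ≤ β * avg (fun c : Cl V k => ind (typ σ c = some x)) := by
  simp_rw [ind_typ, Finset.sum_mul]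
  rw [avg_sum, avg_sum, Finset.mul_sum]
  apply Finset.sum_le_sum; intro j _
  refine (avg_mono fun c => crit_wt_le h0 h1 σ τ hx j c).trans ?_
  rw [avg_add, avg_mul_right, avg_sum, avg_crit]
  rw [Finset.sum_congr rfl (g := fun _ => pcrit V k * (dst σ τ / Fintype.card V))
    (fun j₂ hj₂ => avg_crit_diff σ τ x j j₂ (Finset.ne_of_mem_erase hj₂))]
  rw [Finset.sum_const, nsmul_eq_mul]
  have hp : 0 ≤ pcrit V k := by unfold pcrit; positivity
  have hc : ((univ.erase j).card : ℝ) ≤ k := by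
    have : (univ.erase j).card ≤ k := by simp
    exact_mod_cast this
  have hn : (0:ℝ) < Fintype.card V := by exact_mod_cast Fintype.card_pos
  have hd' : (dst σ τ : ℝ) / Fintype.card V ≤ δ := by rwa [div_le_iff₀ hn]
  have hd0 : 0 ≤ (dst σ τ : ℝ) / Fintype.card V := by positivity
  have : ((univ.erase j).card : ℝ) * ((dst σ τ : ℝ) / Fintype.card V) ≤ k * δ := by gcongr
  nlinarith

end annealed
end KS

namespace KS

section close
variable {V : Type} [Fintype V] {k m : ℕ}

def nT (Q : Finset (Fin m)) (T : Fin m → Option V) (x : V) : ℕ := (Q.filter fun i => T i = some x).card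
def yT (β : ℝ) (Q : Finset (Fin m)) (T : Fin m → Option V) : ℝ := ∏ x, (1 + β ^ nT Q T x)
def bT (β : ℝ) (U : V → Prop) (t : Option V) : ℝ := t.elim 1 fun x => if U x then β else 1

lemma prod_bT (β : ℝ) (U : V → Prop) (Q : Finset (Fin m)) (T : Fin m → Option V) :
    ∏ i ∈ Q, bT β U (T i) = ∏ x, (if U x then β ^ nT Q T x else 1) := by
  rw [← Finset.prod_fiberwise Q T, Fintype.prod_option]
  have h0 : ∏ i ∈ Q with T i = none, bT β U (T i) = 1 := by
    apply Finset.prod_eq_one; intro i hi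
    rw [(Finset.mem_filter.1 hi).2]; rfl
  rw [h0, one_mul]
  apply Finset.prod_congr rfl; intro x _
  have : ∏ i ∈ Q with T i = some x, bT β U (T i) = ∏ i ∈ Q with T i = some x, (if U x then β else 1) := by
    apply Finset.prod_congr rfl; intro i hi
    rw [(Finset.mem_filter.1 hi).2]; rfl
  rw [this, Finset.prod_const]
  split_ifs
  · rfl
  · simp

lemma bT_nonneg {β : ℝ} (h : 0 ≤ β) (U : V → Prop) (t : Option V) : 0 ≤ bT β U t := by
  unfold bT; cases t with
  | none => simp
  | some x => simp only [Option.elim]; split_ifs <;> linarith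

lemma sum_bT (β : ℝ) (σ : V → Bool) (Q : Finset (Fin m)) (T : Fin m → Option V) :
    ∑ τ : V → Bool, ∏ i ∈ Q, bT β (fun x => σ x ≠ τ x) (T i) = yT β Q T := by
  simp_rw [prod_bT]
  have h := Finset.prod_univ_sum (fun _ : V => (univ : Finset Bool)) (fun x b => if σ x ≠ b then β ^ nT Q T x else 1)
  simp only [Fintype.piFinset_univ] at h
  refine Eq.trans ?_ (h.symm.trans ?_)
  · apply Finset.sum_congr rfl; intro τ _; apply Finset.prod_congr rfl; intro x _; congr
  unfold yT
  apply Finset.prod_congr rfl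
  intro x _; rw [Fintype.sum_bool]; cases σ x <;> simp [add_comm]

lemma fiber_compare' {ι C T : Type} [Fintype ι] [DecidableEq ι] [Fintype C] [Fintype T] (t : C → T)
    (w w' : ι → C → ℝ) (hw : ∀ i c, 0 ≤ w i c)
    (h : ∀ i a, ∑ c, ind (t c = a) * w i c ≤ ∑ c, ind (t c = a) * w' i c)
    (g : (ι → T) → ℝ) (hg : ∀ T, 0 ≤ g T) :
    ∑ Φ : ι → C, g (fun i => t (Φ i)) * ∏ i, w i (Φ i) ≤ ∑ Φ : ι → C, g (fun i => t (Φ i)) * ∏ i, w' i (Φ i) := by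
  refine fiber_compare t w w' hw ?_ g hg
  intro i a
  have E : ∀ v : C → ℝ, ∑ c ∈ univ.filter (fun c => t c = a), v c = ∑ c, ind (t c = a) * v c := by
    intro v; rw [Finset.sum_filter]; apply Finset.sum_congr rfl; intro c _
    by_cases hc : t c = a
    · rw [if_pos hc, ind_true hc, one_mul]
    · rw [if_neg hc, ind_false hc, zero_mul]
  rw [E, E]; exact h i a

lemma compare [Nonempty V] {κ β δ : ℝ} (h0 : 0 < κ) (h1 : κ ≤ 1) (hβ : κ + k * δ ≤ β) (σ τ : V → Bool)
    (hd : (dst σ τ : ℝ) ≤ δ * Fintype.card V) (Q : Finset (Fin m)) (g : (Fin m → Option V) → ℝ) (hg : ∀ T, 0 ≤ g T) :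
    avg (fun Φ : Fin m → Cl V k => g (fun i => typ σ (Φ i)) * (W κ Q (JF m k) Φ σ * W κ Q (JF m k) Φ τ))
      ≤ avg (fun Φ : Fin m → Cl V k => g (fun i => typ σ (Φ i)) * (W κ Q (JF m k) Φ σ *
          ∏ i ∈ Q, bT β (fun x => σ x ≠ τ x) (typ σ (Φ i)))) := by
  have E : ∀ (f : Cl V k → ℝ) (Φ : Fin m → Cl V k), ∏ i ∈ Q, f (Φ i) = ∏ i, (if i ∈ Q then f (Φ i) else 1) := by
    intro f Φ; rw [Finset.prod_ite_mem]; simp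
  have := fiber_compare' (ι := Fin m) (C := Cl V k) (T := Option V) (typ σ)
    (fun i c => if i ∈ Q then wt κ σ univ c * wt κ τ univ c else 1)
    (fun i c => if i ∈ Q then wt κ σ univ c * bT β (fun x => σ x ≠ τ x) (typ σ c) else 1)
    (by
      intro i c; split_ifs
      · exact mul_nonneg (wt_pos h0 _ _ _).le (wt_pos h0 _ _ _).le
      · norm_num)
    (by
      intro i a
      split_ifs with hi
      · by_cases ha : ∃ x, a = some x ∧ σ x ≠ τ x
        · obtain ⟨x, rfl, hx⟩ := ha
          have key := avg_typ_wt (k := k) h0 h1 hβ σ τ hd hx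
          rw [← avg_mul] at key
          unfold avg at key
          have hc : (0:ℝ) < Fintype.card (Cl V k) := by exact_mod_cast Fintype.card_pos
          rw [div_le_div_iff_of_pos_right hc] at key
          refine le_trans (le_of_eq ?_) (key.trans (le_of_eq ?_))
          · apply Finset.sum_congr rfl; intro c _
            by_cases h : typ σ c = some x
            · simp only [ind_true h, wt_of_sat (sat_of_typ h), one_mul]
            · simp only [ind_false h, zero_mul]
          · apply Finset.sum_congr rfl; intro c _
            by_cases h : typ σ c = some x
            · simp only [wt_of_sat (sat_of_typ h), h]
              simp [bT, hx]; ring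
            · simp only [ind_false h, zero_mul, mul_zero]
        · apply Finset.sum_le_sum; intro c _
          by_cases h : typ σ c = a
          · rw [ind_true h, one_mul, one_mul]
            apply mul_le_mul_of_nonneg_left _ (wt_pos h0 _ _ _).le
            rw [h]
            have : bT β (fun x => σ x ≠ τ x) a = 1 := by
              cases a with
              | none => rfl
              | some x => exact if_neg (fun hx => ha ⟨x, rfl, hx⟩)
            rw [this]; exact wt_le_one h1 _ _ _
          · rw [ind_false h, zero_mul, zero_mul]
      · exact le_refl _) g hg
  unfold avg
  apply div_le_div_of_nonneg_right _ (by positivity)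
  refine le_trans (le_of_eq ?_) (this.trans (le_of_eq ?_))
  · apply Finset.sum_congr rfl; intro Φ _
    unfold W; beta_reduce; rw [← Finset.prod_mul_distrib, E (fun c => wt κ σ univ c * wt κ τ univ c)]
  · apply Finset.sum_congr rfl; intro Φ _
    unfold W; beta_reduce; rw [← Finset.prod_mul_distrib, E (fun c => wt κ σ univ c * bT β (fun x => σ x ≠ τ x) (typ σ c))]

def Zcl (κ δ : ℝ) (Q : Finset (Fin m)) (Φ : Fin m → Cl V k) (σ : V → Bool) : ℝ :=
  ∑ τ : V → Bool, ind ((dst σ τ : ℝ) ≤ δ * Fintype.card V) * W κ Q (JF m k) Φ τ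

lemma Zcl_nonneg {κ : ℝ} (h0 : 0 < κ) (δ : ℝ) (Q : Finset (Fin m)) (Φ : Fin m → Cl V k) (σ : V → Bool) : 0 ≤ Zcl κ δ Q Φ σ :=
  Finset.sum_nonneg fun τ _ => mul_nonneg (ind_nonneg _) (W_pos h0 _ _ _ _).le

lemma Zcl_le {κ : ℝ} (h0 : 0 < κ) (δ : ℝ) (Q : Finset (Fin m)) (Φ : Fin m → Cl V k) (σ : V → Bool) :
    Zcl κ δ Q Φ σ ≤ Z κ Q (JF m k) Φ :=
  Finset.sum_le_sum fun τ _ => mul_le_of_le_one_left (W_pos h0 _ _ _ _).le (ind_le_one _)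

lemma yT_pos {β : ℝ} (h : 0 ≤ β) (Q : Finset (Fin m)) (T : Fin m → Option V) : 0 < yT β Q T :=
  Finset.prod_pos fun x _ => by positivity

lemma tangent {θ y z : ℝ} (hθ : 0 ≤ θ) (hθ1 : θ ≤ 1) (hy : 0 < y) (hz : 0 ≤ z) :
    z ^ θ ≤ (1 - θ) * y ^ θ + θ * (y ^ (θ - 1) * z) := by
  have h := Real.geom_mean_le_arith_mean2_weighted (w₁ := θ) (w₂ := 1 - θ) hθ (by linarith)
    (p₁ := z / y) (p₂ := 1) (by positivity) zero_le_one (by ring)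
  rw [Real.one_rpow, mul_one, Real.div_rpow hz hy.le, div_le_iff₀ (by positivity)] at h
  rw [Real.rpow_sub_one hy.ne']
  refine h.trans (le_of_eq ?_); field_simp; ring

lemma X2_tangent [Nonempty V] {κ β δ θ : ℝ} (h0 : 0 < κ) (h1 : κ ≤ 1) (hδ : 0 ≤ δ) (hβ : κ + k * δ ≤ β)
    (hθ : 0 ≤ θ) (hθ1 : θ ≤ 1) (σ : V → Bool) (Q : Finset (Fin m)) :
    avg (fun Φ : Fin m → Cl V k => W κ Q (JF m k) Φ σ * Zcl κ δ Q Φ σ ^ θ)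
      ≤ avg (fun Φ : Fin m → Cl V k => W κ Q (JF m k) Φ σ * yT β Q (fun i => typ σ (Φ i)) ^ θ) := by
  have hβ0 : 0 ≤ β := by have : 0 ≤ (k:ℝ) * δ := by positivity
                         linarith
  set y : (Fin m → Cl V k) → ℝ := fun Φ => yT β Q (fun i => typ σ (Φ i)) with hy
  have hyp : ∀ Φ, 0 < y Φ := fun Φ => yT_pos hβ0 _ _
  have A : avg (fun Φ : Fin m → Cl V k => W κ Q (JF m k) Φ σ * (y Φ ^ (θ-1) * Zcl κ δ Q Φ σ))
      ≤ avg (fun Φ : Fin m → Cl V k => W κ Q (JF m k) Φ σ * y Φ ^ θ) := by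
    have e1 : ∀ Φ : Fin m → Cl V k, W κ Q (JF m k) Φ σ * (y Φ ^ (θ-1) * Zcl κ δ Q Φ σ)
      = ∑ τ : V → Bool, ind ((dst σ τ : ℝ) ≤ δ * Fintype.card V) * (y Φ ^ (θ-1) * (W κ Q (JF m k) Φ σ * W κ Q (JF m k) Φ τ)) := by
      intro Φ; unfold Zcl; rw [Finset.mul_sum, Finset.mul_sum]
      apply Finset.sum_congr rfl; intro τ _; ring
    have e2 : ∀ Φ : Fin m → Cl V k, W κ Q (JF m k) Φ σ * y Φ ^ θ
      = ∑ τ : V → Bool, (y Φ ^ (θ-1) * (W κ Q (JF m k) Φ σ * ∏ i ∈ Q, bT β (fun x => σ x ≠ τ x) (typ σ (Φ i)))) := by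
      intro Φ
      rw [← Finset.mul_sum, ← Finset.mul_sum, sum_bT β σ Q (fun i => typ σ (Φ i))]
      have : y Φ ^ θ = y Φ ^ (θ - 1) * y Φ := by rw [Real.rpow_sub_one (hyp Φ).ne', div_mul_cancel₀ _ (hyp Φ).ne']
      rw [this]; simp only [hy]; ring
    simp_rw [e1, e2]
    rw [avg_sum, avg_sum]
    apply Finset.sum_le_sum; intro τ _
    rw [avg_mul]
    by_cases hd : (dst σ τ : ℝ) ≤ δ * Fintype.card V
    · rw [ind_true hd, one_mul]
      exact compare h0 h1 hβ σ τ hd Q (fun T => yT β Q T ^ (θ-1)) fun T => Real.rpow_nonneg (yT_pos hβ0 _ _).le _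
    · rw [ind_false hd, zero_mul]
      apply avg_nonneg; intro Φ
      apply mul_nonneg (Real.rpow_nonneg (hyp Φ).le _)
      exact mul_nonneg (W_pos h0 _ _ _ _).le (Finset.prod_nonneg fun i _ => bT_nonneg hβ0 _ _)
  have B : avg (fun Φ : Fin m → Cl V k => W κ Q (JF m k) Φ σ * Zcl κ δ Q Φ σ ^ θ)
    ≤ avg (fun Φ : Fin m → Cl V k => (1 - θ) * (W κ Q (JF m k) Φ σ * y Φ ^ θ) +
        θ * (W κ Q (JF m k) Φ σ * (y Φ ^ (θ-1) * Zcl κ δ Q Φ σ))) := by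
    apply avg_mono; intro Φ
    have := mul_le_mul_of_nonneg_left (tangent hθ hθ1 (hyp Φ) (Zcl_nonneg h0 δ Q Φ σ)) (W_pos h0 Q (JF m k) Φ σ).le
    refine this.trans (le_of_eq ?_); ring
  rw [avg_add, avg_mul, avg_mul] at B
  nlinarith

lemma gamma_ge {θ : ℝ} (hθ : 0 ≤ θ) : θ ≤ 2 * ((2:ℝ) ^ θ - 1) := by
  have : (2:ℝ) ^ θ = Real.exp (Real.log 2 * θ) := Real.rpow_def_of_pos (by norm_num) θ
  have h := Real.add_one_le_exp (Real.log 2 * θ)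
  have := Real.log_two_gt_d9
  nlinarith

lemma y_factor {θ β : ℝ} (hθ : 0 ≤ θ) (hθ1 : θ ≤ 1) (hβ : 0 ≤ β) (N : ℕ) :
    (1 + β ^ N) ^ θ ≤ 1 + ((2:ℝ) ^ θ - 1) * (2 * β) ^ N := by
  cases N with
  | zero => norm_num
  | succ N =>
    have hp : 0 ≤ β ^ (N+1) := by positivity
    have h1 := rpow_one_add_le_one_add_mul_self (s := β ^ (N+1)) (by linarith) hθ hθ1
    have h2 := gamma_ge hθ
    have h3 : (1:ℝ) ≤ 2 ^ N := one_le_pow₀ (by norm_num)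
    have h4 : θ ≤ ((2:ℝ) ^ θ - 1) * 2 ^ (N+1) := by
      rw [pow_succ]; nlinarith
    rw [mul_pow]; nlinarith

lemma avg_typ_mem [Nonempty V] (hk : 1 ≤ k) (σ : V → Bool) (Y : Finset V) :
    avg (fun c : Cl V k => ∑ x ∈ Y, ind (typ σ c = some x)) = k * (1/2:ℝ)^k * (Y.card / Fintype.card V) := by
  rw [avg_sum]
  simp_rw [ind_typ]
  have : ∀ x, (avg fun c : Cl V k => ∑ j, ind (crit σ j c ∧ (c j).1 = x)) = k * pcrit V k := by
    intro x; rw [avg_sum]; simp_rw [avg_crit]; simp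
  simp_rw [this]
  rw [Finset.sum_const, nsmul_eq_mul]; unfold pcrit
  have hn : (0:ℝ) < Fintype.card V := by exact_mod_cast Fintype.card_pos
  obtain ⟨k', rfl⟩ : ∃ k', k = k' + 1 := ⟨k - 1, by omega⟩
  rw [Nat.add_sub_cancel, pow_succ]; field_simp

lemma wt_bT {κ : ℝ} (b : ℝ) (σ : V → Bool) (Y : Finset V) (c : Cl V k) :
    wt κ σ univ c * bT b (fun x => x ∈ Y) (typ σ c) = wt κ σ univ c - (1 - b) * ∑ x ∈ Y, ind (typ σ c = some x) := by
  cases h : typ σ c with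
  | none => simp [bT, ind]
  | some x =>
    rw [wt_of_sat (sat_of_typ h)]
    have : ∀ y, ind (some x = some y) = if x = y then 1 else 0 := by intro y; simp [ind]
    simp_rw [this]
    rw [Finset.sum_ite_eq]
    simp only [bT, Option.elim]; split_ifs <;> ring

lemma X2_term [Nonempty V] (hk : 1 ≤ k) {κ b : ℝ} (h0 : 0 < κ) (h1 : κ ≤ 1) (hb : 0 ≤ b) (hb1 : b ≤ 1) (σ : V → Bool)
    (Q : Finset (Fin m)) (Y : Finset V) :
    avg (fun Φ : Fin m → Cl V k => W κ Q (JF m k) Φ σ * ∏ i ∈ Q, bT b (fun x => x ∈ Y) (typ σ (Φ i)))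
      ≤ (1 - (1-κ) * (1/2)^k) ^ Q.card * Real.exp (-(k * (1/2)^k * (1-b) * (Q.card / Fintype.card V))) ^ Y.card := by
  have e : ∀ Φ : Fin m → Cl V k, W κ Q (JF m k) Φ σ * ∏ i ∈ Q, bT b (fun x => x ∈ Y) (typ σ (Φ i))
    = ∏ i ∈ Q, (fun c => wt κ σ univ c * bT b (fun x => x ∈ Y) (typ σ c)) (Φ i) := by
    intro Φ; unfold W; rw [← Finset.prod_mul_distrib]
  rw [show (fun Φ : Fin m → Cl V k => W κ Q (JF m k) Φ σ * ∏ i ∈ Q, bT b (fun x => x ∈ Y) (typ σ (Φ i))) = _ from funext e]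
  rw [avg_W_prod Q (fun c : Cl V k => wt κ σ univ c * bT b (fun x => x ∈ Y) (typ σ c))]
  have hnn : 0 ≤ avg (fun c : Cl V k => wt κ σ univ c * bT b (fun x => x ∈ Y) (typ σ c)) :=
    avg_nonneg fun c => mul_nonneg (wt_pos h0 _ _ _).le (bT_nonneg hb _ _)
  have hle : avg (fun c : Cl V k => wt κ σ univ c * bT b (fun x => x ∈ Y) (typ σ c))
      ≤ (1 - (1-κ) * (1/2)^k) * Real.exp (-(k * (1/2)^k * (1-b) * (Y.card / Fintype.card V))) := by
    simp_rw [wt_bT]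
    rw [avg_sub, avg_mul, avg_typ_mem hk, avg_wt]
    set z := (k * (1/2)^k * (1-b) * (Y.card / Fintype.card V) : ℝ)
    have hz : 0 ≤ z := by have : 0 ≤ 1 - b := by linarith
                          positivity
    have ha1 : (1 - (1-κ) * (1/2:ℝ)^k) ≤ 1 := by
      have : 0 ≤ (1-κ) * (1/2:ℝ)^k := mul_nonneg (by linarith) (by positivity)
      linarith
    have ha0 : 0 ≤ (1 - (1-κ) * (1/2:ℝ)^k) := by
      have : (1/2:ℝ)^k ≤ 1 := pow_le_one₀ (by norm_num) (by norm_num)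
      have : 0 ≤ (1/2:ℝ)^k := by positivity
      nlinarith
    have he := Real.add_one_le_exp (-z)
    have : (1 - b) * (k * (1/2)^k * (Y.card / Fintype.card V)) = z := by simp only [z]; ring
    rw [this]; nlinarith
  refine (pow_le_pow_left₀ hnn hle _).trans (le_of_eq ?_)
  rw [mul_pow]; congr 1
  rw [← Real.exp_nat_mul, ← Real.exp_nat_mul]; congr 1; ring

lemma avg_X2 [Nonempty V] (hk : 1 ≤ k) {κ β δ θ : ℝ} (h0 : 0 < κ) (h1 : κ ≤ 1) (hδ : 0 ≤ δ) (hβ : κ + k * δ ≤ β) (hβ1 : 2 * β ≤ 1)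
    (hθ : 0 ≤ θ) (hθ1 : θ ≤ 1) (Q : Finset (Fin m)) :
    avg (fun Φ : Fin m → Cl V k => ∑ σ, W κ Q (JF m k) Φ σ * Zcl κ δ Q Φ σ ^ θ)
      ≤ 2 ^ Fintype.card V * ((1 - (1-κ) * (1/2)^k) ^ Q.card *
        Real.exp (Fintype.card V * (((2:ℝ)^θ - 1) * Real.exp (-(k * (1/2)^k * (1-2*β) * (Q.card / Fintype.card V)))))) := by
  have hβ0 : 0 ≤ β := by have : 0 ≤ (k:ℝ) * δ := by positivity
                         linarith
  have hγ : 0 ≤ (2:ℝ)^θ - 1 := by have := gamma_ge hθ; linarith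
  set q := Real.exp (-(k * (1/2)^k * (1-2*β) * (Q.card / Fintype.card V))) with hq
  set γ := (2:ℝ)^θ - 1 with hγd
  set a := (1 - (1-κ) * (1/2:ℝ)^k) with ha
  have ha0 : 0 ≤ a := by
      have : (1/2:ℝ)^k ≤ 1 := pow_le_one₀ (by norm_num) (by norm_num)
      have : 0 ≤ (1/2:ℝ)^k := by positivity
      nlinarith
  rw [avg_sum]
  have : ∀ σ ∈ (univ : Finset (V → Bool)), avg (fun Φ : Fin m → Cl V k => W κ Q (JF m k) Φ σ * Zcl κ δ Q Φ σ ^ θ)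
      ≤ a ^ Q.card * Real.exp (Fintype.card V * (γ * q)) := by
    intro σ _
    refine (X2_tangent h0 h1 hδ hβ hθ hθ1 σ Q).trans ?_
    have s1 : avg (fun Φ : Fin m → Cl V k => W κ Q (JF m k) Φ σ * yT β Q (fun i => typ σ (Φ i)) ^ θ)
      ≤ avg (fun Φ : Fin m → Cl V k => ∑ Y : Finset V, γ ^ Y.card * (W κ Q (JF m k) Φ σ * ∏ i ∈ Q, bT (2*β) (fun x => x ∈ Y) (typ σ (Φ i)))) := by
      apply avg_mono; intro Φ
      have : ∑ Y : Finset V, γ ^ Y.card * (W κ Q (JF m k) Φ σ * ∏ i ∈ Q, bT (2*β) (fun x => x ∈ Y) (typ σ (Φ i)))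
        = W κ Q (JF m k) Φ σ * ∏ x, (1 + γ * (2*β) ^ nT Q (fun i => typ σ (Φ i)) x) := by
        rw [Finset.prod_one_add, Finset.mul_sum, Finset.powerset_univ]
        apply Finset.sum_congr rfl; intro Y _
        rw [prod_bT (2*β) (fun x => x ∈ Y) Q (fun i => typ σ (Φ i)), Finset.prod_mul_distrib, Finset.prod_const]
        have : ∏ x, (if x ∈ Y then (2 * β) ^ nT Q (fun i => typ σ (Φ i)) x else 1) = ∏ x ∈ Y, (2 * β) ^ nT Q (fun i => typ σ (Φ i)) x := by
          rw [← Finset.prod_filter]; congr 1; ext x; simp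
        rw [← this]; ring_nf
      rw [this]
      apply mul_le_mul_of_nonneg_left _ (W_pos h0 _ _ _ _).le
      unfold yT
      rw [← Real.finsetProd_rpow _ _ (fun x _ => by positivity)]
      exact Finset.prod_le_prod (fun x _ => by positivity) fun x _ => y_factor hθ hθ1 hβ0 _
    refine s1.trans ?_
    rw [avg_sum]
    have s2 : ∑ Y : Finset V, (avg fun Φ : Fin m → Cl V k => γ ^ Y.card * (W κ Q (JF m k) Φ σ * ∏ i ∈ Q, bT (2*β) (fun x => x ∈ Y) (typ σ (Φ i))))
       ≤ ∑ Y : Finset V, γ ^ Y.card * (a ^ Q.card * q ^ Y.card) := by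
      apply Finset.sum_le_sum; intro Y _
      rw [avg_mul]
      exact mul_le_mul_of_nonneg_left (X2_term hk h0 h1 (by linarith) hβ1 σ Q Y) (by positivity)
    refine s2.trans ?_
    have s3 : ∑ Y : Finset V, γ ^ Y.card * (a ^ Q.card * q ^ Y.card) = a ^ Q.card * ∏ _x : V, (1 + γ * q) := by
      rw [Finset.prod_one_add, Finset.mul_sum, Finset.powerset_univ]
      apply Finset.sum_congr rfl; intro Y _
      rw [Finset.prod_const, mul_pow]; ring
    rw [s3]
    apply mul_le_mul_of_nonneg_left _ (by positivity)
    rw [Finset.prod_const, Finset.card_univ, Real.exp_nat_mul]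
    have hq0 : 0 < q := Real.exp_pos _
    apply pow_le_pow_left₀ (by positivity)
    have := Real.add_one_le_exp (γ * q); linarith
  refine (Finset.sum_le_sum this).trans (le_of_eq ?_)
  rw [Finset.sum_const, nsmul_eq_mul]; simp


lemma Fr_split1 [Nonempty V] {κ δ η : ℝ} (h0 : 0 < κ) (Q : Finset (Fin m)) (Φ : Fin m → Cl V k) :
    Fr η κ Q (JF m k) Φ ≤ X1 κ η δ Q Φ / Z κ Q (JF m k) Φ ^ 2
      + ∑ σ, W κ Q (JF m k) Φ σ * (Zcl κ δ Q Φ σ / Z κ Q (JF m k) Φ) / Z κ Q (JF m k) Φ := by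
  have hZ := Z_pos h0 Q (JF m k) Φ
  unfold Fr far X1 Zcl gw
  rw [Finset.sum_div, ← Finset.sum_add_distrib]
  apply Finset.sum_le_sum; intro σ _
  rw [Finset.sum_div, Finset.sum_div, Finset.mul_sum, Finset.sum_div, ← Finset.sum_add_distrib]
  apply Finset.sum_le_sum; intro τ _
  have hσ := W_pos h0 Q (JF m k) Φ σ
  have hτ := W_pos h0 Q (JF m k) Φ τ
  have : ind (η < ovl σ τ) ≤ ind (η < ovl σ τ ∧ δ * Fintype.card V < dst σ τ) + ind ((dst σ τ : ℝ) ≤ δ * Fintype.card V) := by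
    by_cases h : (dst σ τ : ℝ) ≤ δ * Fintype.card V
    · rw [ind_true h]; have := ind_le_one (η < ovl σ τ); have := ind_nonneg (η < ovl σ τ ∧ δ * Fintype.card V < dst σ τ); linarith
    · have h2 := not_le.1 h
      have := ind_mono (p := η < ovl σ τ) (q := η < ovl σ τ ∧ δ * Fintype.card V < dst σ τ) fun h3 => ⟨h3, h2⟩
      have := ind_nonneg ((dst σ τ : ℝ) ≤ δ * Fintype.card V); linarith
  have h3 : 0 ≤ W κ Q (JF m k) Φ σ * W κ Q (JF m k) Φ τ / Z κ Q (JF m k) Φ ^ 2 := by positivity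
  have := mul_le_mul_of_nonneg_right this h3
  refine le_trans (le_of_eq ?_) (this.trans (le_of_eq ?_))
  · field_simp
  · field_simp

lemma Fr_split2 [Nonempty V] {κ δ η θ : ℝ} (h0 : 0 < κ) (hθ : 0 ≤ θ) (hθ1 : θ ≤ 1) (Q : Finset (Fin m)) (Φ : Fin m → Cl V k) :
    Fr η κ Q (JF m k) Φ ≤ X1 κ η δ Q Φ / Z κ Q (JF m k) Φ ^ 2
      + (∑ σ, W κ Q (JF m k) Φ σ * Zcl κ δ Q Φ σ ^ θ) / Z κ Q (JF m k) Φ ^ (1 + θ) := by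
  refine (Fr_split1 (δ := δ) h0 Q Φ).trans ?_
  have hZ := Z_pos h0 Q (JF m k) Φ
  rw [Finset.sum_div]
  apply add_le_add_right
  apply Finset.sum_le_sum; intro σ _
  have hσ := W_pos h0 Q (JF m k) Φ σ
  have hz := Zcl_nonneg h0 δ Q Φ σ
  have hz1 : Zcl κ δ Q Φ σ / Z κ Q (JF m k) Φ ≤ 1 := by rw [div_le_one hZ]; exact Zcl_le h0 δ Q Φ σ
  have : Zcl κ δ Q Φ σ / Z κ Q (JF m k) Φ ≤ (Zcl κ δ Q Φ σ / Z κ Q (JF m k) Φ) ^ θ := by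
    rcases hz.eq_or_lt with h | h
    · rw [← h, zero_div]; exact Real.rpow_nonneg le_rfl _
    · have := Real.rpow_le_rpow_of_exponent_ge (x := Zcl κ δ Q Φ σ / Z κ Q (JF m k) Φ) (y := 1) (z := θ) (by positivity) hz1 hθ1
      rwa [Real.rpow_one] at this
  rw [Real.div_rpow hz hZ.le] at this
  rw [Real.rpow_add hZ, Real.rpow_one]
  calc _ ≤ W κ Q (JF m k) Φ σ * (Zcl κ δ Q Φ σ ^ θ / Z κ Q (JF m k) Φ ^ θ) / Z κ Q (JF m k) Φ := by gcongr
    _ = _ := by field_simp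

lemma vol_le [Nonempty V] {δ : ℝ} (hδ : 0 < δ) (hδ1 : δ ≤ 1) (σ : V → Bool) :
    ∑ τ : V → Bool, ind ((dst σ τ : ℝ) ≤ δ * Fintype.card V) ≤ Real.exp (Fintype.card V * (δ - δ * Real.log δ)) := by
  have e : Real.exp (Fintype.card V * (δ - δ * Real.log δ)) = Real.exp δ ^ Fintype.card V / δ ^ (δ * Fintype.card V) := by
    rw [Real.rpow_def_of_pos hδ, ← Real.exp_nat_mul, ← Real.exp_sub]; congr 1; ring
  have h1 : (1 + δ) ^ Fintype.card V ≤ Real.exp δ ^ Fintype.card V :=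
    pow_le_pow_left₀ (by positivity) (by have := Real.add_one_le_exp δ; linarith) _
  have hp : 0 < δ ^ (δ * Fintype.card V) := Real.rpow_pos_of_pos hδ _
  rw [e, le_div_iff₀ hp]
  refine le_trans ?_ h1
  rw [← sum_dst σ δ, Finset.sum_mul]
  apply Finset.sum_le_sum; intro τ _
  by_cases h : (dst σ τ : ℝ) ≤ δ * Fintype.card V
  · rw [ind_true h, one_mul, ← Real.rpow_natCast]
    exact Real.rpow_le_rpow_of_exponent_ge hδ hδ1 h
  · rw [ind_false h, zero_mul]; positivity

lemma Fr_split3 [Nonempty V] {κ δ η : ℝ} (h0 : 0 < κ) (h1 : κ ≤ 1) (hδ : 0 < δ) (hδ1 : δ ≤ 1) (Q : Finset (Fin m)) (Φ : Fin m → Cl V k) :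
    Fr η κ Q (JF m k) Φ ≤ X1 κ η δ Q Φ / Z κ Q (JF m k) Φ ^ 2
      + Real.exp (Fintype.card V * (δ - δ * Real.log δ)) / Z κ Q (JF m k) Φ := by
  refine (Fr_split1 (δ := δ) h0 Q Φ).trans ?_
  have hZ := Z_pos h0 Q (JF m k) Φ
  apply add_le_add_right
  rw [← Finset.sum_div]
  apply div_le_div_of_nonneg_right _ hZ.le
  set B := Real.exp (Fintype.card V * (δ - δ * Real.log δ))
  calc _ ≤ ∑ σ, W κ Q (JF m k) Φ σ * (B / Z κ Q (JF m k) Φ) := by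
        apply Finset.sum_le_sum; intro σ _
        apply mul_le_mul_of_nonneg_left _ (W_pos h0 _ _ _ _).le
        apply div_le_div_of_nonneg_right _ hZ.le
        refine le_trans ?_ (vol_le hδ hδ1 σ)
        exact Finset.sum_le_sum fun τ _ => mul_le_of_le_one_right (ind_nonneg _) (W_le_one h0 h1 _ _ _ _)
    _ = B := by rw [← Finset.sum_mul]; change Z κ Q (JF m k) Φ * _ = _; field_simp

end close
end KS

namespace KS

section lifting
variable {V : Type} [Fintype V] {k m : ℕ}

@[ext] structure Vy {V : Type} (y : V) : Type where
  val : V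
  property : val ≠ y

def VyE (y : V) : {v : V // v ≠ y} ≃ Vy y :=
  ⟨fun v => ⟨v.1, v.2⟩, fun v => ⟨v.1, v.2⟩, fun _ => rfl, fun _ => rfl⟩

instance instVy (y : V) : Fintype (Vy y) := Fintype.ofEquiv _ (VyE y)

lemma card_Vy (y : V) : Fintype.card (Vy y) + 1 = Fintype.card V := by
  rw [← Fintype.card_congr (VyE y), Fintype.card_subtype_compl, Fintype.card_subtype_eq]
  have : 0 < Fintype.card V := Fintype.card_pos_iff.2 ⟨y⟩
  omega


def lslot (y : V) (q : V × (Vy y × Bool)) : V × Bool := if q.1 = y then (y, q.2.2) else (q.2.1.1, q.2.2)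

lemma lslot_fib (y : V) (l : V × Bool) :
    (univ.filter fun q : V × (Vy y × Bool) => lslot y q = l).card = Fintype.card (Vy y) := by
  by_cases h : l.1 = y
  · have : (univ.filter fun q : V × (Vy y × Bool) => lslot y q = l) = univ.image fun v : Vy y => (y, (v, l.2)) := by
      ext ⟨a, v, b⟩
      rw [mem_filter, mem_image]
      simp only [mem_univ, true_and, lslot, Prod.mk.injEq]
      constructor
      · intro h2
        split_ifs at h2 with h3
        · exact ⟨v, h3.symm, rfl, by rw [← h2]⟩
        · exfalso; rw [← h2] at h; exact v.2 h
      · rintro ⟨w, rfl, rfl, rfl⟩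
        rw [if_pos rfl, ← h]
    rw [this, Finset.card_image_of_injective _ (fun v w hvw => by simpa using hvw), Finset.card_univ]
  · have : (univ.filter fun q : V × (Vy y × Bool) => lslot y q = l) = univ.image fun a : Vy y => (a.1, ((⟨l.1, h⟩ : Vy y), l.2)) := by
      ext ⟨a, v, b⟩
      rw [mem_filter, mem_image]
      simp only [mem_univ, true_and, lslot, Prod.mk.injEq]
      constructor
      · intro h2
        split_ifs at h2 with h3
        · exfalso; rw [← h2] at h; exact h rfl
        · exact ⟨⟨a, h3⟩, rfl, Vy.ext (congrArg Prod.fst h2).symm, by rw [← h2]⟩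
      · rintro ⟨w, rfl, rfl, rfl⟩
        rw [if_neg w.2]
    rw [this, Finset.card_image_of_injective _ (fun v w hvw => Vy.ext (by simpa using hvw)), Finset.card_univ]

lemma fib_pi {ι α β : Type} [Fintype ι] [Fintype α] [Fintype β] (p : α → β) (K : ℕ)
    (h : ∀ b, (univ.filter fun a => p a = b).card = K) (f : ι → β) :
    (univ.filter fun g : ι → α => (fun i => p (g i)) = f).card = K ^ Fintype.card ι := by
  have : (univ.filter fun g : ι → α => (fun i => p (g i)) = f) = Fintype.piFinset fun i => univ.filter fun a => p a = f i := by
    ext g; simp [funext_iff]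
  rw [this, Fintype.card_piFinset]
  simp [h]

def lft (y : V) (M : Fin m → Fin k → V) (Ψ : Fin m → Cl (Vy y) k) : Fin m → Cl V k := fun i j => lslot y (M i j, Ψ i j)

lemma avg_lift (y : V) [Nonempty (Vy y)] (f : (Fin m → Cl V k) → ℝ) :
    avg f = avg fun M : Fin m → Fin k → V => avg fun Ψ : Fin m → Cl (Vy y) k => f (lft y M Ψ) := by
  have h1 := avg_fiber (fun g : Fin m → Fin k → V × (Vy y × Bool) => fun i j => lslot y (g i j))
    ((Fintype.card (Vy y) ^ Fintype.card (Fin k)) ^ Fintype.card (Fin m))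
    (by have : 0 < Fintype.card (Vy y) := Fintype.card_pos
        positivity)
    (by
      intro b
      have := fib_pi (ι := Fin m) (fun g : Fin k → V × (Vy y × Bool) => fun j => lslot y (g j))
        (Fintype.card (Vy y) ^ Fintype.card (Fin k)) (fun b => by
          convert fib_pi (ι := Fin k) (lslot y) (Fintype.card (Vy y)) (fun l => by convert lslot_fib y l) b) b
      convert this) f
  rw [← h1, ← avg_prod (fun p : (Fin m → Fin k → V) × (Fin m → Cl (Vy y) k) => f (lft y p.1 p.2))]
  let e : ((Fin m → Fin k → V) × (Fin m → Cl (Vy y) k)) ≃ (Fin m → Fin k → V × (Vy y × Bool)) :=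
    { toFun := fun p i j => (p.1 i j, p.2 i j)
      invFun := fun g => (fun i j => (g i j).1, fun i j => (g i j).2)
      left_inv := fun p => rfl
      right_inv := fun g => rfl }
  rw [← avg_equiv e]; rfl

def exts (y : V) (b : Bool) (σ : Vy y → Bool) : V → Bool := fun v => if h : v = y then b else σ ⟨v, h⟩

def extsE (y : V) : ((Vy y → Bool) × Bool) ≃ (V → Bool) where
  toFun p := exts y p.2 p.1
  invFun σ := (fun v => σ v.1, σ y)
  left_inv := fun p => by
    ext v
    · simp [exts, v.2]
    · simp [exts]
  right_inv := fun σ => by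
    funext v; simp only [exts]; split_ifs with h
    · rw [h]
    · rfl

lemma sum_exts (y : V) (f : (V → Bool) → ℝ) : ∑ σ, f σ = ∑ b : Bool, ∑ σ : Vy y → Bool, f (exts y b σ) := by
  rw [← (extsE y).sum_comp, Fintype.sum_prod_type, Finset.sum_comm]; rfl

lemma exts_slot {y : V} {M : Fin m → Fin k → V} {i : Fin m} {j : Fin k} (h : M i j ≠ y) (Ψ : Fin m → Cl (Vy y) k) (b : Bool) (σ : Vy y → Bool) :
    (exts y b σ (lft y M Ψ i j).1 = (lft y M Ψ i j).2) ↔ σ (Ψ i j).1 = (Ψ i j).2 := by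
  unfold lft lslot exts; simp only [if_neg h]
  rw [dif_neg (Ψ i j).1.2]

def tch (y : V) (M : Fin m → Fin k → V) : Finset (Fin m) := univ.filter fun i => ∃ j, M i j = y
def Jy (y : V) (M : Fin m → Fin k → V) (J : Fin m → Finset (Fin k)) : Fin m → Finset (Fin k) := fun i => (J i).filter fun j => M i j ≠ y

lemma not_tch {y : V} {M : Fin m → Fin k → V} {i : Fin m} (h : i ∉ tch y M) (j : Fin k) : M i j ≠ y := by
  intro e; apply h; unfold tch; rw [mem_filter]; exact ⟨mem_univ _, j, e⟩

lemma Jy_not_tch {y : V} {M : Fin m → Fin k → V} {i : Fin m} (h : i ∉ tch y M) (J : Fin m → Finset (Fin k)) : Jy y M J i = J i := by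
  unfold Jy; apply Finset.filter_true_of_mem; intro j _; exact not_tch h j

lemma Jy_tch {y : V} {M : Fin m → Fin k → V} {i : Fin m} (h : i ∈ tch y M) (J : Fin m → Finset (Fin k)) : Jy y M J i ≠ univ := by
  unfold tch at h; rw [mem_filter] at h
  obtain ⟨_, j, hj⟩ := h
  intro e
  have : j ∈ Jy y M J i := by rw [e]; exact mem_univ _
  unfold Jy at this; rw [mem_filter] at this; exact this.2 hj

variable {κ : ℝ}

lemma wt_lift_eq {y : V} {M : Fin m → Fin k → V} {i : Fin m} (h : i ∉ tch y M) (J : Finset (Fin k)) (Ψ : Fin m → Cl (Vy y) k)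
    (b : Bool) (σ : Vy y → Bool) : wt κ (exts y b σ) J (lft y M Ψ i) = wt κ σ J (Ψ i) := by
  unfold wt
  have : sat (exts y b σ) J (lft y M Ψ i) ↔ sat σ J (Ψ i) := by
    unfold sat
    exact exists_congr fun j => and_congr_right fun _ => exts_slot (not_tch h j) Ψ b σ
  simp only [this]

lemma le_wt_lift (h1 : κ ≤ 1) {y : V} {M : Fin m → Fin k → V} (i : Fin m) (J : Fin m → Finset (Fin k)) (Ψ : Fin m → Cl (Vy y) k)
    (b : Bool) (σ : Vy y → Bool) : wt κ σ (Jy y M J i) (Ψ i) ≤ wt κ (exts y b σ) (J i) (lft y M Ψ i) := by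
  by_cases h : sat σ (Jy y M J i) (Ψ i)
  · rw [wt_of_sat h]
    obtain ⟨j, hj, hs⟩ := h
    unfold Jy at hj; rw [mem_filter] at hj
    rw [wt_of_sat ⟨j, hj.1, (exts_slot hj.2 Ψ b σ).2 hs⟩]
  · unfold wt; rw [if_neg h]; exact le_wt h1 _ _ _

lemma Z_lift_eq {y : V} {M : Fin m → Fin k → V} {P : Finset (Fin m)} (h : ∀ i ∈ P, i ∉ tch y M) (J : Fin m → Finset (Fin k)) (Ψ : Fin m → Cl (Vy y) k) :
    Z κ P J (lft y M Ψ) = 2 * Z κ P J Ψ := by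
  unfold Z; rw [sum_exts y]
  have : ∀ b σ, W κ P J (lft y M Ψ) (exts y b σ) = W κ P J Ψ σ := by
    intro b σ; unfold W
    exact Finset.prod_congr rfl fun i hi => wt_lift_eq (h i hi) _ _ _ _
  simp_rw [this]; simp

lemma Z_anti (h0 : 0 < κ) (h1 : κ ≤ 1) {P Q : Finset (Fin m)} (h : Q ⊆ P) (J : Fin m → Finset (Fin k)) (Φ : Fin m → Cl V k) :
    Z κ P J Φ ≤ Z κ Q J Φ := by
  unfold Z; apply Finset.sum_le_sum; intro σ _; unfold W
  rw [← Finset.prod_sdiff h]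
  exact mul_le_of_le_one_left (W_pos h0 _ _ _ _).le (W_le_one h0 h1 _ _ _ _)

lemma Z_lift_le (h0 : 0 < κ) (h1 : κ ≤ 1) (y : V) (M : Fin m → Fin k → V) (P : Finset (Fin m)) (J : Fin m → Finset (Fin k)) (Ψ : Fin m → Cl (Vy y) k) :
    Z κ P J (lft y M Ψ) ≤ 2 * Z κ (P \ tch y M) J Ψ := by
  rw [← Z_lift_eq (M := M) (fun i hi => (Finset.mem_sdiff.1 hi).2)]
  exact Z_anti h0 h1 Finset.sdiff_subset _ _

lemma Zl_lift_ge (h0 : 0 < κ) (h1 : κ ≤ 1) (y : V) (b : Bool) (M : Fin m → Fin k → V) (P : Finset (Fin m)) (J : Fin m → Finset (Fin k)) (Ψ : Fin m → Cl (Vy y) k) :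
    Z κ P (Jy y M J) Ψ ≤ Zl κ P J (lft y M Ψ) (y, b) := by
  unfold Zl Z; rw [sum_exts y]
  refine le_trans ?_ (Finset.single_le_sum (f := fun b' => ∑ σ : Vy y → Bool, ind (exts y b' σ y = b) * W κ P J (lft y M Ψ) (exts y b' σ))
    (fun b' _ => Finset.sum_nonneg fun σ _ => mul_nonneg (ind_nonneg _) (W_pos h0 _ _ _ _).le) (mem_univ b))
  apply Finset.sum_le_sum; intro σ _
  rw [ind_true (by simp [exts]), one_mul]
  exact Finset.prod_le_prod (fun i _ => (wt_pos h0 _ _ _).le) fun i _ => le_wt_lift h1 i J Ψ b σ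

/-- coupling of log Z -/
lemma Z_pow_le (h0 : 0 < κ) (h1 : κ ≤ 1) {P Q : Finset (Fin m)} (h : Q ⊆ P) (J : Fin m → Finset (Fin k)) (Φ : Fin m → Cl V k) :
    κ ^ (P \ Q).card * Z κ Q J Φ ≤ Z κ P J Φ := by
  unfold Z; rw [Finset.mul_sum]; apply Finset.sum_le_sum; intro σ _; unfold W
  rw [← Finset.prod_sdiff h]
  apply mul_le_mul_of_nonneg_right _ (W_pos h0 Q J Φ σ).le
  rw [← Finset.prod_const]
  exact Finset.prod_le_prod (fun _ _ => h0.le) fun i _ => le_wt h1 _ _ _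

/-- chain lemma -/
lemma chain (h0 : 0 < κ) {P0 I : Finset (Fin m)} (hd : Disjoint P0 I) (J : Fin m → Finset (Fin k)) (Φ : Fin m → Cl V k) {s' : ℝ}
    (h : Z κ (P0 ∪ I) J Φ < Real.exp (-(s' * I.card)) * Z κ P0 J Φ) :
    ∃ i ∈ I, Z κ (insert i (P0 ∪ I.filter (· < i))) J Φ < Real.exp (-s') * Z κ (P0 ∪ I.filter (· < i)) J Φ := by
  by_contra hc
  push Not at hc
  have key : ∀ A : Finset (Fin m), (∀ i ∈ A, i ∈ I ∧ A.filter (· < i) = I.filter (· < i)) →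
      Real.exp (-(s' * A.card)) * Z κ P0 J Φ ≤ Z κ (P0 ∪ A) J Φ := by
    intro A
    induction A using Finset.induction_on_max with
    | empty => intro _; simp
    | insert a A hmax ih =>
      intro hA
      have ha := hA a (mem_insert_self _ _)
      have hna : a ∉ A := fun h => lt_irrefl _ (hmax a h)
      have e : (insert a A).filter (· < a) = A := by
        ext x; simp only [mem_filter, mem_insert]
        constructor
        · rintro ⟨rfl | h, h2⟩
          · exact absurd h2 (lt_irrefl _)
          · exact h
        · intro h; exact ⟨Or.inr h, hmax x h⟩
      have hA' : ∀ i ∈ A, i ∈ I ∧ A.filter (· < i) = I.filter (· < i) := by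
        intro i hi
        refine ⟨(hA i (mem_insert_of_mem hi)).1, ?_⟩
        rw [← (hA i (mem_insert_of_mem hi)).2, Finset.filter_insert, if_neg (not_lt.2 (hmax i hi).le)]
      have h2 := ih hA'
      have h3 := hc a ha.1
      rw [← ha.2, e] at h3
      rw [Finset.card_insert_of_notMem hna]
      have : P0 ∪ insert a A = insert a (P0 ∪ A) := by ext x; simp
      rw [this]
      refine le_trans (le_of_eq ?_) ((mul_le_mul_of_nonneg_left h2 (Real.exp_pos (-s')).le).trans h3)
      rw [← mul_assoc, ← Real.exp_add]; push_cast; congr 2; ring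
  exact absurd h (not_lt.2 (key I fun i hi => ⟨hi, rfl⟩))

end lifting
end KS

namespace KS

section masks
variable {V : Type} [Fintype V] {k m : ℕ}

lemma avg_eq_y [Nonempty V] (y : V) : avg (fun v : V => ind (v = y)) = 1 / Fintype.card V := by
  unfold avg; congr 1
  simp [ind]

lemma avg_all_eq [Nonempty V] (y : V) (T : Finset (Fin k)) :
    avg (fun r : Fin k → V => ind (∀ j ∈ T, r j = y)) = (1 / Fintype.card V : ℝ) ^ T.card := by
  have : ∀ r : Fin k → V, ind (∀ j ∈ T, r j = y) = ∏ j, (if j ∈ T then ind (r j = y) else 1) := by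
    intro r
    rw [show ind (∀ j ∈ T, r j = y) = ind (∀ j, (j ∈ T → r j = y)) from rfl, ind_forall]
    apply Finset.prod_congr rfl; intro j _
    by_cases h : j ∈ T <;> simp [h, ind]
  simp_rw [this]
  rw [avg_pi_prod (fun j v => if j ∈ T then ind (v = y) else 1)]
  have : ∀ j : Fin k, (avg fun v : V => if j ∈ T then ind (v = y) else 1) = if j ∈ T then (1 / Fintype.card V : ℝ) else 1 := by
    intro j; split_ifs
    · exact avg_eq_y y
    · exact avg_const 1
  simp_rw [this]
  rw [Finset.prod_ite, Finset.prod_const, Finset.prod_const_one, mul_one]; simp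

lemma avg_row [Nonempty V] (y : V) : avg (fun r : Fin k → V => ind (∃ j, r j = y)) ≤ k * (1 / Fintype.card V) := by
  have : ∀ r : Fin k → V, ind (∃ j, r j = y) ≤ ∑ j, ind (∀ j' ∈ ({j} : Finset (Fin k)), r j' = y) := by
    intro r
    have := ind_exists_le (univ : Finset (Fin k)) (fun j => r j = y)
    simpa using this
  refine (avg_mono this).trans ?_
  rw [avg_sum]; simp_rw [avg_all_eq]; simp

lemma avg_row3 [Nonempty V] (y : V) : avg (fun r : Fin k → V => ind (3 ≤ (univ.filter fun j => r j = y).card)) ≤ k ^ 3 * (1 / Fintype.card V) ^ 3 := by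
  have : ∀ r : Fin k → V, ind (3 ≤ (univ.filter fun j => r j = y).card) ≤ ∑ T ∈ powersetCard 3 univ, ind (∀ j ∈ T, r j = y) := by
    intro r
    refine le_trans (ind_mono ?_) (ind_exists_le (powersetCard 3 univ) (fun T : Finset (Fin k) => ∀ j ∈ T, r j = y))
    intro h
    obtain ⟨T, hT, hc⟩ := Finset.exists_subset_card_eq h
    exact ⟨T, by rw [mem_powersetCard]; exact ⟨subset_univ _, hc⟩, fun j hj => (mem_filter.1 (hT hj)).2⟩
  refine (avg_mono this).trans ?_
  rw [avg_sum]; simp_rw [avg_all_eq]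
  rw [Finset.sum_congr rfl (g := fun _ => (1 / Fintype.card V : ℝ) ^ 3) (fun T hT => by rw [(mem_powersetCard.1 hT).2])]
  rw [Finset.sum_const, card_powersetCard, nsmul_eq_mul]
  have : ((univ : Finset (Fin k)).card.choose 3 : ℝ) ≤ k ^ 3 := by
    rw [Finset.card_univ, Fintype.card_fin]; exact_mod_cast Nat.choose_le_pow k 3
  gcongr

lemma avg_coord {C : Type} [Fintype C] [Nonempty C] (i : Fin m) (f : C → ℝ) :
    avg (fun Φ : Fin m → C => f (Φ i)) = avg f := by
  rw [← avg_update i]; simp only [Function.update_self]; exact avg_const _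

def badM (y : V) (M : Fin m → Fin k → V) : Prop := ∃ i, 3 ≤ (univ.filter fun j => M i j = y).card

lemma avg_bad [Nonempty V] (y : V) : avg (fun M : Fin m → Fin k → V => ind (badM y M)) ≤ m * (k ^ 3 * (1 / Fintype.card V) ^ 3) := by
  have : ∀ M : Fin m → Fin k → V, ind (badM y M) ≤ ∑ i, ind (3 ≤ (univ.filter fun j => M i j = y).card) := by
    intro M
    have := ind_exists_le (univ : Finset (Fin m)) (fun i => 3 ≤ (univ.filter fun j => M i j = y).card)
    unfold badM; simpa using this
  refine (avg_mono this).trans ?_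
  rw [avg_sum]
  calc _ ≤ ∑ i : Fin m, ((k:ℝ) ^ 3 * (1 / Fintype.card V) ^ 3) := by
        apply Finset.sum_le_sum; intro i _
        rw [avg_coord i (fun r : Fin k → V => ind (3 ≤ (univ.filter fun j => r j = y).card))]
        exact avg_row3 y
    _ = _ := by simp

lemma avg_tch [Nonempty V] (y : V) : avg (fun M : Fin m → Fin k → V => ((tch y M).card : ℝ)) ≤ m * (k * (1 / Fintype.card V)) := by
  have : ∀ M : Fin m → Fin k → V, ((tch y M).card : ℝ) = ∑ i, ind (∃ j, M i j = y) := by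
    intro M; rw [sum_ind]; rfl
  simp_rw [this]
  rw [avg_sum]
  calc _ ≤ ∑ i : Fin m, ((k:ℝ) * (1 / Fintype.card V)) := by
        apply Finset.sum_le_sum; intro i _
        rw [avg_coord i (fun r : Fin k → V => ind (∃ j, r j = y))]
        exact avg_row y
    _ = _ := by simp

lemma avg_exp_tch [Nonempty V] (y : V) {t : ℝ} (ht : 0 ≤ t) :
    avg (fun M : Fin m → Fin k → V => Real.exp (t * (tch y M).card)) ≤ Real.exp (m * (k * (1 / Fintype.card V)) * (Real.exp t - 1)) := by
  have : ∀ M : Fin m → Fin k → V, Real.exp (t * (tch y M).card) = ∏ i, (1 + (Real.exp t - 1) * ind (∃ j, M i j = y)) := by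
    intro M
    have h1 : ((tch y M).card : ℝ) = ∑ i, ind (∃ j, M i j = y) := by rw [sum_ind]; rfl
    rw [h1, Finset.mul_sum, Real.exp_sum]
    apply Finset.prod_congr rfl; intro i _
    by_cases h : ∃ j, M i j = y
    · rw [ind_true h]; ring_nf
    · rw [ind_false h]; simp
  simp_rw [this]
  rw [avg_pi_prod (fun (_ : Fin m) (r : Fin k → V) => 1 + (Real.exp t - 1) * ind (∃ j, r j = y))]
  rw [Finset.prod_const, Finset.card_univ, Fintype.card_fin, avg_add, avg_const, avg_mul]
  have he : 0 ≤ Real.exp t - 1 := by have := Real.add_one_le_exp t; linarith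
  have h1 : 1 + (Real.exp t - 1) * avg (fun r : Fin k → V => ind (∃ j, r j = y)) ≤ Real.exp ((Real.exp t - 1) * (k * (1 / Fintype.card V))) := by
    have := Real.add_one_le_exp ((Real.exp t - 1) * (k * (1 / Fintype.card V) : ℝ))
    have := mul_le_mul_of_nonneg_left (avg_row (k := k) y) he
    linarith
  have h2 : 0 ≤ 1 + (Real.exp t - 1) * avg (fun r : Fin k → V => ind (∃ j, r j = y)) := by
    have := mul_nonneg he (avg_nonneg (f := fun r : Fin k → V => ind (∃ j, r j = y)) fun _ => ind_nonneg _)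
    linarith
  refine (pow_le_pow_left₀ h2 h1 m).trans (le_of_eq ?_)
  rw [← Real.exp_nat_mul]; congr 1; ring

/-- moments of the number of touched clauses -/
lemma moment [Nonempty V] (hk : 1 ≤ k) (y : V) (hm : (m:ℝ) ≤ 2 * 2 ^ k * Fintype.card V) (p : ℕ) :
    avg (fun M : Fin m → Fin k → V => ((tch y M).card : ℝ) ^ p) ≤ p.factorial * (k * 2 ^ k) ^ p * Real.exp 4 := by
  have hk' : (1:ℝ) ≤ k := by exact_mod_cast hk
  have h2k : (1:ℝ) ≤ 2 ^ k := one_le_pow₀ (by norm_num)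
  set t : ℝ := 1 / (k * 2 ^ k) with ht
  have hkk : (1:ℝ) ≤ k * 2 ^ k := by nlinarith
  have ht0 : 0 < t := by positivity
  have ht1 : t ≤ 1 := by rw [ht, div_le_one (by positivity)]; exact hkk
  have hn : (0:ℝ) < Fintype.card V := by exact_mod_cast Fintype.card_pos
  have h1 : ∀ M : Fin m → Fin k → V, ((tch y M).card : ℝ) ^ p ≤ p.factorial * (k * 2 ^ k) ^ p * Real.exp (t * (tch y M).card) := by
    intro M
    have := Real.pow_div_factorial_le_exp (t * (tch y M).card) (by positivity) p
    rw [div_le_iff₀ (by positivity), mul_pow, ht, div_pow, one_pow] at this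
    have h3 : 0 < ((k:ℝ) * 2 ^ k) ^ p := by positivity
    rw [one_div, inv_mul_eq_div, div_le_iff₀ h3] at this
    linarith
  refine (avg_mono h1).trans ?_
  rw [avg_mul]
  apply mul_le_mul_of_nonneg_left _ (by positivity)
  refine (avg_exp_tch y ht0.le).trans ?_
  apply Real.exp_le_exp.2
  have he : Real.exp t - 1 ≤ 2 * t := by
    have := Real.abs_exp_sub_one_le (x := t) (by rw [abs_of_pos ht0]; exact ht1)
    rw [abs_of_pos ht0] at this
    exact (le_abs_self _).trans this
  calc (m:ℝ) * (k * (1 / Fintype.card V)) * (Real.exp t - 1) ≤ (2 * 2 ^ k * Fintype.card V) * (k * (1 / Fintype.card V)) * (2 * t) := by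
        gcongr
        have := Real.add_one_le_exp t; linarith
    _ = 4 := by rw [ht]; field_simp; norm_num

/-- coupling -/
lemma coupling [Nonempty V] (y : V) [Nonempty (Vy y)] {S : ℝ} (hS : 0 ≤ S) (Q : Finset (Fin m)) :
    avg (fun Φ : Fin m → Cl V k => Real.log (Z (Real.exp (-S)) Q (JF m k) Φ))
      ≤ Real.log 2 + avg (fun Φ : Fin m → Cl (Vy y) k => Real.log (Z (Real.exp (-S)) Q (JF m k) Φ))
        + S * (m * (k * (1 / Fintype.card V))) := by
  set κ := Real.exp (-S) with hκ
  have h0 : 0 < κ := Real.exp_pos _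
  have h1 : κ ≤ 1 := Real.exp_le_one_iff.2 (by linarith)
  rw [avg_lift y]
  set A := avg (fun Φ : Fin m → Cl (Vy y) k => Real.log (Z κ Q (JF m k) Φ)) with hA
  have key : ∀ M : Fin m → Fin k → V, avg (fun Ψ : Fin m → Cl (Vy y) k => Real.log (Z κ Q (JF m k) (lft y M Ψ)))
      ≤ (Real.log 2 + A) + S * (tch y M).card := by
    intro M
    have : (Real.log 2 + A) + S * (tch y M).card
       = avg (fun Ψ : Fin m → Cl (Vy y) k => (Real.log 2 + S * (tch y M).card) + Real.log (Z κ Q (JF m k) Ψ)) := by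
      rw [avg_add, avg_const]; ring
    rw [this]
    apply avg_mono; intro Ψ
    have a1 := Z_lift_le h0 h1 y M Q (JF m k) Ψ
    have a2 := Z_pow_le h0 h1 (P := Q) (Q := Q \ tch y M) Finset.sdiff_subset (JF m k) Ψ
    have a3 : κ ^ (tch y M).card ≤ κ ^ (Q \ (Q \ tch y M)).card := by
      apply pow_le_pow_of_le_one h0.le h1
      apply Finset.card_le_card; intro i hi
      rw [Finset.mem_sdiff, Finset.mem_sdiff] at hi; by_contra hc; exact hi.2 ⟨hi.1, hc⟩
    have z1 := Z_pos h0 (Q \ tch y M) (JF m k) Ψ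
    have z2 := Z_pos h0 Q (JF m k) Ψ
    have a4 : κ ^ (tch y M).card * Z κ (Q \ tch y M) (JF m k) Ψ ≤ Z κ Q (JF m k) Ψ :=
      (mul_le_mul_of_nonneg_right a3 z1.le).trans a2
    have a5 := Real.log_le_log (by positivity) a4
    rw [Real.log_mul (by positivity) z1.ne', Real.log_pow, hκ, Real.log_exp] at a5
    have a6 := Real.log_le_log (Z_pos h0 Q (JF m k) (lft y M Ψ)) a1
    rw [Real.log_mul (by norm_num) z1.ne'] at a6
    linarith
  refine (avg_mono key).trans ?_
  rw [avg_add, avg_const, avg_mul]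
  have := mul_le_mul_of_nonneg_left (avg_tch (m := m) (k := k) y) hS
  linarith

end masks
end KS

namespace KS

section cavity
variable {V : Type} [Fintype V] {k m : ℕ}

def outE (κ : ℝ) (P : Finset (Fin m)) (J : Fin m → Finset (Fin k)) (s : ℝ) (Φ : Fin m → Cl V k) (l : V × Bool) : Prop :=
  l ∈ frz κ P J Φ s ∧ ∀ i ∈ P, J i ≠ univ → ∀ j, (Φ i j).1 ≠ l.1

def rout (κ : ℝ) (P : Finset (Fin m)) (J : Fin m → Finset (Fin k)) (s : ℝ) (Φ : Fin m → Cl V k) : ℝ :=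
  avg fun l : V × Bool => ind (outE κ P J s Φ l)

def Tout (V : Type) [Fintype V] (κ : ℝ) (P : Finset (Fin m)) (J : Fin m → Finset (Fin k)) (s : ℝ) : ℝ :=
  avg fun Φ : Fin m → Cl V k => rout κ P J s Φ

def UU (P : Finset (Fin m)) (J : Fin m → Finset (Fin k)) : Finset (Fin m) := P.filter fun i => J i ≠ univ

lemma rout_nonneg (κ : ℝ) (P : Finset (Fin m)) (J : Fin m → Finset (Fin k)) (s : ℝ) (Φ : Fin m → Cl V k) : 0 ≤ rout κ P J s Φ :=
  avg_nonneg fun _ => ind_nonneg _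
lemma rout_le_one (κ : ℝ) (P : Finset (Fin m)) (J : Fin m → Finset (Fin k)) (s : ℝ) (Φ : Fin m → Cl V k) : rout κ P J s Φ ≤ 1 :=
  avg_le_const zero_le_one fun _ => ind_le_one _
lemma Tout_nonneg (κ : ℝ) (P : Finset (Fin m)) (J : Fin m → Finset (Fin k)) (s : ℝ) : 0 ≤ Tout V κ P J s :=
  avg_nonneg fun _ => rout_nonneg _ _ _ _ _
lemma Tout_le_one (κ : ℝ) (P : Finset (Fin m)) (J : Fin m → Finset (Fin k)) (s : ℝ) : Tout V κ P J s ≤ 1 :=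
  avg_le_const zero_le_one fun _ => rout_le_one _ _ _ _ _

lemma avg_lit [Nonempty V] (v : V) : avg (fun l : V × Bool => ind (v = l.1)) = 1 / Fintype.card V := by
  rw [avg_prod]
  simp_rw [avg_const]
  have : (fun a : V => ind (v = a)) = fun a => ind (a = v) := by funext a; congr 1; exact propext eq_comm
  rw [this, avg_eq_y]

lemma rho_le_rout [Nonempty V] (κ : ℝ) (P : Finset (Fin m)) (J : Fin m → Finset (Fin k)) (s : ℝ) (Φ : Fin m → Cl V k) :
    rho κ P J Φ s ≤ rout κ P J s Φ + (UU P J).card * (k * (1 / Fintype.card V)) := by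
  have : ∀ l : V × Bool, ind (l ∈ frz κ P J Φ s) ≤ ind (outE κ P J s Φ l) + ∑ i ∈ UU P J, ∑ j : Fin k, ind ((Φ i j).1 = l.1) := by
    intro l
    have hs : ∀ i, 0 ≤ ∑ j : Fin k, ind ((Φ i j).1 = l.1) := fun i => Finset.sum_nonneg fun _ _ => ind_nonneg _
    have hss : 0 ≤ ∑ i ∈ UU P J, ∑ j : Fin k, ind ((Φ i j).1 = l.1) := Finset.sum_nonneg fun i _ => hs i
    apply ind_le_of
    · intro h
      by_cases ho : outE κ P J s Φ l
      · rw [ind_true ho]; linarith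
      · have : ∃ i ∈ P, J i ≠ univ ∧ ∃ j, (Φ i j).1 = l.1 := by
          by_contra hc; apply ho; refine ⟨h, ?_⟩
          intro i hi hJ j hj; exact hc ⟨i, hi, hJ, j, hj⟩
        obtain ⟨i, hi, hJ, j, hj⟩ := this
        have hiU : i ∈ UU P J := Finset.mem_filter.2 ⟨hi, hJ⟩
        have a1 := Finset.single_le_sum (f := fun i => ∑ j : Fin k, ind ((Φ i j).1 = l.1)) (fun i _ => hs i) hiU
        have a2 := Finset.single_le_sum (f := fun j => ind ((Φ i j).1 = l.1)) (fun i _ => ind_nonneg _) (Finset.mem_univ j)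
        rw [ind_true hj] at a2
        have := ind_nonneg (outE κ P J s Φ l)
        linarith
    · have := ind_nonneg (outE κ P J s Φ l)
      linarith
  refine (avg_mono this).trans ?_
  rw [avg_add, avg_sum]
  simp_rw [avg_sum, avg_lit]
  unfold rout; simp

/-- one clause -/
lemma clause_bound [Nonempty V] (hk : 4 ≤ k) {κ : ℝ} (h0 : 0 < κ) (h1 : κ ≤ 1) {η : ℝ} (hη : 0 ≤ η) (hη1 : 2 * η ≤ 1) {E : ℕ} {g : ℝ}
    {P : Finset (Fin m)} {i : Fin m} (hi : i ∉ P) (J : Fin m → Finset (Fin k)) (hJ : k - 2 ≤ (J i).card) {s : ℝ} (hs : 3 ≤ s)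
    (hE : (UU P J).card ≤ E)
    (hG : avg (fun Φ : Fin m → Cl V k => ind (η * κ ^ (2 * E) < Fr η κ (P \ UU P J) (JF m k) Φ)) ≤ g) :
    avg (fun Φ : Fin m → Cl V k => ind (Z κ (insert i P) J Φ < Real.exp (-s) * Z κ P J Φ))
      ≤ g + 2 * (2 * η) ^ (k - 4) * Tout V κ P J s + 2 * ((UU P J).card * (k * (1 / Fintype.card V))) ^ 2 := by
  refine (step_prob h0 hi J s).trans ?_
  set b : ℝ := (UU P J).card * (k * (1 / Fintype.card V)) with hb
  have hb0 : 0 ≤ b := by positivity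
  have key : ∀ Φ : Fin m → Cl V k, rho κ P J Φ s ^ (J i).card
      ≤ (ind (η * κ ^ (2 * E) < Fr η κ (P \ UU P J) (JF m k) Φ) + 2 * (2 * η) ^ (k - 4) * rout κ P J s Φ) + 2 * b ^ 2 := by
    intro Φ
    have r0 := rho_nonneg (κ := κ) P J Φ s
    have r1 := rho_le_one (κ := κ) P J Φ s
    have o0 := rout_nonneg κ P J s Φ
    have o1 := rout_le_one κ P J s Φ
    have hp0 : 0 ≤ (2 * η) ^ (k - 4) := by positivity
    have hp1 : (2 * η) ^ (k - 4) ≤ 1 := pow_le_one₀ (by positivity) hη1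
    by_cases h : η * κ ^ (2 * E) < Fr η κ (P \ UU P J) (JF m k) Φ
    · rw [ind_true h]
      have := pow_le_one₀ (n := (J i).card) r0 r1
      have : 0 ≤ 2 * (2 * η) ^ (k - 4) * rout κ P J s Φ := by positivity
      nlinarith [sq_nonneg b]
    · rw [ind_false h, zero_add]
      have hF : Fr η κ P J Φ ≤ η := by
        have hc := Fr_compare h0 h1 η (P := P) (Q := P \ UU P J) Finset.sdiff_subset (e := E)
          (by refine le_trans (Finset.card_le_card ?_) hE
              intro x hx; rw [Finset.mem_sdiff, Finset.mem_sdiff] at hx; by_contra hh; exact hx.2 ⟨hx.1, hh⟩)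
          (J := J) (J' := JF m k) (by
            intro x hx; rw [Finset.mem_sdiff] at hx
            by_contra hh; exact hx.2 (Finset.mem_filter.2 ⟨hx.1, hh⟩)) Φ
        push Not at h
        have hpos : 0 < κ ^ (2 * E) := by positivity
        refine hc.trans ?_
        rw [inv_mul_le_iff₀ hpos]; linarith
      have hr : rho κ P J Φ s ≤ 2 * η := (rho_le h0 hη hs P J Φ).trans (by linarith)
      have hr2 := rho_le_rout κ P J s Φ
      rw [← hb] at hr2
      calc rho κ P J Φ s ^ (J i).card ≤ rho κ P J Φ s ^ (k - 2) := pow_le_pow_of_le_one r0 r1 hJ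
        _ = rho κ P J Φ s ^ (k - 4) * rho κ P J Φ s ^ 2 := by rw [← pow_add]; congr 1; omega
        _ ≤ (2 * η) ^ (k - 4) * (2 * rout κ P J s Φ + 2 * b ^ 2) := by
            have : rho κ P J Φ s ^ 2 ≤ 2 * rout κ P J s Φ + 2 * b ^ 2 := by
              have := pow_le_pow_left₀ r0 hr2 2
              nlinarith [sq_nonneg (rout κ P J s Φ - b)]
            gcongr
        _ ≤ _ := by nlinarith [sq_nonneg b]
  refine (avg_mono key).trans ?_
  rw [avg_add, avg_add, avg_mul, avg_const]
  unfold Tout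
  linarith

/-- pointwise lift -/
lemma lift_pt {κ : ℝ} (h0 : 0 < κ) (h1 : κ ≤ 1) (y : V) (b : Bool) (M : Fin m → Fin k → V) (P : Finset (Fin m))
    (J : Fin m → Finset (Fin k)) {s : ℝ} (hs : 3 ≤ s) (Ψ : Fin m → Cl (Vy y) k) :
    ind (outE κ P J s (lft y M Ψ) (y, b)) ≤ ∑ i ∈ P ∩ tch y M,
      ind (Z κ (insert i (P \ tch y M ∪ (P ∩ tch y M).filter (· < i))) (Jy y M J) Ψ
        < Real.exp (-(s / (2 * (P ∩ tch y M).card))) * Z κ (P \ tch y M ∪ (P ∩ tch y M).filter (· < i)) (Jy y M J) Ψ) := by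
  refine le_trans (ind_mono ?_) (ind_exists_le _ _)
  intro ho
  set I := P ∩ tch y M with hI
  set P0 := P \ tch y M with hP0
  have hd : Disjoint P0 I := by
    rw [Finset.disjoint_left]; intro x hx hx'
    exact (Finset.mem_sdiff.1 hx).2 (Finset.mem_inter.1 hx').2
  have hU : P0 ∪ I = P := by
    ext x; rw [Finset.mem_union, Finset.mem_sdiff, Finset.mem_inter]; tauto
  apply chain h0 hd
  rw [hU]
  have a1 := Zl_lift_ge h0 h1 y b M P J Ψ
  have a2 := (Finset.mem_filter.1 ho.1).2
  have a3 := Z_lift_le h0 h1 y M P J Ψ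
  rw [← hP0] at a3
  have a4 : Z κ P0 J Ψ = Z κ P0 (Jy y M J) Ψ := Z_congr (fun _ _ => rfl) (fun i hi => (Jy_not_tch (Finset.mem_sdiff.1 hi).2 J).symm)
  rw [a4] at a3
  have zp := Z_pos h0 P0 (Jy y M J) Ψ
  have e1 : s / (2 * I.card) * I.card ≤ s / 2 := by
    rcases Nat.eq_zero_or_pos I.card with h | h
    · rw [h]; simp; linarith
    · have : (0:ℝ) < I.card := by exact_mod_cast h
      apply le_of_eq; field_simp
  have e2 : 2 * Real.exp (-s) ≤ Real.exp (-(s / (2 * I.card) * I.card)) := by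
    have : 2 * Real.exp (-s) ≤ Real.exp (-(s/2)) := by
      have : Real.exp (-(s/2)) = Real.exp (s/2) * Real.exp (-s) := by rw [← Real.exp_add]; congr 1; ring
      rw [this]
      have := Real.add_one_le_exp (s/2)
      apply mul_le_mul_of_nonneg_right _ (Real.exp_pos _).le
      linarith
    exact this.trans (Real.exp_le_exp.2 (by linarith))
  calc Z κ P (Jy y M J) Ψ < Real.exp (-s) * Z κ P J (lft y M Ψ) := a1.trans_lt a2
    _ ≤ Real.exp (-s) * (2 * Z κ P0 (Jy y M J) Ψ) := by gcongr
    _ = 2 * Real.exp (-s) * Z κ P0 (Jy y M J) Ψ := by ring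
    _ ≤ _ := by gcongr

lemma lift_not_disj {κ : ℝ} (y : V) (b : Bool) (M : Fin m → Fin k → V) (P : Finset (Fin m))
    (J : Fin m → Finset (Fin k)) (s : ℝ) (Ψ : Fin m → Cl (Vy y) k) {i : Fin m} (hi : i ∈ P) (hJ : J i ≠ univ) (ht : i ∈ tch y M) :
    ind (outE κ P J s (lft y M Ψ) (y, b)) = 0 := by
  apply ind_false
  rintro ⟨_, h⟩
  obtain ⟨j, hj⟩ := (Finset.mem_filter.1 ht).2
  apply h i hi hJ j
  unfold lft lslot; rw [if_pos hj]

end cavity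
end KS

namespace KS

section cavity2
variable {V : Type} [Fintype V] {k m : ℕ}

def Dp (k p : ℕ) : ℝ := p.factorial * (k * 2 ^ k) ^ p * Real.exp 4

lemma Jy_card {y : V} {M : Fin m → Fin k → V} (hb : ¬ badM y M) {J : Fin m → Finset (Fin k)} {i : Fin m} (hJ : J i = univ) :
    k - 2 ≤ (Jy y M J i).card := by
  have h : (univ.filter fun j => M i j = y).card ≤ 2 := by
    by_contra hc; exact hb ⟨i, by omega⟩
  have := Finset.card_filter_add_card_filter_not (s := (univ : Finset (Fin k))) (fun j => M i j = y)
  rw [Finset.card_univ, Fintype.card_fin] at this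
  unfold Jy; rw [hJ]
  have e : (univ.filter fun j => M i j ≠ y).card = (univ.filter fun j => ¬ M i j = y).card := rfl
  rw [e]; omega

lemma UU_sub (y : V) (M : Fin m → Fin k → V) (P : Finset (Fin m)) (J : Fin m → Finset (Fin k)) (i : Fin m) :
    UU (P \ tch y M ∪ (P ∩ tch y M).filter (· < i)) (Jy y M J) ⊆ UU P J ∪ (P ∩ tch y M) := by
  intro x hx
  unfold UU at hx ⊢
  rw [Finset.mem_filter, Finset.mem_union, Finset.mem_sdiff] at hx
  rw [Finset.mem_union, Finset.mem_filter]
  rcases hx with ⟨h | h, h2⟩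
  · left; refine ⟨h.1, ?_⟩; rwa [Jy_not_tch h.2] at h2
  · right; exact (Finset.mem_filter.1 h).1

lemma rest_sub (y : V) (M : Fin m → Fin k → V) (P : Finset (Fin m)) (J : Fin m → Finset (Fin k)) (i : Fin m) :
    (P \ tch y M ∪ (P ∩ tch y M).filter (· < i)) \ UU (P \ tch y M ∪ (P ∩ tch y M).filter (· < i)) (Jy y M J) ⊆ P \ UU P J := by
  intro x hx
  rw [Finset.mem_sdiff] at hx
  have hJ : Jy y M J x = univ := by
    by_contra hc; exact hx.2 (Finset.mem_filter.2 ⟨hx.1, hc⟩)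
  have ht : x ∉ tch y M := fun h => Jy_tch h J hJ
  have hP : x ∈ P := by
    rcases Finset.mem_union.1 hx.1 with h | h
    · exact (Finset.mem_sdiff.1 h).1
    · exact (Finset.mem_inter.1 (Finset.mem_filter.1 h).1).1
  rw [Finset.mem_sdiff]; refine ⟨hP, ?_⟩
  intro h
  rw [Jy_not_tch ht] at hJ
  exact (Finset.mem_filter.1 h).2 hJ

set_option maxHeartbeats 1600000 in
/-- bound for a fixed mask -/
lemma mask_bound (hk : 4 ≤ k) {κ : ℝ} (h0 : 0 < κ) (h1 : κ ≤ 1) {η : ℝ} (hη : 0 ≤ η) (hη1 : 2 * η ≤ 1) {E Mx N : ℕ}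
    (y : V) [Nonempty (Vy y)] (hN : 1 ≤ N) (hNE : N ≤ E ^ 2) (hn : (N:ℝ) ≤ 2 * Fintype.card (Vy y)) {A0 B : ℝ} (hA0 : 0 ≤ A0) (hB : 0 ≤ B)
    (hG : ∀ Q : Finset (Fin m), Q.card ≤ Mx → avg (fun Φ : Fin m → Cl (Vy y) k => ind (η * κ ^ (2 * E) < Fr η κ Q (JF m k) Φ)) ≤ 1 / (N:ℝ) ^ 2)
    {R : ℝ}
    (IH : ∀ (P : Finset (Fin m)) (J : Fin m → Finset (Fin k)) (s : ℝ), (P \ UU P J).card ≤ Mx → 0 < s → s ≤ R / 2 →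
      Tout (Vy y) κ P J s ≤ A0 / s ^ 8 + B * ((UU P J).card + 1) ^ 4 / (N:ℝ) ^ 2)
    (P : Finset (Fin m)) (J : Fin m → Finset (Fin k)) (hP : (P \ UU P J).card ≤ Mx) {s : ℝ} (hs : 3 ≤ s) (hsR : s ≤ R)
    (he : 2 * (UU P J).card ≤ E) (b : Bool) (M : Fin m → Fin k → V) :
    avg (fun Ψ : Fin m → Cl (Vy y) k => ind (outE κ P J s (lft y M Ψ) (y, b)))
      ≤ ind (badM y M) + 6 ^ 8 / s ^ 8 * ((tch y M).card : ℝ) ^ 8 + 16 / (N:ℝ) ^ 2 * ((tch y M).card : ℝ) ^ 4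
        + 1 / (N:ℝ) ^ 2 * ((tch y M).card : ℝ) ^ 1 + 2 ^ 9 * (2 * η) ^ (k - 4) * A0 / s ^ 8 * ((tch y M).card : ℝ) ^ 9
        + 32 * (2 * η) ^ (k - 4) * B * ((UU P J).card + 1) ^ 4 / (N:ℝ) ^ 2 * ((tch y M).card : ℝ) ^ 5
        + 32 * k ^ 2 * ((UU P J).card + 1) ^ 4 / (N:ℝ) ^ 2 * ((tch y M).card : ℝ) ^ 3 := by
  have hNr : (0:ℝ) < N := by exact_mod_cast hN
  have hs0 : 0 < s := by linarith
  set d : ℝ := ((tch y M).card : ℝ) with hd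
  have hd0 : 0 ≤ d := by positivity
  set e := (UU P J).card with hee
  set q := (2 * η) ^ (k - 4) with hq
  have hq0 : 0 ≤ q := by positivity
  have t1 := ind_nonneg (badM y M)
  have t2 : 0 ≤ 6 ^ 8 / s ^ 8 * d ^ 8 := by positivity
  have t3 : 0 ≤ 16 / (N:ℝ) ^ 2 * d ^ 4 := by positivity
  have t4 : 0 ≤ 1 / (N:ℝ) ^ 2 * d ^ 1 := by positivity
  have t5 : 0 ≤ 2 ^ 9 * q * A0 / s ^ 8 * d ^ 9 := by positivity
  have t6 : 0 ≤ 32 * q * B * (e + 1) ^ 4 / (N:ℝ) ^ 2 * d ^ 5 := by positivity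
  have t7 : 0 ≤ 32 * k ^ 2 * (e + 1) ^ 4 / (N:ℝ) ^ 2 * d ^ 3 := by positivity
  have triv : avg (fun Ψ : Fin m → Cl (Vy y) k => ind (outE κ P J s (lft y M Ψ) (y, b))) ≤ 1 :=
    avg_le_const zero_le_one fun _ => ind_le_one _
  by_cases hbad : badM y M
  · rw [ind_true hbad]; linarith
  by_cases h6 : s < 6 * d
  · have : 1 ≤ 6 ^ 8 / s ^ 8 * d ^ 8 := by
      rw [div_mul_eq_mul_div, le_div_iff₀ (by positivity), one_mul, ← mul_pow]
      exact pow_le_pow_left₀ hs0.le h6.le 8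
    linarith
  by_cases h2 : E < 2 * (tch y M).card
  · have : 1 ≤ 16 / (N:ℝ) ^ 2 * d ^ 4 := by
      rw [div_mul_eq_mul_div, le_div_iff₀ (by positivity), one_mul]
      have a : (N:ℝ) ≤ (E:ℝ) ^ 2 := by exact_mod_cast hNE
      have b : (E:ℝ) ≤ 2 * d := by rw [hd]; exact_mod_cast h2.le
      calc (N:ℝ) ^ 2 ≤ ((E:ℝ) ^ 2) ^ 2 := by gcongr
        _ = (E:ℝ) ^ 4 := by ring
        _ ≤ (2 * d) ^ 4 := by gcongr
        _ = _ := by ring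
    linarith
  by_cases hdis : ∃ i ∈ P, J i ≠ univ ∧ i ∈ tch y M
  · obtain ⟨i, hi, hJ, ht⟩ := hdis
    simp_rw [lift_not_disj (κ := κ) y b M P J s _ hi hJ ht]
    rw [avg_const]; linarith
  push Not at hdis h6 h2
  refine (avg_mono (lift_pt h0 h1 y b M P J hs)).trans ?_
  rw [avg_sum]
  set I := P ∩ tch y M with hI
  have hId : (I.card : ℝ) ≤ d := by rw [hd]; exact_mod_cast Finset.card_le_card Finset.inter_subset_right
  have hIdn : I.card ≤ (tch y M).card := Finset.card_le_card Finset.inter_subset_right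
  have key : ∀ i ∈ I, avg (fun Ψ : Fin m → Cl (Vy y) k => ind (Z κ (insert i (P \ tch y M ∪ I.filter (· < i))) (Jy y M J) Ψ
        < Real.exp (-(s / (2 * I.card))) * Z κ (P \ tch y M ∪ I.filter (· < i)) (Jy y M J) Ψ))
      ≤ 1 / (N:ℝ) ^ 2 + 2 * q * (A0 / s ^ 8 * (2 * d) ^ 8 + B * ((e + 1) * (d + 1)) ^ 4 / (N:ℝ) ^ 2)
        + 8 * ((e + 1) * (d + 1)) ^ 2 * k ^ 2 / (N:ℝ) ^ 2 := by
    intro i hi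
    have hIpos : 0 < I.card := Finset.card_pos.2 ⟨i, hi⟩
    have hIr : (1:ℝ) ≤ I.card := by exact_mod_cast hIpos
    have hiI := Finset.mem_inter.1 hi
    have hJi : J i = univ := by
      by_contra hc; exact hdis i hiI.1 hc hiI.2
    have hni : i ∉ P \ tch y M ∪ I.filter (· < i) := by
      intro h; rcases Finset.mem_union.1 h with h | h
      · exact (Finset.mem_sdiff.1 h).2 hiI.2
      · exact lt_irrefl _ (Finset.mem_filter.1 h).2
    have hUc : (UU (P \ tch y M ∪ I.filter (· < i)) (Jy y M J)).card ≤ e + (tch y M).card := by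
      refine (Finset.card_le_card (UU_sub y M P J i)).trans ((Finset.card_union_le _ _).trans ?_)
      exact Nat.add_le_add le_rfl (Finset.card_le_card Finset.inter_subset_right)
    have hs3 : 3 ≤ s / (2 * I.card) := by
      rw [le_div_iff₀ (by positivity)]; nlinarith
    have hrest := (Finset.card_le_card (rest_sub y M P J i)).trans hP
    have c := clause_bound hk h0 h1 hη hη1 (E := E) hni (Jy y M J) (Jy_card hbad hJi) hs3 (by omega) (hG _ hrest)
    refine c.trans ?_
    have hsle : s / (2 * I.card) ≤ R / 2 := by
      rw [div_le_iff₀ (by positivity)]; nlinarith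
    have ih := IH _ (Jy y M J) _ hrest (by linarith) hsle
    set u := (UU (P \ tch y M ∪ I.filter (· < i)) (Jy y M J)).card with hu
    have hur : (u:ℝ) ≤ e + d := by rw [hd]; exact_mod_cast hUc
    have hed : (u:ℝ) + 1 ≤ (e + 1) * (d + 1) := by
      have := mul_nonneg (Nat.cast_nonneg (α := ℝ) e) hd0
      linarith [this, hur, (by ring : ((e:ℝ) + 1) * (d + 1) = e * d + e + d + 1)]
    have e1 : A0 / (s / (2 * I.card)) ^ 8 ≤ A0 / s ^ 8 * (2 * d) ^ 8 := by
      rw [div_pow, div_div_eq_mul_div, div_mul_eq_mul_div]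
      gcongr
    have e2 : B * ((u:ℝ) + 1) ^ 4 / (N:ℝ) ^ 2 ≤ B * ((e + 1) * (d + 1)) ^ 4 / (N:ℝ) ^ 2 := by gcongr
    have e3 : 2 * ((u:ℝ) * (k * (1 / Fintype.card (Vy y)))) ^ 2 ≤ 8 * ((e + 1) * (d + 1)) ^ 2 * k ^ 2 / (N:ℝ) ^ 2 := by
      have hv : (0:ℝ) < Fintype.card (Vy y) := by linarith
      have i1 : 1 / (Fintype.card (Vy y) : ℝ) ≤ 2 / N := by
        rw [div_le_div_iff₀ hv hNr]; linarith
      calc 2 * ((u:ℝ) * (k * (1 / Fintype.card (Vy y)))) ^ 2 ≤ 2 * (((e + 1) * (d + 1)) * (k * (2 / N))) ^ 2 := by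
            gcongr; linarith
        _ = _ := by field_simp; ring
    have e4 : 2 * q * Tout (Vy y) κ (P \ tch y M ∪ I.filter (· < i)) (Jy y M J) (s / (2 * I.card))
       ≤ 2 * q * (A0 / s ^ 8 * (2 * d) ^ 8 + B * ((e + 1) * (d + 1)) ^ 4 / (N:ℝ) ^ 2) := by
      apply mul_le_mul_of_nonneg_left _ (by positivity)
      linarith
    linarith
  refine (Finset.sum_le_sum key).trans ?_
  rw [Finset.sum_const, nsmul_eq_mul]
  set K := 1 / (N:ℝ) ^ 2 + 2 * q * (A0 / s ^ 8 * (2 * d) ^ 8 + B * ((e + 1) * (d + 1)) ^ 4 / (N:ℝ) ^ 2)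
        + 8 * ((e + 1) * (d + 1)) ^ 2 * k ^ 2 / (N:ℝ) ^ 2 with hK
  have hK0 : 0 ≤ K := by positivity
  have hdd : d = 0 ∨ 1 ≤ d := by
    rcases Nat.eq_zero_or_pos (tch y M).card with h | h
    · left; rw [hd, h]; simp
    · right; rw [hd]; exact_mod_cast h
  have p4 : d * (d + 1) ^ 4 ≤ 16 * d ^ 5 := by
    rcases hdd with h | h
    · rw [h]; simp
    · calc d * (d + 1) ^ 4 ≤ d * (2 * d) ^ 4 := by gcongr; linarith
        _ = _ := by ring
  have p2 : d * (d + 1) ^ 2 ≤ 4 * d ^ 3 := by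
    rcases hdd with h | h
    · rw [h]; simp
    · calc d * (d + 1) ^ 2 ≤ d * (2 * d) ^ 2 := by gcongr; linarith
        _ = _ := by ring
  have e0 : (e:ℝ) + 1 ≥ 1 := by linarith [Nat.cast_nonneg (α := ℝ) e]
  calc (I.card : ℝ) * K ≤ d * K := by gcongr
    _ = 1 / (N:ℝ) ^ 2 * d ^ 1 + 2 ^ 9 * q * A0 / s ^ 8 * d ^ 9 + 2 * q * B * (e + 1) ^ 4 / (N:ℝ) ^ 2 * (d * (d + 1) ^ 4)
       + 8 * k ^ 2 * (e + 1) ^ 2 / (N:ℝ) ^ 2 * (d * (d + 1) ^ 2) := by rw [hK]; ring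
    _ ≤ 1 / (N:ℝ) ^ 2 * d ^ 1 + 2 ^ 9 * q * A0 / s ^ 8 * d ^ 9 + 2 * q * B * (e + 1) ^ 4 / (N:ℝ) ^ 2 * (16 * d ^ 5)
       + 8 * k ^ 2 * (e + 1) ^ 4 / (N:ℝ) ^ 2 * (4 * d ^ 3) := by
        gcongr
        norm_num
    _ = 1 / (N:ℝ) ^ 2 * d ^ 1 + 2 ^ 9 * q * A0 / s ^ 8 * d ^ 9 + 32 * q * B * (e + 1) ^ 4 / (N:ℝ) ^ 2 * d ^ 5
       + 32 * k ^ 2 * (e + 1) ^ 4 / (N:ℝ) ^ 2 * d ^ 3 := by ring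
    _ ≤ _ := by linarith

end cavity2
end KS

namespace KS

section cavity3

lemma avg_eq_of_fst {V : Type} [Fintype V] {m k : ℕ} (F : (Fin m → Cl V k) → V × Bool → ℝ) {C : ℝ} (hC : 0 ≤ C)
    (h : ∀ l, avg (fun Φ => F Φ l) ≤ C) : avg (fun Φ => avg fun l => F Φ l) ≤ C := by
  rw [avg_comm]; exact avg_le_const hC h

/-- the cavity theorem -/
theorem cavity {k m N E Jm Mx : ℕ} {κ η A0 B : ℝ} (hk : 4 ≤ k) (h0 : 0 < κ) (h1 : κ ≤ 1) (hη : 0 ≤ η) (hη1 : 2 * η ≤ 1)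
    (hm : (m:ℝ) ≤ 2 ^ k * N) (hN : 2 ≤ N) (hNE : N ≤ E ^ 2) (hJm : 2 * Jm ≤ N)
    (hG : ∀ (V : Type) [Fintype V], N ≤ Fintype.card V + Jm → Fintype.card V ≤ N → ∀ Q : Finset (Fin m), Q.card ≤ Mx →
      avg (fun Φ : Fin m → Cl V k => ind (η * κ ^ (2 * E) < Fr η κ Q (JF m k) Φ)) ≤ 1 / (N:ℝ) ^ 2)
    (hA0 : 3 ^ 8 ≤ A0) (hA1 : 2 * 6 ^ 8 * Dp k 8 ≤ A0) (hq9 : 2 ^ 9 * (2 * η) ^ (k - 4) * Dp k 9 ≤ 1 / 2)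
    (hq5 : 32 * (2 * η) ^ (k - 4) * Dp k 5 ≤ 1 / 2) (hB : 16 ≤ B)
    (hB1 : 2 * (8 * 2 ^ k * k ^ 3 + 16 * Dp k 4 + Dp k 1 + 32 * k ^ 2 * Dp k 3) ≤ B) :
    ∀ j : ℕ, ∀ (V : Type) [Fintype V], N + j ≤ Fintype.card V + Jm → Fintype.card V ≤ N →
      ∀ (P : Finset (Fin m)) (J : Fin m → Finset (Fin k)) (s : ℝ), (P \ UU P J).card ≤ Mx → 0 < s → s ≤ 3 * 2 ^ j →
      Tout V κ P J s ≤ A0 / s ^ 8 + B * ((UU P J).card + 1) ^ 4 / (N:ℝ) ^ 2 := by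
  have hNr : (0:ℝ) < N := by exact_mod_cast (by omega : 0 < N)
  have hA00 : 0 ≤ A0 := le_trans (by norm_num) hA0
  have hB00 : 0 ≤ B := by linarith
  have triv : ∀ (V : Type) [Fintype V] (P : Finset (Fin m)) (J : Fin m → Finset (Fin k)) (s : ℝ), 0 < s → s ≤ 3 →
      Tout V κ P J s ≤ A0 / s ^ 8 + B * ((UU P J).card + 1) ^ 4 / (N:ℝ) ^ 2 := by
    intro V _ P J s hs hs3
    have h : 1 ≤ A0 / s ^ 8 := by
      rw [le_div_iff₀ (by positivity), one_mul]
      exact (pow_le_pow_left₀ hs.le hs3 8).trans hA0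
    have h' : 0 ≤ B * (((UU P J).card : ℝ) + 1) ^ 4 / (N:ℝ) ^ 2 := by positivity
    have := Tout_le_one (V := V) κ P J s
    linarith
  intro j
  induction j with
  | zero => intro V _ _ _ P J s _ hs hs3; exact triv V P J s hs (by simpa using hs3)
  | succ j ih =>
    intro V _ hV1 hV2 P J s hP hs hsj
    by_cases hs3 : s ≤ 3
    · exact triv V P J s hs hs3
    push Not at hs3
    by_cases he : E < 2 * (UU P J).card
    · have h : 1 ≤ B * (((UU P J).card : ℝ) + 1) ^ 4 / (N:ℝ) ^ 2 := by
        rw [le_div_iff₀ (by positivity), one_mul]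
        have a : (N:ℝ) ≤ (E:ℝ) ^ 2 := by exact_mod_cast hNE
        have b : (E:ℝ) ≤ 2 * ((UU P J).card + 1) := by
          have : (E:ℝ) ≤ 2 * (UU P J).card := by exact_mod_cast he.le
          linarith
        calc (N:ℝ) ^ 2 ≤ ((E:ℝ) ^ 2) ^ 2 := by gcongr
          _ = (E:ℝ) ^ 4 := by ring
          _ ≤ (2 * ((UU P J).card + 1)) ^ 4 := by gcongr
          _ = 16 * ((UU P J).card + 1) ^ 4 := by ring
          _ ≤ _ := by gcongr
      have h' : 0 ≤ A0 / s ^ 8 := by positivity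
      have := Tout_le_one (V := V) κ P J s
      linarith
    push Not at he
    have hVc : N ≤ 2 * (Fintype.card V - 1) := by omega
    have hV0 : 2 ≤ Fintype.card V := by omega
    have : Nonempty V := Fintype.card_pos_iff.1 (by omega)
    set e := (UU P J).card with hee
    set q := (2 * η) ^ (k - 4) with hq
    have hq0 : 0 ≤ q := by positivity
    unfold Tout rout
    apply avg_eq_of_fst
    · positivity
    rintro ⟨y, b⟩
    have hcy := card_Vy y
    have : Nonempty (Vy y) := Fintype.card_pos_iff.1 (by omega)
    rw [avg_lift y]
    have hny : (N:ℝ) ≤ 2 * Fintype.card (Vy y) := by exact_mod_cast (by omega : N ≤ 2 * Fintype.card (Vy y))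
    have mb := mask_bound hk h0 h1 hη hη1 (E := E) (Mx := Mx) (N := N) y (by omega) hNE hny hA00 hB00
      (hG (Vy y) (by omega) (by omega)) (R := 3 * 2 ^ (j + 1))
      (fun P J s h1 h2 h3 => ih (Vy y) (by omega) (by omega) P J s h1 h2 (by rw [pow_succ] at h3; linarith))
      P J hP hs3.le hsj he b
    refine (avg_mono mb).trans ?_
    rw [avg_add, avg_add, avg_add, avg_add, avg_add, avg_add, avg_mul, avg_mul, avg_mul, avg_mul, avg_mul, avg_mul]
    have hnV : (N:ℝ) ≤ 2 * Fintype.card V := by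
      have : (Fintype.card (Vy y) : ℝ) + 1 = Fintype.card V := by exact_mod_cast hcy
      linarith
    have hVr : (0:ℝ) < Fintype.card V := by linarith
    have hm2 : (m:ℝ) ≤ 2 * 2 ^ k * Fintype.card V := by
      refine hm.trans ?_
      calc (2:ℝ) ^ k * N ≤ 2 ^ k * (2 * Fintype.card V) := by gcongr
        _ = _ := by ring
    have mo := fun p => moment (m := m) (k := k) (by omega) y hm2 p
    have hbad : avg (fun M : Fin m → Fin k → V => ind (badM y M)) ≤ 8 * 2 ^ k * k ^ 3 / (N:ℝ) ^ 2 := by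
      refine (avg_bad y).trans ?_
      have i1 : 1 / (Fintype.card V : ℝ) ≤ 2 / N := by rw [div_le_div_iff₀ hVr hNr]; linarith
      set n : ℝ := (Fintype.card V : ℝ) with hn
      calc (m:ℝ) * ((k:ℝ) ^ 3 * (1 / n) ^ 3) ≤ (2 * 2 ^ k * n) * ((k:ℝ) ^ 3 * (1 / n) ^ 3) := by gcongr
        _ = 2 * 2 ^ k * (k:ℝ) ^ 3 * (1 / n) ^ 2 := by field_simp
        _ ≤ 2 * 2 ^ k * (k:ℝ) ^ 3 * (2 / N) ^ 2 := by gcongr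
        _ = _ := by field_simp; ring
    have m8 := mul_le_mul_of_nonneg_left (mo 8) (by positivity : 0 ≤ 6 ^ 8 / s ^ 8)
    have m4 := mul_le_mul_of_nonneg_left (mo 4) (by positivity : 0 ≤ 16 / (N:ℝ) ^ 2)
    have m1 := mul_le_mul_of_nonneg_left (mo 1) (by positivity : 0 ≤ 1 / (N:ℝ) ^ 2)
    have m9 := mul_le_mul_of_nonneg_left (mo 9) (by positivity : 0 ≤ 2 ^ 9 * q * A0 / s ^ 8)
    have m5 := mul_le_mul_of_nonneg_left (mo 5) (by positivity : 0 ≤ 32 * q * B * ((e:ℝ) + 1) ^ 4 / (N:ℝ) ^ 2)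
    have m3 := mul_le_mul_of_nonneg_left (mo 3) (by positivity : 0 ≤ 32 * (k:ℝ) ^ 2 * ((e:ℝ) + 1) ^ 4 / (N:ℝ) ^ 2)
    change _ ≤ _ * Dp k 8 at m8
    change _ ≤ _ * Dp k 4 at m4
    change _ ≤ _ * Dp k 1 at m1
    change _ ≤ _ * Dp k 9 at m9
    change _ ≤ _ * Dp k 5 at m5
    change _ ≤ _ * Dp k 3 at m3
    have Dnn : ∀ p, 0 ≤ Dp k p := fun p => by unfold Dp; positivity
    have e1 : (1:ℝ) ≤ ((e:ℝ) + 1) ^ 4 := one_le_pow₀ (by linarith [Nat.cast_nonneg (α := ℝ) e])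
    have F1 : 6 ^ 8 / s ^ 8 * Dp k 8 + 2 ^ 9 * q * A0 / s ^ 8 * Dp k 9 ≤ A0 / s ^ 8 := by
      have : 6 ^ 8 / s ^ 8 * Dp k 8 + 2 ^ 9 * q * A0 / s ^ 8 * Dp k 9 = (6 ^ 8 * Dp k 8 + A0 * (2 ^ 9 * q * Dp k 9)) / s ^ 8 := by ring
      rw [this]; gcongr; nlinarith
    have F2 : 8 * 2 ^ k * k ^ 3 / (N:ℝ) ^ 2 + 16 / (N:ℝ) ^ 2 * Dp k 4 + 1 / (N:ℝ) ^ 2 * Dp k 1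
        + 32 * q * B * ((e:ℝ) + 1) ^ 4 / (N:ℝ) ^ 2 * Dp k 5 + 32 * (k:ℝ) ^ 2 * ((e:ℝ) + 1) ^ 4 / (N:ℝ) ^ 2 * Dp k 3
        ≤ B * ((e:ℝ) + 1) ^ 4 / (N:ℝ) ^ 2 := by
      have : 8 * 2 ^ k * k ^ 3 / (N:ℝ) ^ 2 + 16 / (N:ℝ) ^ 2 * Dp k 4 + 1 / (N:ℝ) ^ 2 * Dp k 1
        + 32 * q * B * ((e:ℝ) + 1) ^ 4 / (N:ℝ) ^ 2 * Dp k 5 + 32 * (k:ℝ) ^ 2 * ((e:ℝ) + 1) ^ 4 / (N:ℝ) ^ 2 * Dp k 3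
        = ((8 * 2 ^ k * k ^ 3 + 16 * Dp k 4 + Dp k 1) + (B * (32 * q * Dp k 5) + 32 * k ^ 2 * Dp k 3) * ((e:ℝ) + 1) ^ 4) / (N:ℝ) ^ 2 := by ring
      rw [this]; gcongr
      have p1 : 0 ≤ 8 * 2 ^ k * (k:ℝ) ^ 3 + 16 * Dp k 4 + Dp k 1 := by
        have := Dnn 4; have := Dnn 1; positivity
      have p2 := mul_le_mul_of_nonneg_left hq5 hB00
      have p3 := mul_le_mul_of_nonneg_left e1 p1
      have p4 : (8 * 2 ^ k * (k:ℝ) ^ 3 + 16 * Dp k 4 + Dp k 1) + (B * (32 * q * Dp k 5) + 32 * k ^ 2 * Dp k 3) ≤ B := by linarith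
      have p5 := mul_le_mul_of_nonneg_right p4 (by linarith : 0 ≤ ((e:ℝ) + 1) ^ 4)
      linarith
    linarith

end cavity3
end KS

namespace KS

section gev
variable {V : Type} [Fintype V] {k m : ℕ}

lemma UU_JF (P : Finset (Fin m)) : UU P (JF m k) = ∅ := by
  unfold UU; apply Finset.filter_false_of_mem; intro i _; simp

lemma rho_eq_rout (κ : ℝ) (P : Finset (Fin m)) (s : ℝ) (Φ : Fin m → Cl V k) : rho κ P (JF m k) Φ s = rout κ P (JF m k) s Φ := by
  unfold rho rout outE; congr 1; funext l; congr 1; simp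

lemma X1_nonneg {κ : ℝ} (h0 : 0 < κ) (η δ : ℝ) (Q : Finset (Fin m)) (Φ : Fin m → Cl V k) : 0 ≤ X1 κ η δ Q Φ :=
  Finset.sum_nonneg fun σ _ => Finset.sum_nonneg fun τ _ => mul_nonneg (ind_nonneg _) (mul_pos (W_pos h0 _ _ _ _) (W_pos h0 _ _ _ _)).le

lemma Gev [Nonempty V] {S : ℝ} (hS : 0 < S) {η δ : ℝ} (Q : Finset (Fin m)) {ℓ x t c τ : ℝ} (hτ : 0 < τ) (ht : 0 ≤ t)
    (hL : ℓ + x ≤ avg (fun Φ : Fin m → Cl V k => Real.log (Z (Real.exp (-S)) Q (JF m k) Φ)))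
    (hX1 : ∀ d : ℕ, d ≤ Fintype.card V → η < 1 - 2 * ((d:ℝ) / Fintype.card V) → δ * Fintype.card V < d →
      ∃ u : ℝ, 0 < u ∧ (Fintype.card V : ℝ) * Real.log (1 + u) - d * Real.log u
        + Q.card * (-2 * (1/2)^k + 2 * Real.exp (-S) + ((1 + (1 - 2 * ((d:ℝ) / Fintype.card V)))/4) ^ k)
         ≤ 2 * ℓ - Fintype.card V * Real.log 2 - c * Fintype.card V)
    (a : ℝ) (ha : 0 ≤ a) (X2 : (Fin m → Cl V k) → ℝ) (hX20 : ∀ Φ, 0 ≤ X2 Φ)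
    (hF : ∀ Φ, Fr η (Real.exp (-S)) Q (JF m k) Φ ≤ X1 (Real.exp (-S)) η δ Q Φ / Z (Real.exp (-S)) Q (JF m k) Φ ^ 2
      + X2 Φ / Z (Real.exp (-S)) Q (JF m k) Φ ^ a)
    (hX2 : avg X2 ≤ Real.exp (a * ℓ - c * Fintype.card V)) :
    avg (fun Φ : Fin m → Cl V k => ind (τ < Fr η (Real.exp (-S)) Q (JF m k) Φ))
      ≤ Real.exp (t ^ 2 * S ^ 2 / 2 * Q.card - t * x) + (Fintype.card V + 2) * Real.exp (- (c * Fintype.card V)) / τ := by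
  set κ := Real.exp (-S) with hκ
  have h0 : 0 < κ := Real.exp_pos _
  have h1 : κ ≤ 1 := Real.exp_le_one_iff.2 (by linarith)
  set n : ℝ := (Fintype.card V : ℝ) with hn
  have az := azuma_tail hS (x := x) ht Q (fun Φ : Fin m → Cl V k => Real.log (Z κ Q (JF m k) Φ))
    (fun Φ Ψ h => by rw [Z_congr h (fun _ _ => rfl)]) (fun i Φ c => logZ_lip hS.le Q (JF m k) i Φ c)
  have aX1 := avg_X1 (V := V) (k := k) h0 h1 η δ _ Q hX1
  have key : ∀ Φ : Fin m → Cl V k, ind (τ < Fr η κ Q (JF m k) Φ)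
     ≤ ind (Real.log (Z κ Q (JF m k) Φ) < avg (fun Φ : Fin m → Cl V k => Real.log (Z κ Q (JF m k) Φ)) - x)
       + (X1 κ η δ Q Φ * (Real.exp (-(2 * ℓ)) / τ) + X2 Φ * (Real.exp (-(a * ℓ)) / τ)) := by
    intro Φ
    have x1 := X1_nonneg h0 η δ Q Φ
    have x2 := hX20 Φ
    have nn : 0 ≤ X1 κ η δ Q Φ * (Real.exp (-(2 * ℓ)) / τ) + X2 Φ * (Real.exp (-(a * ℓ)) / τ) := by positivity
    by_cases hz : Real.log (Z κ Q (JF m k) Φ) < avg (fun Φ : Fin m → Cl V k => Real.log (Z κ Q (JF m k) Φ)) - x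
    · rw [ind_true hz]
      have := ind_le_one (τ < Fr η κ Q (JF m k) Φ)
      linarith
    rw [ind_false hz, zero_add]
    apply ind_le_of _ nn
    intro hf
    push Not at hz
    have zp := Z_pos h0 Q (JF m k) Φ
    have hzl : ℓ ≤ Real.log (Z κ Q (JF m k) Φ) := by linarith
    have z2 : Real.exp (2 * ℓ) ≤ Z κ Q (JF m k) Φ ^ 2 := by
      rw [← Real.exp_log zp, ← Real.exp_nat_mul]; apply Real.exp_le_exp.2; push_cast; linarith
    have za : Real.exp (a * ℓ) ≤ Z κ Q (JF m k) Φ ^ a := by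
      rw [Real.rpow_def_of_pos zp, mul_comm]; apply Real.exp_le_exp.2; gcongr
    have f1 : X1 κ η δ Q Φ / Z κ Q (JF m k) Φ ^ 2 ≤ X1 κ η δ Q Φ * Real.exp (-(2 * ℓ)) := by
      rw [Real.exp_neg, ← div_eq_mul_inv]; gcongr
    have f2 : X2 Φ / Z κ Q (JF m k) Φ ^ a ≤ X2 Φ * Real.exp (-(a * ℓ)) := by
      rw [Real.exp_neg, ← div_eq_mul_inv]; gcongr
    have f3 := hF Φ
    rw [← mul_div_assoc, ← mul_div_assoc, ← add_div, le_div_iff₀ hτ, one_mul]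
    linarith
  refine (avg_mono key).trans ?_
  rw [avg_add, avg_add, avg_mul_right, avg_mul_right]
  have b1 : avg (X1 (V := V) (k := k) κ η δ Q) * (Real.exp (-(2 * ℓ)) / τ) ≤ (n + 1) * Real.exp (-(c * n)) / τ := by
    calc _ ≤ (2 ^ Fintype.card V * ((n + 1) * Real.exp (2 * ℓ - n * Real.log 2 - c * n))) * (Real.exp (-(2 * ℓ)) / τ) := by gcongr
      _ = (n + 1) * (Real.exp (n * Real.log 2) * Real.exp (2 * ℓ - n * Real.log 2 - c * n) * Real.exp (-(2 * ℓ))) / τ := by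
          rw [hn, Real.exp_nat_mul, Real.exp_log (by norm_num)]; ring
      _ = _ := by rw [← Real.exp_add, ← Real.exp_add]; congr 3; ring
  have b2 : avg X2 * (Real.exp (-(a * ℓ)) / τ) ≤ Real.exp (-(c * n)) / τ := by
    calc _ ≤ Real.exp (a * ℓ - c * n) * (Real.exp (-(a * ℓ)) / τ) := by gcongr
      _ = _ := by rw [← mul_div_assoc, ← Real.exp_add]; congr 2; ring
  have b3 : (n + 2) * Real.exp (-(c * n)) / τ = (n + 1) * Real.exp (-(c * n)) / τ + Real.exp (-(c * n)) / τ := by ring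
  rw [b3]
  linarith

/-- transport along an equivalence -/
lemma avg_logZ_equiv {V' : Type} [Fintype V'] (e : V ≃ V') (κ : ℝ) (Q : Finset (Fin m)) :
    avg (fun Φ : Fin m → Cl V k => Real.log (Z κ Q (JF m k) Φ)) = avg (fun Φ : Fin m → Cl V' k => Real.log (Z κ Q (JF m k) Φ)) := by
  let e1 : (V × Bool) ≃ (V' × Bool) := Equiv.prodCongr e (Equiv.refl Bool)
  let E : (Fin m → Cl V k) ≃ (Fin m → Cl V' k) := Equiv.piCongrRight fun _ => Equiv.piCongrRight fun _ => e1
  rw [← avg_equiv E]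
  congr 1; funext Φ; congr 1
  unfold Z
  let Eσ : (V → Bool) ≃ (V' → Bool) := Equiv.arrowCongr e (Equiv.refl Bool)
  rw [← Equiv.sum_comp Eσ]
  apply Finset.sum_congr rfl; intro σ _
  unfold W; apply Finset.prod_congr rfl; intro i _
  unfold wt sat
  simp [E, Eσ, e1]

lemma coupling_iter {N : ℕ} {S : ℝ} (hS : 0 ≤ S) (hN : 2 ≤ N) (Q : Finset (Fin m)) {Lz : ℝ}
    (h : ∀ (V : Type) [Fintype V], Fintype.card V = N → Lz ≤ avg (fun Φ : Fin m → Cl V k => Real.log (Z (Real.exp (-S)) Q (JF m k) Φ))) :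
    ∀ j : ℕ, 2 * j ≤ N → ∀ (V : Type) [Fintype V], Fintype.card V + j = N →
      Lz - j * (Real.log 2 + S * (m * (k * (2 / N)))) ≤ avg (fun Φ : Fin m → Cl V k => Real.log (Z (Real.exp (-S)) Q (JF m k) Φ)) := by
  intro j
  induction j with
  | zero => intro _ V _ hV; simpa using h V (by simpa using hV)
  | succ j ih =>
    intro hj V _ hV
    have ihV := ih (by omega) (Option V) (by rw [Fintype.card_option]; omega)
    have : Nonempty V := Fintype.card_pos_iff.1 (by omega)
    let e : V ≃ Vy (none : Option V) := ⟨fun v => ⟨some v, by simp⟩, fun w => match w with | ⟨some v, _⟩ => v | ⟨none, h⟩ => absurd rfl h,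
      fun v => rfl, fun w => by rcases w with ⟨_ | v, h⟩; · exact absurd rfl h
                                · rfl⟩
    have : Nonempty (Vy (none : Option V)) := ⟨e (Classical.arbitrary V)⟩
    have c := coupling (k := k) (none : Option V) hS Q
    rw [avg_logZ_equiv e]
    have hc : (1:ℝ) / Fintype.card (Option V) ≤ 2 / N := by
      have : N ≤ 2 * Fintype.card (Option V) := by rw [Fintype.card_option]; omega
      have h2 : (N:ℝ) ≤ 2 * Fintype.card (Option V) := by exact_mod_cast this
      have h3 : (0:ℝ) < N := by exact_mod_cast (by omega : 0 < N)
      rw [div_le_div_iff₀ (by linarith) h3]; linarith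
    have : S * (m * (k * (1 / (Fintype.card (Option V) : ℝ)))) ≤ S * (m * (k * (2 / N))) := by gcongr
    push_cast
    linarith

end gev
end KS

namespace KS

lemma ev_pow (p : ℕ) {q C : ℝ} (hq : 0 ≤ q) (hq1 : q < 1) (hC : 0 < C) : ∀ᶠ k : ℕ in atTop, (k:ℝ)^p * q^k ≤ C :=
  ((tendsto_pow_const_mul_const_pow_of_lt_one p hq hq1).eventually (gt_mem_nhds hC)).mono fun _ h => h.le

lemma ev_log {C : ℝ} (hC : 0 < C) : ∀ᶠ k : ℕ in atTop, Real.log (k:ℝ) ≤ C * k := by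
  have h := (Real.isLittleO_log_id_atTop.bound hC)
  have h2 := tendsto_natCast_atTop_atTop.eventually (h : ∀ᶠ x : ℝ in atTop, _)
  filter_upwards [h2] with k hk
  have := (le_abs_self _).trans hk
  simpa using this

lemma ev_ge (C : ℝ) : ∀ᶠ k : ℕ in atTop, C ≤ (k:ℝ) := tendsto_natCast_atTop_atTop.eventually (eventually_ge_atTop C)

lemma log2_lo : (0.693:ℝ) < Real.log 2 := by have := Real.log_two_gt_d9; linarith
lemma log2_hi : Real.log 2 < (0.694:ℝ) := by have := Real.log_two_lt_d9; linarith

lemma F1_i {k : ℕ} {α y : ℝ} (hk : 1 ≤ (k:ℝ)) (hy : y = (1/2)^k) (h14 : 1/4 ≤ α) (hα : 2 * α < 1 - 1/(k:ℝ)^4)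
    (e1 : (k:ℝ)^8 * (1/2)^k ≤ 1/14) (e2 : (k:ℝ)^2 * (1/2)^k ≤ 1/16) (e3 : (k:ℝ)^2 * (3/4)^k ≤ 1/4) :
    ∃ u : ℝ, 0 < u ∧ Real.log (1+u) - α * Real.log u + Real.log 2 * ((1-α)^k - 1) + 4 * y ≤ 0 := by
  set q := 1 - 2 * α with hq
  have hk4 : 0 < (1:ℝ)/(k:ℝ)^4 := by positivity
  have q0 : 1/(k:ℝ)^4 < q := by linarith
  have qh : q ≤ 1/2 := by linarith
  refine ⟨Real.exp (-(2*q)), Real.exp_pos _, ?_⟩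
  rw [Real.log_exp]
  have hc : 1 + Real.exp (-(2*q)) = 2 * Real.exp (-q) * Real.cosh q := by
    rw [Real.cosh_eq]
    have e1 : Real.exp (-(2*q)) = Real.exp (-q) * Real.exp (-q) := by rw [← Real.exp_add]; ring_nf
    have e2 : Real.exp (-q) * Real.exp q = 1 := by rw [← Real.exp_add]; simp
    rw [e1]; linear_combination (-1) * e2
  have hl : Real.log (1 + Real.exp (-(2*q))) ≤ Real.log 2 - q + q^2/2 := by
    rw [hc, Real.log_mul (by positivity) (Real.cosh_pos _).ne', Real.log_mul (by norm_num) (Real.exp_pos _).ne', Real.log_exp]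
    have := (Real.log_le_log (Real.cosh_pos q) (Real.cosh_le_exp_half_sq q))
    rw [Real.log_exp] at this; linarith
  have ha : α = (1-q)/2 := by linarith
  have hp : (1-α)^k = y * (1+q)^k := by rw [hy, ← mul_pow]; congr 1; linarith
  have hp0 : 0 ≤ (1-α)^k := pow_nonneg (by linarith) _
  have l2 : Real.log 2 * (1-α)^k ≤ (1-α)^k := by
    have := log2_hi; nlinarith
  have main : (1-α)^k + 4 * y ≤ q^2/2 := by
    by_cases hqk : q ≤ 1/(k:ℝ)
    · have : (1+q)^k ≤ 3 := by
        calc (1+q)^k ≤ (Real.exp q)^k := by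
              apply pow_le_pow_left₀ (by linarith); linarith [Real.add_one_le_exp q]
          _ = Real.exp (k * q) := by rw [Real.exp_nat_mul]
          _ ≤ Real.exp 1 := by
              apply Real.exp_le_exp.2; rw [le_div_iff₀ (by linarith)] at hqk; linarith
          _ ≤ 3 := by have := Real.exp_one_lt_d9; linarith
      have y0 : 0 ≤ y := by rw [hy]; positivity
      have hq2 : (1/(k:ℝ)^4)^2 ≤ q^2 := pow_le_pow_left₀ hk4.le q0.le 2
      have : 7 * y ≤ (1/(k:ℝ)^4)^2 / 2 := by
        rw [← hy] at e1
        have : (1/(k:ℝ)^4)^2 = 1/(k:ℝ)^8 := by rw [div_pow]; ring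
        rw [this, div_div, le_div_iff₀ (by positivity)]; linarith
      rw [hp]; nlinarith
    · push Not at hqk
      have hq2 : (1/(k:ℝ))^2 ≤ q^2 := pow_le_pow_left₀ (by positivity) hqk.le 2
      have h34 : (1-α)^k ≤ (3/4)^k := pow_le_pow_left₀ (by linarith) (by linarith) _
      have hkk : (1/(k:ℝ))^2/4 = 1/(4*(k:ℝ)^2) := by field_simp
      have a1 : (3/4:ℝ)^k ≤ (1/(k:ℝ))^2/4 := by
        rw [hkk, le_div_iff₀ (by positivity)]; linarith
      have a2 : 4 * y ≤ (1/(k:ℝ))^2/4 := by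
        rw [hy, hkk, le_div_iff₀ (by positivity)]; linarith
      linarith
  have ht : α * -(2*q) = -q + q^2 := by rw [ha]; ring
  rw [ht, mul_sub (Real.log 2)]
  linarith

lemma F1 : ∀ᶠ k : ℕ in atTop, ∀ α : ℝ, 1/(k:ℝ)^5 < α → 2 * α < 1 - 1/(k:ℝ)^4 →
    ∃ u : ℝ, 0 < u ∧ Real.log (1+u) - α * Real.log u + Real.log 2 * ((1-α)^k - 1) + 4 * (1/2)^k ≤ 0 := by
  filter_upwards [ev_ge 1, ev_pow 8 (by norm_num : (0:ℝ) ≤ 1/2) (by norm_num) (by norm_num : (0:ℝ) < 1/14),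
    ev_pow 2 (by norm_num : (0:ℝ) ≤ 1/2) (by norm_num) (by norm_num : (0:ℝ) < 1/16),
    ev_pow 2 (by norm_num : (0:ℝ) ≤ 3/4) (by norm_num) (by norm_num : (0:ℝ) < 1/4),
    ev_pow 5 (by norm_num : (0:ℝ) ≤ 1/2) (by norm_num) (by norm_num : (0:ℝ) < 1/4),
    ev_pow 0 (by norm_num : (0:ℝ) ≤ 1/2) (by norm_num) (by norm_num : (0:ℝ) < 1/1000),
    ev_log (by norm_num : (0:ℝ) < 0.01), ev_ge 100] with k hk e1 e2 e3 e4 e5 hl h100 α h1 h2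
  have hk4 : 0 < (1:ℝ)/(k:ℝ)^4 := by positivity
  have hk5 : 0 < (1:ℝ)/(k:ℝ)^5 := by positivity
  have a0 : 0 < α := by linarith
  by_cases h14 : 1/4 ≤ α
  · exact F1_i hk rfl h14 h2 e1 e2 e3
  push Not at h14
  refine ⟨α, a0, ?_⟩
  have hl1 : Real.log (1+α) ≤ α := by have := Real.log_le_sub_one_of_pos (by linarith : 0 < 1+α); linarith
  have L1 := log2_lo
  have L2 := log2_hi
  simp only [pow_zero, one_mul] at e5
  have y0 : (0:ℝ) ≤ (1/2)^k := by positivity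
  by_cases h3 : 3/(k:ℝ) ≤ α
  · have h4 : α - α * Real.log α ≤ 2 * Real.log 2 * α + 1/4 := by
      have := Real.log_le_sub_one_of_pos (by positivity : 0 < 1/(4*α))
      rw [one_div, Real.log_inv, Real.log_mul (by norm_num) a0.ne'] at this
      have l4 : Real.log 4 = 2 * Real.log 2 := by
        rw [show (4:ℝ) = 2^2 by norm_num, Real.log_pow]; norm_num
      rw [l4] at this
      have h5 := mul_le_mul_of_nonneg_left this a0.le
      have h6 : α * ((4*α)⁻¹) = 1/4 := by field_simp
      rw [mul_sub, h6] at h5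
      nlinarith
    have h5 : (1-α)^k ≤ 1/20 + 1/1000 := by
      calc (1-α)^k ≤ (Real.exp (-α))^k := by
            apply pow_le_pow_left₀ (by linarith); linarith [Real.add_one_le_exp (-α)]
        _ = Real.exp (k * (-α)) := by rw [Real.exp_nat_mul]
        _ ≤ Real.exp (-3) := by
            apply Real.exp_le_exp.2; rw [div_le_iff₀ (by linarith)] at h3; linarith
        _ ≤ _ := by
            have e3' : Real.exp 3 = Real.exp 1 ^ 3 := by rw [← Real.exp_nat_mul]; norm_num
            rw [Real.exp_neg, e3']
            have : (19.65:ℝ) ≤ Real.exp 1 ^ 3 := by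
              calc (19.65:ℝ) ≤ 2.7^3 := by norm_num
                _ ≤ _ := by have := Real.exp_one_gt_d9; gcongr; linarith
            rw [inv_le_comm₀ (by positivity) (by norm_num)]; norm_num; linarith
    nlinarith
  · push Not at h3
    have hka : k * α < 3 := by rw [lt_div_iff₀ (by linarith)] at h3; linarith
    have b : 1 + k * α ≤ (1+α)^k := one_add_mul_le_pow (by linarith) k
    have b2 : (1-α)^k * (1+α)^k ≤ 1 := by
      rw [← mul_pow]; apply pow_le_one₀ <;> nlinarith
    have p0 : 0 ≤ (1-α)^k := pow_nonneg (by linarith) _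
    have ka0 : 0 < k * α := by positivity
    have b3 : (1-α)^k ≤ 1 - k*α/4 := by
      have : (1-α)^k * (1 + k*α) ≤ 1 := (mul_le_mul_of_nonneg_left b p0).trans b2
      have h7 : (1-α)^k ≤ 1/(1+k*α) := by rw [le_div_iff₀ (by linarith)]; exact this
      refine h7.trans ?_
      rw [div_le_iff₀ (by linarith)]; nlinarith
    have l5 : -Real.log α ≤ 5 * Real.log k := by
      have := Real.log_le_log hk5 h1.le
      rw [one_div, Real.log_inv, Real.log_pow] at this; push_cast at this; linarith
    have y5 : 4 * (1/2)^k ≤ α := by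
      refine le_trans ?_ h1.le
      rw [le_div_iff₀ (by positivity)]; linarith
    have t1 : α * (-Real.log α) ≤ α * (0.05 * k) := by gcongr; linarith
    have t2 : Real.log 2 * ((1-α)^k - 1) ≤ 0.69 * (-(k*α/4)) := by nlinarith
    nlinarith

end KS

namespace KS

def yk (k : ℕ) : ℝ := (1/2)^k
def etak (k : ℕ) : ℝ := 1/(k:ℝ)^4
def ddk (k : ℕ) : ℝ := 1/(k:ℝ)^5
def thk (k : ℕ) : ℝ := 1/(4*(k:ℝ))
def lamk (k : ℕ) : ℝ := yk k + yk k^2*(1/2 + 2/(k:ℝ)^3)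

lemma yk_pos (k : ℕ) : 0 < yk k := by unfold yk; positivity
lemma yk_le_one (k : ℕ) : yk k ≤ 1 := by unfold yk; apply pow_le_one₀ <;> norm_num

lemma A1 : ∀ᶠ k : ℕ in atTop, ∀ ϱ κ : ℝ, 0 ≤ ϱ → ϱ * yk k ≤ Real.log 2 → 0 ≤ κ → κ ≤ yk k^5 →
    ∀ α : ℝ, ddk k < α → etak k < 1 - 2 * α →
    ∃ u : ℝ, 0 < u ∧ Real.log (1+u) - α * Real.log u + ϱ * (-2 * (1/2)^k + 2 * κ + ((1 + (1 - 2*α))/4)^k)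
      ≤ 2 * (Real.log 2 - ϱ * lamk k - 2 * yk k^4) - Real.log 2 - yk k^3 := by
  filter_upwards [F1, ev_ge 10, ev_pow 0 (by norm_num : (0:ℝ) ≤ 1/2) (by norm_num) (by norm_num : (0:ℝ) < 1/1000)] with k hF hk e5 ϱ κ r0 r1 κ0 κ1 α h1 h2
  simp only [pow_zero, one_mul] at e5
  obtain ⟨u, u0, hu⟩ := hF α h1 (by unfold etak at h2; linarith)
  refine ⟨u, u0, ?_⟩
  change yk k ≤ 1/1000 at e5
  change _ + 4 * yk k ≤ 0 at hu
  change _ + ϱ * (-2 * yk k + 2 * κ + _) ≤ _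
  have y0 := yk_pos k
  set y := yk k with hy
  have p1 : ((1 + (1 - 2*α))/4)^k = y * (1-α)^k := by
    rw [hy]; unfold yk; rw [← mul_pow]; congr 1; ring
  have al : 2 * α < 1 := by
    have : 0 ≤ etak k := by unfold etak; positivity
    linarith
  have p0 : 0 ≤ (1-α)^k := pow_nonneg (by linarith) _
  have p2 : ϱ * (y * (1-α)^k) ≤ Real.log 2 * (1-α)^k := by rw [← mul_assoc]; gcongr
  have k3 : 2/(k:ℝ)^3 ≤ 1/4 := by
    rw [div_le_iff₀ (by positivity)]
    have : (10:ℝ)^3 ≤ (k:ℝ)^3 := by gcongr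
    linarith
  have q1 : ϱ * (2 * κ) ≤ ϱ * (2 * y^5) := by gcongr
  have q1' : ϱ * (2 * y^5) ≤ 2 * y^4 := by
    have : ϱ * y * (2 * y^4) ≤ 1 * (2 * y^4) := by
      gcongr; have := log2_hi; linarith
    linarith
  have q2 : 2 * (ϱ * lamk k) - 2 * (ϱ * y) ≤ 2 * y := by
    unfold lamk; rw [← hy]
    have : ϱ * y * (y * (1/2 + 2/(k:ℝ)^3)) ≤ 1 * (y * (1/2 + 1/4)) := by
      gcongr; have := log2_hi; linarith
    linarith
  have y3 : y^3 ≤ y * (1/1000) := by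
    have : y^2 ≤ 1/1000 := by nlinarith
    nlinarith
  have y4 : y^4 ≤ y^3 := pow_le_pow_of_le_one y0.le (by linarith) (by norm_num)
  rw [p1]
  nlinarith

lemma A3 : ∀ᶠ k : ℕ in atTop, ∀ ϱ : ℝ, 0 ≤ ϱ → ϱ * yk k ≤ Real.log 2 / 2 → 
    ddk k - ddk k * Real.log (ddk k) ≤ Real.log 2 - ϱ * lamk k - 2 * yk k^4 - yk k^3 := by
  filter_upwards [ev_ge 10, ev_pow 0 (by norm_num : (0:ℝ) ≤ 1/2) (by norm_num) (by norm_num : (0:ℝ) < 1/1000), ev_log (by norm_num : (0:ℝ) < 1)] with k hk e5 hl ϱ r0 r1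
  simp only [pow_zero, one_mul] at e5
  change yk k ≤ 1/1000 at e5
  have y0 := yk_pos k
  have k3 : 2/(k:ℝ)^3 ≤ 1/4 := by
    rw [div_le_iff₀ (by positivity)]
    have : (10:ℝ)^3 ≤ (k:ℝ)^3 := by gcongr
    linarith
  have d1 : ddk k - ddk k * Real.log (ddk k) ≤ 0.1 := by
    unfold ddk
    rw [one_div, Real.log_inv, Real.log_pow]
    have : ((k:ℝ)^5)⁻¹ * (1 + 5 * Real.log k) ≤ 0.1 := by
      rw [inv_mul_le_iff₀ (by positivity)]
      have : (10:ℝ)^4 ≤ (k:ℝ)^4 := by gcongr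
      nlinarith
    push_cast; linarith
  set y := yk k with hy
  have q2 : ϱ * lamk k - (ϱ * y) ≤  y := by
    unfold lamk; rw [← hy]
    have : ϱ * y * (y * (1/2 + 2/(k:ℝ)^3)) ≤ 1 * (y * (1/2 + 1/4)) := by
      gcongr; have := log2_hi; linarith
    linarith
  have y3 : y^3 ≤ y * (1/1000) := by
    have : y^2 ≤ 1/1000 := by nlinarith
    nlinarith
  have y4 : y^4 ≤ y^3 := pow_le_pow_of_le_one y0.le (by linarith) (by norm_num)
  have := log2_lo
  linarith

end KS

namespace KS

lemma exp_le_quad {x : ℝ} (h0 : 0 ≤ x) (h1 : x ≤ 1) : Real.exp x ≤ 1 + x + x^2 := by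
  have := Real.abs_exp_sub_one_sub_id_le (by rw [abs_of_nonneg h0]; exact h1 : |x| ≤ 1)
  have := (abs_le.1 this).2; linarith

lemma log_le_quad {x : ℝ} (h0 : 0 ≤ x) (h1 : x < 1) : Real.log (1 - x) ≤ -x - x^2/2 := by
  have h := Real.hasSum_pow_div_log_of_abs_lt_one (by rw [abs_of_nonneg h0]; exact h1 : |x| < 1)
  have h2 := sum_le_hasSum (Finset.range 2) (fun i _ => by positivity) h
  simp [Finset.sum_range_succ] at h2
  linarith

lemma A2_pre {k : ℕ} {ϱ κ θ y v δ E : ℝ} (hk : 10 ≤ (k:ℝ)) (hy : 0 < y) (hy1 : y ≤ 1/1000) (r0 : 0 ≤ ϱ) (hv : v = Real.log 2 - ϱ * y) (hv0 : 0 ≤ v)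
   (κ0 : 0 ≤ κ) (κ1 : κ ≤ y^5) (hθ : 0 ≤ θ) (hθ1 : θ ≤ 1) (hδ : 0 ≤ δ) (hδ1 : δ ≤ 1)
   (hE : (2^θ - 1) * E ≤ θ * v - y * Real.log 2 * (θ/2 + δ*(1+θ)) - 10 * y^3) :
   Real.log 2 + ϱ * Real.log (1 - (1-κ)*y) + (2^θ-1) * E ≤ (1+θ) * (Real.log 2 - ϱ * (y + y^2*(1/2 + δ)) - 2 * y^4) - y^3 := by
  have y5 : y^5 ≤ 1 := pow_le_one₀ hy.le (by linarith)
  have lq := log_le_quad (x := (1-κ)*y) (mul_nonneg (by linarith) hy.le) (by nlinarith)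
  have h1 : ϱ * Real.log (1 - (1-κ)*y) ≤ ϱ * (-((1-κ)*y) - ((1-κ)*y)^2/2) := by gcongr
  have ry : ϱ * y ≤ 1 := by have := log2_hi; linarith
  have ry0 : 0 ≤ ϱ * y := by positivity
  have h2 : ϱ * (-((1-κ)*y) - ((1-κ)*y)^2/2) ≤ -(ϱ*y) - (ϱ*y)*y/2 + 2 * y^5 := by
    have e : ϱ * (-((1-κ)*y) - ((1-κ)*y)^2/2) = -(ϱ*y) - (ϱ*y)*y/2 + (ϱ*y)*(κ + y*κ - y*κ^2/2) := by ring
    rw [e]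
    have : κ + y*κ - y*κ^2/2 ≤ 2 * y^5 := by
      have : y * κ ≤ 1 * y^5 := by gcongr; linarith
      have : 0 ≤ y * κ^2/2 := by positivity
      linarith
    have : (ϱ*y)*(κ + y*κ - y*κ^2/2) ≤ (ϱ*y)*(2*y^5) := by gcongr
    have : (ϱ*y)*(2*y^5) ≤ 1*(2*y^5) := by gcongr
    linarith
  have h3 : (ϱ*y)*y*(θ/2 + δ*(1+θ)) ≤ Real.log 2 * y * (θ/2 + δ*(1+θ)) := by
    gcongr; linarith
  have y4 : y^4 ≤ y^3 := pow_le_pow_of_le_one hy.le (by linarith) (by norm_num)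
  have y54 : y^5 ≤ y^3 := pow_le_pow_of_le_one hy.le (by linarith) (by norm_num)
  have t4 : θ * y^4 ≤ 1 * y^3 := by gcongr
  have y3 : 0 ≤ y^3 := by positivity
  have e2 : (1+θ) * (Real.log 2 - ϱ * (y + y^2*(1/2 + δ)) - 2 * y^4) = (Real.log 2 -(ϱ*y) - (ϱ*y)*y/2) + θ * (Real.log 2 - ϱ * y)
     - (ϱ*y)*y*(θ/2 + δ*(1+θ)) - 2*y^4 - 2 * (θ*y^4) := by ring
  rw [e2, ← hv]
  linarith

set_option maxHeartbeats 1600000 in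
lemma A2 : ∀ᶠ k : ℕ in atTop, ∀ ϱ κ : ℝ, 0 ≤ ϱ → Real.log 2 / 2 < ϱ * yk k → ϱ * yk k ≤ Real.log 2 - yk k * (3/2 * Real.log 2 + 1/(2*((k:ℝ)+1))) →
    0 ≤ κ → κ ≤ yk k^5 →
    Real.log 2 + ϱ * Real.log (1 - (1-κ)*(1/2)^k) + (2^(thk k) - 1) * Real.exp (-(k * (1/2)^k * (1 - 2*(κ + k * ddk k)) * ϱ))
      ≤ (1 + thk k) * (Real.log 2 - ϱ * lamk k - 2 * yk k^4) - yk k^3 := by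
  filter_upwards [ev_ge 1000, ev_pow 0 (by norm_num : (0:ℝ) ≤ 1/2) (by norm_num) (by norm_num : (0:ℝ) < 1/1000),
    ev_pow 2 (by norm_num : (0:ℝ) ≤ 1/2) (by norm_num) (by norm_num : (0:ℝ) < 1/100),
    ev_pow 4 (by norm_num : (0:ℝ) ≤ 1/2) (by norm_num) (by norm_num : (0:ℝ) < 1/1000),
    ev_pow 4 (Real.exp_pos (-(1/4))).le (by rw [Real.exp_lt_one_iff]; norm_num) (by norm_num : (0:ℝ) < 1/100)] with k hk e0 e2 e4 ee ϱ κ r0 r1 r2 κ0 κ1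
  simp only [pow_zero, one_mul] at e0
  change yk k ≤ _ at e0
  change (k:ℝ)^2 * yk k ≤ _ at e2
  change (k:ℝ)^4 * yk k ≤ _ at e4
  change Real.log 2 + ϱ * Real.log (1 - (1-κ)*yk k) + (2^(thk k) - 1) * Real.exp (-(k * yk k * (1 - 2*(κ + k * ddk k)) * ϱ)) ≤ _
  have y0 := yk_pos k
  have ye : yk k = Real.exp (-(k * Real.log 2)) := by
    unfold yk; rw [Real.exp_neg, Real.exp_nat_mul, Real.exp_log (by norm_num), one_div, inv_pow]
  unfold lamk
  set y := yk k with hy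
  set K : ℝ := (k:ℝ) with hK
  have K0 : 0 < K := by linarith
  have th : thk k = 1/(4*K) := rfl
  set θ := thk k with hθ
  have t0 : 0 < θ := by rw [th]; positivity
  have t1 : θ ≤ 1/4000 := by rw [th]; rw [div_le_div_iff₀ (by positivity) (by norm_num)]; linarith
  have L1 := log2_lo
  have L2 := log2_hi
  obtain ⟨v, hv⟩ : ∃ v, v = Real.log 2 - ϱ * y := ⟨_, rfl⟩
  have vlo : y * (3/2 * Real.log 2 + 1/(2*(K+1))) ≤ v := by linarith
  have v0 : 0 ≤ v := le_trans (by positivity) vlo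
  have vhi : v < Real.log 2 / 2 := by linarith
  have kd : K * ddk k = 1/K^4 := by unfold ddk; rw [← hK]; field_simp
  have d3 : 2/K^3 ≤ 1 := by
    rw [div_le_iff₀ (by positivity)]
    have : (1000:ℝ)^3 ≤ K^3 := by gcongr
    linarith
  apply A2_pre (k := k) (by linarith) y0 e0 r0 hv v0 κ0 κ1 t0.le (by linarith) (by positivity) d3
  have two : (2:ℝ)^θ - 1 ≤ θ * (Real.log 2 + θ) := by
    rw [Real.rpow_def_of_pos (by norm_num)]
    have := exp_le_quad (x := Real.log 2 * θ) (by positivity) (by nlinarith)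
    have : (Real.log 2 * θ)^2 ≤ (1 * θ)^2 := by gcongr; linarith
    linarith
  have twob : (2:ℝ)^θ - 1 ≤ θ := by have := mul_le_mul_of_nonneg_left (by linarith : Real.log 2 + θ ≤ 1) t0.le; linarith
  have two0 : 0 ≤ (2:ℝ)^θ - 1 := by have := Real.one_le_rpow (by norm_num : (1:ℝ) ≤ 2) t0.le; linarith
  have κy : κ ≤ 1/(2*K^4) := by
    have : y^5 ≤ y := by simpa using pow_le_pow_of_le_one y0.le (by linarith) (by norm_num : 1 ≤ 5)
    refine κ1.trans (this.trans ?_)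
    rw [le_div_iff₀ (by positivity)]; linarith
  have β1 : 2 * (κ + K * ddk k) ≤ 3/K^4 := by
    rw [kd]; have : 1/(2*K^4) = (1/K^4)/2 := by field_simp
    have : 3/K^4 = 3*(1/K^4) := by ring
    linarith
  have Kinv : 1/K^2 ≤ 1/1000000 := by
    apply one_div_le_one_div_of_le (by norm_num)
    have : (1000:ℝ)^2 ≤ K^2 := by gcongr
    linarith
  have expo : -(K * y * (1 - 2*(κ + K * ddk k)) * ϱ) = -(K * (1 - 2*(κ + K * ddk k)) * (Real.log 2 - v)) := by rw [hv]; ring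
  rw [expo]
  set b := 2*(κ + K * ddk k) with hb
  have b0 : 0 ≤ b := by rw [hb, kd]; positivity
  have y3 : 0 ≤ y^3 := by positivity
  by_cases hc : v ≤ 1/K^3
  · have E1 : Real.exp (-(K * (1-b) * (Real.log 2 - v))) ≤ y * (1 + 3/K^2) := by
      have : -(K * (1-b) * (Real.log 2 - v)) ≤ -(K * Real.log 2) + 2/K^2 := by
        have s1 : K * v ≤ 1/K^2 := by
          calc K * v ≤ K * (1/K^3) := by gcongr
            _ = _ := by field_simp
        have s2 : K * b ≤ 1/K^2 := by
          calc K * b ≤ K * (3/K^4) := by gcongr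
            _ = (3/K) * (1/K^2) := by field_simp
            _ ≤ 1 * (1/K^2) := by gcongr; rw [div_le_one K0]; linarith
            _ = _ := one_mul _
        have s3 : K * b * (Real.log 2 - v) ≤ K * b * 1 := by gcongr; linarith
        have s4 : 2/K^2 = 1/K^2 + 1/K^2 := by ring
        linarith
      refine (Real.exp_le_exp.2 this).trans ?_
      rw [Real.exp_add, ← ye]
      gcongr
      have s4 : 2/K^2 = 2 * (1/K^2) := by ring
      have s5 : 3/K^2 = 3 * (1/K^2) := by ring
      have s6 : 0 < 1/K^2 := by positivity
      rw [s4, s5]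
      have := exp_le_quad (x := 2 * (1/K^2)) (by positivity) (by linarith)
      have := mul_le_mul_of_nonneg_left Kinv s6.le; linarith
    have E2 : (2^θ - 1) * Real.exp (-(K * (1-b) * (Real.log 2 - v))) ≤ θ * (Real.log 2 + θ) * (y * (1+3/K^2)) := by gcongr
    refine E2.trans ?_
    have V : θ * (y * (3/2 * Real.log 2 + 1/(2*(K+1)))) ≤ θ * v := by gcongr
    have main : (Real.log 2 + θ) * (1+3/K^2) + Real.log 2 * (1/2 + (8/K^2)*(1+θ)) + 1/K^2 ≤ 3/2 * Real.log 2 + 1/(2*(K+1)) := by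
      have g1 : 1/(2*(K+1)) - θ ≥ 1/(8*K) := by
        rw [th, ge_iff_le, div_sub_div _ _ (by positivity) (by positivity), div_le_div_iff₀ (by positivity) (by positivity)]
        have := mul_le_mul_of_nonneg_left hk K0.le; linarith
      have g2 : 30 * (1/K^2) ≤ 1/(8*K) := by
        rw [← mul_div_assoc, div_le_div_iff₀ (by positivity) (by positivity)]; have := mul_le_mul_of_nonneg_left hk K0.le; linarith
      have g3 : 3/K^2 = 3 * (1/K^2) := by ring
      have g4 : 8/K^2 = 8 * (1/K^2) := by ring
      rw [g3, g4]
      set z := 1/K^2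
      have z0 : 0 < z := by positivity
      have a1 : Real.log 2 * (3*z) ≤ 1 * (3*z) := by gcongr; linarith
      have a2 : θ * (3*z) ≤ 1 * (3*z) := by gcongr; linarith
      have a3 : Real.log 2 * (8*z*(1+θ)) ≤ 1 * (8*z*2) := by gcongr <;> linarith
      linarith
    have m2 := mul_le_mul_of_nonneg_left main (by positivity : 0 ≤ θ * y)
    have dth : 2/K^3 = (8/K^2) * θ := by rw [th]; field_simp; norm_num
    rw [dth]
    have last : 10 * y^3 ≤ θ * y * (1/K^2) := by
      have : 10 * y^2 ≤ θ * (1/K^2) := by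
        have e : θ * (1/K^2) = 1/(4*K^3) := by rw [th]; field_simp
        rw [e, le_div_iff₀ (by positivity)]
        have : K^3 * y ≤ 1 := by
          have : K^3 * y ≤ K^4 * y := by gcongr <;> linarith
          linarith
        have := mul_le_mul_of_nonneg_left this y0.le; linarith
      have := mul_le_mul_of_nonneg_left this y0.le; linarith
    linarith
  · push Not at hc
    have E1 : Real.exp (-(K * (1-b) * (Real.log 2 - v))) ≤ Real.exp (-(1/4))^k := by
      rw [← Real.exp_nat_mul]; apply Real.exp_le_exp.2
      have b2 : b ≤ 1/10 := by
        refine β1.trans ?_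
        have : (1000:ℝ)^4 ≤ K^4 := by gcongr
        rw [div_le_div_iff₀ (by positivity) (by norm_num)]; linarith
      have : (9/10) * (0.3465) ≤ (1-b) * (Real.log 2 - v) := by gcongr <;> linarith
      rw [← hK]; have := mul_le_mul_of_nonneg_left this K0.le; linarith
    have E2 : (2^θ - 1) * Real.exp (-(K * (1-b) * (Real.log 2 - v))) ≤ θ * Real.exp (-(1/4))^k := by gcongr
    refine E2.trans ?_
    have V : θ * (1/K^3) ≤ θ * v := by gcongr
    have w1 : Real.exp (-(1/4))^k ≤ (1/100) * (1/K^4) := by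
      rw [← mul_div_assoc, le_div_iff₀ (by positivity)]; linarith
    have w2 : y ≤ (1/1000) * (1/K^4) := by
      rw [← mul_div_assoc, le_div_iff₀ (by positivity)]; linarith
    have w3 : y * Real.log 2 * (θ/2 + 2/K^3*(1+θ)) ≤ 3 * y := by
      have : Real.log 2 * (θ/2 + 2/K^3*(1+θ)) ≤ 1 * (1/2 + 1 * (1+1)) := by gcongr <;> linarith
      have := mul_le_mul_of_nonneg_left this y0.le; linarith
    have w4 : 10 * y^3 ≤ 10 * y := by
      have : y^3 ≤ y := by simpa using pow_le_pow_of_le_one y0.le (by linarith) (by norm_num : 1 ≤ 3)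
      linarith
    have w5 : θ * (1/K^3) = (1/4) * (1/K^4) := by rw [th]; field_simp
    have w6 : θ * Real.exp (-(1/4))^k ≤ 1 * Real.exp (-(1/4))^k := by gcongr; linarith
    have : 0 < 1/K^4 := by positivity
    linarith

end KS

namespace KS

def A0k (k : ℕ) : ℝ := 3^8 + 2*6^8*Dp k 8
def Bk (k : ℕ) : ℝ := 16 + 2*(8*2^k*k^3+16*Dp k 4+Dp k 1+32*k^2*Dp k 3)

lemma Dp_nonneg (k p : ℕ) : 0 ≤ Dp k p := by unfold Dp; positivity

lemma two_eta {k : ℕ} (hk : 10 ≤ k) : 2 * etak k ≤ (1/2)^12 := by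
  unfold etak
  have : (10:ℝ)^4 ≤ (k:ℝ)^4 := by gcongr; exact_mod_cast hk
  rw [← mul_div_assoc, div_le_iff₀ (by positivity)]; nlinarith

lemma eta_pow {k : ℕ} (hk : 10 ≤ k) : (2 * etak k)^(k-4) ≤ 2^48 * yk k^12 := by
  have e0 : 0 ≤ 2 * etak k := by unfold etak; positivity
  calc (2 * etak k)^(k-4) ≤ ((1/2)^12)^(k-4) := pow_le_pow_left₀ e0 (two_eta hk) _
    _ = 2^48 * (((1/2)^12)^(k-4) * ((1/2)^12)^4) := by norm_num; ring
    _ = 2^48 * ((1/2)^12)^k := by rw [← pow_add]; congr 2; omega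
    _ = _ := by unfold yk; rw [← pow_mul, ← pow_mul, mul_comm 12 k]

lemma Dp_y (k p q : ℕ) : Dp k p * yk k^(q+p) = p.factorial * Real.exp 4 * ((k:ℝ)^p * yk k^q) := by
  have h : (2:ℝ)^k * yk k = 1 := by unfold yk; rw [← mul_pow]; norm_num
  unfold Dp
  calc _ = p.factorial * Real.exp 4 * ((k:ℝ)^p * yk k^q) * ((2:ℝ)^k * yk k)^p := by
        rw [mul_pow, mul_pow, pow_add]; ring
    _ = _ := by rw [h]; simp

lemma ev_y (p q : ℕ) {C : ℝ} (hC : 0 < C) : ∀ᶠ k : ℕ in atTop, (k:ℝ)^p * yk k^(q+1) ≤ C := by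
  filter_upwards [ev_pow p (by norm_num : (0:ℝ) ≤ 1/2) (by norm_num) hC] with k hk
  refine le_trans ?_ hk
  have := yk_pos k
  change _ ≤ _ * yk k
  gcongr
  simpa using pow_le_pow_of_le_one this.le (yk_le_one k) (by omega : 1 ≤ q + 1)

lemma Cq (p q : ℕ) (hpq : q + 1 + p = 12) (C : ℝ) (hC : 0 < C) : ∀ᶠ k : ℕ in atTop, C * (2 * etak k)^(k-4) * Dp k p ≤ 1/2 := by
  filter_upwards [ev_y p q (C := 1/2/(C * 2^48 * (p.factorial * Real.exp 4))) (by positivity), eventually_ge_atTop 10] with k h hk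
  rw [le_div_iff₀ (by positivity)] at h
  calc C * (2 * etak k)^(k-4) * Dp k p ≤ C * (2^48 * yk k^12) * Dp k p := by
        gcongr
        · exact Dp_nonneg _ _
        · exact eta_pow hk
    _ = C * 2^48 * (Dp k p * yk k^(q+1+p)) := by rw [hpq]; ring
    _ = _ := by rw [Dp_y]
    _ ≤ 1/2 := by linarith

lemma pow_one_add_le {k : ℕ} {x : ℝ} (h0 : 0 ≤ x) (h : k * x ≤ 1) : (1+x)^k ≤ 1 + 2 * (k * x) := by
  calc (1+x)^k ≤ Real.exp x ^ k := by apply pow_le_pow_left₀ (by linarith); linarith [Real.add_one_le_exp x]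
    _ = Real.exp (k*x) := by rw [Real.exp_nat_mul]
    _ ≤ _ := by
      have h1 : 0 ≤ k * x := by positivity
      have := exp_le_quad h1 h; nlinarith

lemma C2 : ∀ᶠ k : ℕ in atTop, (1/2)^k + ((1+etak k)/4)^k/2 + 24*((1+3*etak k)/8)^k + (2*etak k)^(k-1) * A0k k + yk k^2/(4*(k:ℝ)^3) ≤ lamk k := by
  filter_upwards [eventually_ge_atTop 10, ev_y 3 0 (C := 1/1000) (by norm_num),
    ev_y 3 9 (C := 1/(16 * 3^8*2^48)) (by norm_num),
    ev_y 11 1 (C := 1/(16*2*6^8*2^48*((8:ℕ).factorial * Real.exp 4))) (by positivity)] with k hk h1 h2 h3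
  have hkr : (10:ℝ) ≤ k := by exact_mod_cast hk
  have y0 := yk_pos k
  have K0 : (0:ℝ) < (k:ℝ)^3 := by positivity
  have e0 : 0 ≤ etak k := by unfold etak; positivity
  have ke : k * etak k = 1/(k:ℝ)^3 := by unfold etak; field_simp
  have k3 : (1:ℝ)/(k:ℝ)^3 ≤ 1/1000 := by
    apply one_div_le_one_div_of_le (by norm_num)
    have : (10:ℝ)^3 ≤ (k:ℝ)^3 := by gcongr
    linarith
  have s1 : ((1+etak k)/4)^k ≤ yk k^2 * (1 + 2*(1/(k:ℝ)^3)) := by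
    rw [← ke]
    calc ((1+etak k)/4)^k = yk k^2 * (1+etak k)^k := by
          unfold yk; rw [← pow_mul, mul_comm k 2, pow_mul, ← mul_pow]; congr 1; ring
      _ ≤ _ := by gcongr; exact pow_one_add_le e0 (by rw [ke]; linarith)
  have s2 : ((1+3*etak k)/8)^k ≤ yk k^3 * 2 := by
    calc ((1+3*etak k)/8)^k = yk k^3 * (1+3*etak k)^k := by
          unfold yk; rw [← pow_mul, mul_comm k 3, pow_mul, ← mul_pow]; congr 1; ring
      _ ≤ yk k^3 * 2 := by
          gcongr
          have e : (k:ℝ) * (3 * etak k) = 3 * (k * etak k) := by ring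
          have := pow_one_add_le (k := k) (x := 3 * etak k) (by positivity) (by rw [e, ke]; linarith)
          rw [e, ke] at this; linarith
  have s3 : (2*etak k)^(k-1) ≤ 2^48 * yk k^12 := by
    refine le_trans ?_ (eta_pow hk)
    apply pow_le_pow_of_le_one (by positivity) ((two_eta hk).trans (by norm_num)) (by omega)
  have A0 : 0 ≤ A0k k := by unfold A0k; have := Dp_nonneg k 8; positivity
  have s4 : (2*etak k)^(k-1) * A0k k ≤ 2^48 * yk k^12 * A0k k := by gcongr
  have s5 : 2^48 * yk k^12 * A0k k = yk k^2 * (3^8*2^48*yk k^10 + 2*6^8*2^48 * (((8:ℕ).factorial * Real.exp 4) * ((k:ℝ)^8 * yk k^2))) := by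
    rw [← Dp_y]; unfold A0k; ring
  have s6 : 3^8*2^48*yk k^10 ≤ (1/(k:ℝ)^3)/16 := by
    rw [div_div, le_div_iff₀ (by positivity)]
    rw [le_div_iff₀ (by positivity)] at h2
    norm_num at h2 ⊢; linarith
  have s7 : 2*6^8*2^48 * (((8:ℕ).factorial * Real.exp 4) * ((k:ℝ)^8 * yk k^2)) ≤ (1/(k:ℝ)^3)/16 := by
    rw [div_div, le_div_iff₀ (by positivity)]
    rw [le_div_iff₀ (by positivity)] at h3
    refine le_trans (le_of_eq ?_) h3
    ring
  have s8 : yk k ≤ (1/1000) * (1/(k:ℝ)^3) := by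
    rw [← mul_div_assoc, le_div_iff₀ K0]; norm_num at h1 ⊢; linarith
  have s9 : yk k^2 * yk k ≤ yk k^2 * ((1/1000) * (1/(k:ℝ)^3)) := by gcongr
  have s10 : (2*etak k)^(k-1) * A0k k ≤ yk k^2 * ((1/(k:ℝ)^3)/8) := by
    refine s4.trans ?_; rw [s5]; gcongr; linarith
  have t1 : yk k^2/(4*(k:ℝ)^3) = (1/4) * (yk k^2 * (1/(k:ℝ)^3)) := by field_simp
  have t2 : (2:ℝ)/(k:ℝ)^3 = 2 * (1/(k:ℝ)^3) := by ring
  unfold lamk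
  rw [t1, t2]
  change yk k + _ + _ + _ + _ ≤ _
  have : 0 < yk k^2 * (1/(k:ℝ)^3) := by positivity
  nlinarith

/-- everything we need to know about a large `k`. -/
structure Good (k : ℕ) : Prop where
  k10 : 10 ≤ k
  a1 : ∀ ϱ κ : ℝ, 0 ≤ ϱ → ϱ * yk k ≤ Real.log 2 → 0 ≤ κ → κ ≤ yk k^5 →
    ∀ α : ℝ, ddk k < α → etak k < 1 - 2 * α →
    ∃ u : ℝ, 0 < u ∧ Real.log (1+u) - α * Real.log u + ϱ * (-2 * (1/2)^k + 2 * κ + ((1 + (1 - 2*α))/4)^k)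
      ≤ 2 * (Real.log 2 - ϱ * lamk k - 2 * yk k^4) - Real.log 2 - yk k^3
  a2 : ∀ ϱ κ : ℝ, 0 ≤ ϱ → Real.log 2 / 2 < ϱ * yk k → ϱ * yk k ≤ Real.log 2 - yk k * (3/2 * Real.log 2 + 1/(2*((k:ℝ)+1))) →
    0 ≤ κ → κ ≤ yk k^5 →
    Real.log 2 + ϱ * Real.log (1 - (1-κ)*(1/2)^k) + (2^(thk k) - 1) * Real.exp (-(k * (1/2)^k * (1 - 2*(κ + k * ddk k)) * ϱ))
      ≤ (1 + thk k) * (Real.log 2 - ϱ * lamk k - 2 * yk k^4) - yk k^3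
  a3 : ∀ ϱ : ℝ, 0 ≤ ϱ → ϱ * yk k ≤ Real.log 2 / 2 → 
    ddk k - ddk k * Real.log (ddk k) ≤ Real.log 2 - ϱ * lamk k - 2 * yk k^4 - yk k^3
  q9 : 2^9*(2*etak k)^(k-4)*Dp k 9 ≤ 1/2
  q5 : 32*(2*etak k)^(k-4)*Dp k 5 ≤ 1/2
  c2 : (1/2)^k + ((1+etak k)/4)^k/2 + 24*((1+3*etak k)/8)^k + (2*etak k)^(k-1) * A0k k + yk k^2/(4*(k:ℝ)^3) ≤ lamk k

lemma ev_good : ∀ᶠ k : ℕ in atTop, Good k := by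
  filter_upwards [eventually_ge_atTop 10, A1, A2, A3, Cq 9 2 (by norm_num) (2^9) (by norm_num), Cq 5 6 (by norm_num) 32 (by norm_num), C2] with k h0 h1 h2 h3 h4 h5 h6
  exact ⟨h0, h1, h2, h3, h4, h5, h6⟩

end KS

namespace KS

def Sl (L : ℕ) : ℝ := 3 * 2^L
def El (L : ℕ) : ℕ := 4 * (2^L)^2
def kap (L : ℕ) : ℝ := Real.exp (-(Sl L))
def tauk (k L : ℕ) : ℝ := etak k * kap L ^ (2 * El L)

/-- numerical conditions satisfied for large `N`. -/
structure BigN (k N m L : ℕ) : Prop where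
  n1 : N ≤ El L ^ 2
  n2 : 2 ≤ N
  n2' : 2 * L + 2 ≤ N
  n3 : kap L ≤ yk k^5
  n4 : m * yk k ≤ (Real.log 2 - yk k * (3/2 * Real.log 2 + 1/(2*((k:ℝ)+1)))) * ((N:ℝ) - L)
  n5 : L * (Real.log 2 + Sl L * (m * (k * (2 / N)))) ≤ yk k^4 * ((N:ℝ) - L)
  n6 : Real.exp (-(yk k^9 * ((N:ℝ) - L) / (2 * Sl L^2))) ≤ 1/(2*(N:ℝ)^2)
  n7 : (N + 2) * Real.exp (-(yk k^3 * ((N:ℝ) - L))) / tauk k L ≤ 1/(2*(N:ℝ)^2)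
  n8 : 73*(tauk k L + 1/(N:ℝ)^2) + 6*2^L*(Bk k+1)/(N:ℝ)^2 ≤ yk k^2/(4*(k:ℝ)^3)

lemma Sl_pos (L : ℕ) : 0 < Sl L := by unfold Sl; positivity
lemma kap_pos (L : ℕ) : 0 < kap L := Real.exp_pos _
lemma kap_le_one (L : ℕ) : kap L ≤ 1 := Real.exp_le_one_iff.2 (by have := Sl_pos L; linarith)
lemma etak_pos {k : ℕ} (hk : 10 ≤ k) : 0 < etak k := by unfold etak; positivity

set_option maxHeartbeats 1600000 in
lemma GG {k N m L : ℕ} (g : Good k) (b : BigN k N m L) (Q : Finset (Fin m))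
    (hLB : ∀ (V : Type) [Fintype V], Fintype.card V = N → N * Real.log 2 - Q.card * lamk k ≤ avg (fun Φ : Fin m → Cl V k => Real.log (Z (kap L) Q (JF m k) Φ)))
    (V : Type) [Fintype V] (hV1 : N ≤ Fintype.card V + L) (hV2 : Fintype.card V ≤ N) :
    avg (fun Φ : Fin m → Cl V k => ind (tauk k L < Fr (etak k) (kap L) Q (JF m k) Φ)) ≤ 1 / (N:ℝ)^2 := by
  have hk := g.k10
  have hkr : (10:ℝ) ≤ k := by exact_mod_cast hk
  have n2 := b.n2
  have n2' := b.n2'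
  have cpos : 0 < Fintype.card V := by omega
  have : Nonempty V := Fintype.card_pos_iff.1 cpos
  have ci := coupling_iter (k := k) (Sl_pos L).le n2 Q hLB (N - Fintype.card V) (by omega) V (by omega)
  have hn1 : (N:ℝ) ≤ Fintype.card V + L := by exact_mod_cast hV1
  have hn2 : (Fintype.card V : ℝ) ≤ N := by exact_mod_cast hV2
  rw [Nat.cast_sub hV2] at ci
  change _ ≤ avg (fun Φ : Fin m → Cl V k => Real.log (Z (kap L) Q (JF m k) Φ)) at ci
  obtain ⟨n, hn⟩ : ∃ n : ℝ, n = (Fintype.card V : ℝ) := ⟨_, rfl⟩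
  have n0 : 0 < n := by rw [hn]; exact_mod_cast cpos
  rw [← hn] at ci hn1 hn2
  have nL : (N:ℝ) - L ≤ n := by linarith
  have y0 := yk_pos k
  obtain ⟨ϱ, hϱ⟩ : ∃ ϱ : ℝ, ϱ = Q.card / n := ⟨_, rfl⟩
  have qc : (Q.card : ℝ) = n * ϱ := by rw [hϱ, mul_comm, div_mul_cancel₀ _ n0.ne']
  have r0 : 0 ≤ ϱ := by rw [hϱ]; exact div_nonneg (Nat.cast_nonneg _) n0.le
  have Qm : (Q.card : ℝ) ≤ m := by
    have := Finset.card_le_univ Q; rw [Fintype.card_fin] at this; exact_mod_cast this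
  have L1 := log2_lo
  have L2 := log2_hi
  have vpos : 0 ≤ Real.log 2 - yk k * (3/2 * Real.log 2 + 1/(2*((k:ℝ)+1))) := by
    have h1 : (0:ℝ) < N - L := by
      have : (L:ℝ) + 2 ≤ N := by exact_mod_cast (by omega : L + 2 ≤ N)
      linarith
    have := b.n4
    have h2 : 0 ≤ m * yk k := by positivity
    by_contra h; push Not at h
    nlinarith [mul_neg_of_neg_of_pos h h1]
  have hr2 : ϱ * yk k ≤ Real.log 2 - yk k * (3/2 * Real.log 2 + 1/(2*((k:ℝ)+1))) := by
    have h1 : n * (ϱ * yk k) ≤ n * (Real.log 2 - yk k * (3/2 * Real.log 2 + 1/(2*((k:ℝ)+1)))) := by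
      calc n * (ϱ * yk k) = Q.card * yk k := by rw [qc]; ring
        _ ≤ m * yk k := by gcongr
        _ ≤ _ := b.n4
        _ ≤ (Real.log 2 - yk k * (3/2 * Real.log 2 + 1/(2*((k:ℝ)+1)))) * n := by gcongr
        _ = _ := by ring
    exact le_of_mul_le_mul_left h1 n0
  have hr1 : ϱ * yk k ≤ Real.log 2 := by
    have : 0 ≤ yk k * (3/2 * Real.log 2 + 1/(2*((k:ℝ)+1))) := by positivity
    linarith
  obtain ⟨ℓ, hℓ⟩ : ∃ ℓ : ℝ, ℓ = n * (Real.log 2 - ϱ * lamk k - 2 * yk k^4) := ⟨_, rfl⟩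
  have hL : ℓ + yk k^4 * n ≤ avg (fun Φ : Fin m → Cl V k => Real.log (Z (kap L) Q (JF m k) Φ)) := by
    refine le_trans ?_ ci
    have h1 : ((N:ℝ) - n) * (Real.log 2 + Sl L * (m * (k * (2 / N)))) ≤ yk k^4 * n := by
      calc ((N:ℝ) - n) * (Real.log 2 + Sl L * (m * (k * (2 / N)))) ≤ L * (Real.log 2 + Sl L * (m * (k * (2 / N)))) := by
            have := (Sl_pos L).le
            gcongr; linarith
        _ ≤ _ := b.n5
        _ ≤ _ := by gcongr
    have h2 : n * Real.log 2 ≤ N * Real.log 2 := by gcongr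
    rw [hℓ, qc]
    have : n * (Real.log 2 - ϱ * lamk k - 2 * yk k^4) + yk k^4 * n = n * Real.log 2 - n * ϱ * lamk k - yk k^4 * n := by ring
    linarith
  have tau0 : 0 < tauk k L := mul_pos (etak_pos hk) (pow_pos (kap_pos L) _)
  have hX1 : ∀ d : ℕ, d ≤ Fintype.card V → etak k < 1 - 2 * ((d:ℝ) / Fintype.card V) → ddk k * Fintype.card V < d →
      ∃ u : ℝ, 0 < u ∧ (Fintype.card V : ℝ) * Real.log (1 + u) - d * Real.log u
        + Q.card * (-2 * (1/2)^k + 2 * Real.exp (-(Sl L)) + ((1 + (1 - 2 * ((d:ℝ) / Fintype.card V)))/4) ^ k)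
         ≤ 2 * ℓ - Fintype.card V * Real.log 2 - yk k^3 * Fintype.card V := by
    intro d _ h1 h2
    rw [← hn] at h1 h2 ⊢
    obtain ⟨u, u0, hu⟩ := g.a1 ϱ (kap L) r0 hr1 (kap_pos L).le b.n3 (d/n) (by rw [lt_div_iff₀ n0]; exact h2) h1
    refine ⟨u, u0, ?_⟩
    have hd : (d:ℝ) = n * (d/n) := by field_simp
    have := mul_le_mul_of_nonneg_left hu n0.le
    change n * Real.log (1+u) - d * Real.log u + Q.card * (_ + 2 * kap L + _) ≤ _
    rw [qc, hℓ]
    calc _ = n * (Real.log (1 + u) - ↑d / n * Real.log u +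
          ϱ * (-2 * (1 / 2) ^ k + 2 * kap L + ((1 + (1 - 2 * (↑d / n))) / 4) ^ k)) := by
            nth_rewrite 1 [hd]; ring
      _ ≤ _ := this
      _ = _ := by ring
  have fin1 : Real.exp ((yk k^5 / Sl L^2) ^ 2 * Sl L ^ 2 / 2 * Q.card - (yk k^5 / Sl L^2) * (yk k^4 * n)) 
      + (n + 2) * Real.exp (-(yk k^3 * n)) / tauk k L ≤ 1/(N:ℝ)^2 := by
    have Sp := Sl_pos L
    have e1 : Real.exp ((yk k^5 / Sl L^2) ^ 2 * Sl L ^ 2 / 2 * Q.card - (yk k^5 / Sl L^2) * (yk k^4 * n)) ≤ 1/(2*(N:ℝ)^2) := by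
      refine le_trans (Real.exp_le_exp.2 ?_) b.n6
      have h1 : (yk k^5 / Sl L^2) ^ 2 * Sl L ^ 2 / 2 * Q.card = yk k^9 * n / (2 * Sl L^2) * (ϱ * yk k) := by
        rw [qc]; field_simp
      have h2 : (yk k^5 / Sl L^2) * (yk k^4 * n) = 2 * (yk k^9 * n / (2 * Sl L^2)) := by field_simp
      rw [h1, h2]
      have h3 : 0 ≤ yk k^9 * n / (2 * Sl L^2) := by positivity
      have h4 : yk k^9 * n / (2 * Sl L^2) * (ϱ * yk k) ≤ yk k^9 * n / (2 * Sl L^2) * 1 := by gcongr; linarith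
      have h5 : yk k^9 * ((N:ℝ) - L) / (2 * Sl L^2) ≤ yk k^9 * n / (2 * Sl L^2) := by gcongr
      linarith
    have e2 : (n + 2) * Real.exp (-(yk k^3 * n)) / tauk k L ≤ 1/(2*(N:ℝ)^2) := by
      refine le_trans ?_ b.n7
      gcongr
    have e3 : 1/(N:ℝ)^2 = 1/(2*(N:ℝ)^2) + 1/(2*(N:ℝ)^2) := by
      have : (0:ℝ) < N := by exact_mod_cast (by omega : 0 < N)
      field_simp; norm_num
    linarith
  refine le_trans ?_ fin1
  have t0 : 0 ≤ yk k^5 / Sl L^2 := by positivity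
  have k1 : (1:ℝ) ≤ (k:ℝ)^5 := one_le_pow₀ (by linarith)
  have dd0 : 0 < ddk k := by unfold ddk; positivity
  have dd1 : ddk k ≤ 1 := by unfold ddk; rw [div_le_one (by positivity)]; exact k1
  rw [hn] at hL ⊢
  by_cases hcase : Real.log 2 / 2 < ϱ * yk k
  · have th0 : 0 ≤ thk k := by unfold thk; positivity
    have th1 : thk k ≤ 1 := by unfold thk; rw [div_le_one (by positivity)]; linarith
    have κk : kap L + k * ddk k ≤ 1/2 := by
      have kd : k * ddk k = 1/(k:ℝ)^4 := by unfold ddk; field_simp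
      have k4 : 1/(k:ℝ)^4 ≤ 1/10000 := by
        apply one_div_le_one_div_of_le (by norm_num)
        have : (10:ℝ)^4 ≤ (k:ℝ)^4 := by gcongr
        linarith
      have y5 : yk k^5 ≤ 1/1024 := by
        have h1 : yk k ≤ 1/2 := by
          unfold yk
          have := pow_le_pow_of_le_one (by norm_num : (0:ℝ) ≤ 1/2) (by norm_num) (by omega : 1 ≤ k)
          simpa using this
        have h2 : yk k ≤ (1/2)^10 := by
          unfold yk
          exact pow_le_pow_of_le_one (by norm_num : (0:ℝ) ≤ 1/2) (by norm_num) hk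
        have h3 : yk k^5 ≤ yk k := by simpa using pow_le_pow_of_le_one y0.le (yk_le_one k) (by norm_num : 1 ≤ 5)
        norm_num at h2; linarith
      have := b.n3
      rw [kd]; linarith
    have X2 := avg_X2 (V := V) (k := k) (by omega) (kap_pos L) (kap_le_one L) dd0.le le_rfl (by linarith : 2 * (kap L + k * ddk k) ≤ 1) th0 th1 Q
    refine Gev (Sl_pos L) (δ := ddk k) Q tau0 t0 hL hX1 (1 + thk k) (by linarith)
      (fun Φ => ∑ σ, W (kap L) Q (JF m k) Φ σ * Zcl (kap L) (ddk k) Q Φ σ ^ (thk k)) 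
      (fun Φ => Finset.sum_nonneg fun σ _ => mul_nonneg (W_pos (kap_pos L) _ _ _ _).le (Real.rpow_nonneg (Zcl_nonneg (kap_pos L) _ _ _ _) _))
      (fun Φ => Fr_split2 (kap_pos L) th0 th1 Q Φ) (X2.trans ?_)
    have h2 := g.a2 ϱ (kap L) r0 hcase hr2 (kap_pos L).le b.n3
    have ap : 0 < 1 - (1 - kap L) * (1/2)^k := by
      have h1 : (1/2:ℝ)^k ≤ 1/2 := by
        have := pow_le_pow_of_le_one (by norm_num : (0:ℝ) ≤ 1/2) (by norm_num) (by omega : 1 ≤ k)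
        simpa using this
      have h2 : (0:ℝ) ≤ (1/2)^k := by positivity
      have := kap_pos L
      nlinarith
    have e1 : (2:ℝ)^Fintype.card V = Real.exp (Fintype.card V * Real.log 2) := by
      rw [Real.exp_nat_mul, Real.exp_log (by norm_num)]
    have e2 : (1 - (1 - kap L) * (1/2)^k)^Q.card = Real.exp (Q.card * Real.log (1 - (1 - kap L) * (1/2)^k)) := by
      rw [Real.exp_nat_mul, Real.exp_log ap]
    rw [e1, e2, ← Real.exp_add, ← Real.exp_add]
    apply Real.exp_le_exp.2
    rw [← hn, ← hϱ, qc, hℓ]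
    have := mul_le_mul_of_nonneg_left h2 n0.le
    linarith
  · push Not at hcase
    refine Gev (Sl_pos L) (δ := ddk k) Q tau0 t0 hL hX1 1 (by norm_num)
      (fun Φ => Real.exp (Fintype.card V * (ddk k - ddk k * Real.log (ddk k)))) (fun _ => (Real.exp_pos _).le)
      (fun Φ => by rw [Real.rpow_one]; exact Fr_split3 (kap_pos L) (kap_le_one L) dd0 dd1 Q Φ) ?_
    rw [avg_const]
    apply Real.exp_le_exp.2
    rw [← hn, hℓ]
    have := mul_le_mul_of_nonneg_left (g.a3 ϱ r0 hcase) n0.le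
    linarith

end KS

namespace KS

def LB (k N m L M : ℕ) : Prop := ∀ Q : Finset (Fin m), Q.card ≤ M → ∀ (V : Type) [Fintype V], Fintype.card V = N →
  N * Real.log 2 - Q.card * lamk k ≤ avg (fun Φ : Fin m → Cl V k => Real.log (Z (kap L) Q (JF m k) Φ))

lemma A0k_nonneg (k : ℕ) : 0 ≤ A0k k := by unfold A0k; have := Dp_nonneg k 8; positivity
lemma Bk_nonneg (k : ℕ) : 0 ≤ Bk k := by
  unfold Bk; have := Dp_nonneg k 4; have := Dp_nonneg k 1; have := Dp_nonneg k 3; positivity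

lemma m_le {k N m L : ℕ} (g : Good k) (b : BigN k N m L) : (m:ℝ) ≤ 2^k * N := by
  have y0 := yk_pos k
  have h : (2:ℝ)^k * yk k = 1 := by unfold yk; rw [← mul_pow]; norm_num
  have h1 : (L:ℝ) ≤ N := by exact_mod_cast (by have := b.n2'; omega : L ≤ N)
  have h2 : m * yk k ≤ 1 * N := by
    refine b.n4.trans ?_
    have := log2_hi
    have := log2_lo
    have h3 : 0 ≤ yk k * (3/2 * Real.log 2 + 1/(2*((k:ℝ)+1))) := by positivity
    gcongr
    · linarith
    · have : (0:ℝ) ≤ L := Nat.cast_nonneg _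
      linarith
  calc (m:ℝ) = 2^k * (m * yk k) := by rw [mul_left_comm, h, mul_one]
    _ ≤ 2^k * N := by gcongr; linarith

lemma Tb {k N m L M : ℕ} (g : Good k) (b : BigN k N m L) (hLB : LB k N m L M) (V : Type) [Fintype V] (hV : Fintype.card V = N)
    (P : Finset (Fin m)) (hP : P.card ≤ M) {s : ℝ} (hs : 0 < s) (hs2 : s ≤ 3 * 2^L) :
    avg (fun Φ : Fin m → Cl V k => rho (kap L) P (JF m k) Φ s) ≤ A0k k / s^8 + Bk k / (N:ℝ)^2 := by
  have hk := g.k10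
  have D8 := Dp_nonneg k 8
  have e0 := etak_pos hk
  have B0 : 0 ≤ 2*(8*2^k*(k:ℝ)^3+16*Dp k 4+Dp k 1+32*k^2*Dp k 3) := by
    have := Dp_nonneg k 4; have := Dp_nonneg k 1; have := Dp_nonneg k 3; positivity
  have c := cavity (k := k) (m := m) (N := N) (E := El L) (Jm := L) (Mx := M) (κ := kap L) (η := etak k) (A0 := A0k k) (B := Bk k)
    (by omega) (kap_pos L) (kap_le_one L) e0.le ((two_eta hk).trans (by norm_num)) (m_le g b) b.n2 b.n1 (by have := b.n2'; omega)
    (fun V _ h1 h2 Q hQ => GG g b Q (fun V' _ hV' => hLB Q hQ V' hV') V h1 h2)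
    (by unfold A0k; have : (0:ℝ) ≤ 2*6^8*Dp k 8 := by positivity
        linarith)
    (by unfold A0k; norm_num) g.q9 g.q5 (by unfold Bk; linarith) (by unfold Bk; linarith) L V (by omega) (by omega) P (JF m k) s
    (by rw [UU_JF]; simpa using hP) hs hs2
  rw [UU_JF] at c
  simp only [Finset.card_empty, Nat.cast_zero, zero_add, one_pow, mul_one] at c
  unfold Tout at c
  simp only [rho_eq_rout]
  exact c

lemma avgFr {k N m L M : ℕ} (g : Good k) (b : BigN k N m L) (hLB : LB k N m L M) (V : Type) [Fintype V] (hV : Fintype.card V = N)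
    (P : Finset (Fin m)) (hP : P.card ≤ M) :
    avg (fun Φ : Fin m → Cl V k => Fr (etak k) (kap L) P (JF m k) Φ) ≤ tauk k L + 1/(N:ℝ)^2 := by
  have : Nonempty V := Fintype.card_pos_iff.1 (by have := b.n2; omega)
  have tau0 : 0 < tauk k L := mul_pos (etak_pos g.k10) (pow_pos (kap_pos L) _)
  have G := GG g b P (fun V' _ hV' => hLB P hP V' hV') V (by omega) (by omega)
  calc _ ≤ avg (fun Φ : Fin m → Cl V k => tauk k L + ind (tauk k L < Fr (etak k) (kap L) P (JF m k) Φ)) := by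
        apply avg_mono; intro Φ
        by_cases h : tauk k L < Fr (etak k) (kap L) P (JF m k) Φ
        · rw [ind_true h]; have := Fr_le_one (kap_pos L) (etak k) P (JF m k) Φ; linarith
        · rw [ind_false h]; linarith
    _ = tauk k L + avg (fun Φ : Fin m → Cl V k => ind (tauk k L < Fr (etak k) (kap L) P (JF m k) Φ)) := by rw [avg_add, avg_const]
    _ ≤ _ := by linarith

lemma avgRhok {k N m L M : ℕ} (g : Good k) (b : BigN k N m L) (hLB : LB k N m L M) (V : Type) [Fintype V] (hV : Fintype.card V = N)
    (P : Finset (Fin m)) (hP : P.card ≤ M) {s : ℝ} (hs : 3 ≤ s) (hs2 : s ≤ 3 * 2^L) :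
    avg (fun Φ : Fin m → Cl V k => rho (kap L) P (JF m k) Φ s ^ k) ≤ (2*etak k)^(k-1) * (A0k k / s^8 + Bk k / (N:ℝ)^2) + 1/(N:ℝ)^2 := by
  have : Nonempty V := Fintype.card_pos_iff.1 (by have := b.n2; omega)
  have hk := g.k10
  have e0 := etak_pos hk
  have tau1 : tauk k L ≤ etak k := mul_le_of_le_one_right e0.le (pow_le_one₀ (kap_pos L).le (kap_le_one L))
  have G := GG g b P (fun V' _ hV' => hLB P hP V' hV') V (by omega) (by omega)
  have T := Tb g b hLB V hV P hP (by linarith : 0 < s) hs2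
  calc _ ≤ avg (fun Φ : Fin m → Cl V k => (2*etak k)^(k-1) * rho (kap L) P (JF m k) Φ s + ind (tauk k L < Fr (etak k) (kap L) P (JF m k) Φ)) := by
        apply avg_mono; intro Φ
        have r0 := rho_nonneg (κ := kap L) P (JF m k) Φ s
        by_cases h : tauk k L < Fr (etak k) (kap L) P (JF m k) Φ
        · rw [ind_true h]
          have : rho (kap L) P (JF m k) Φ s ^ k ≤ 1 := pow_le_one₀ r0 (rho_le_one P (JF m k) Φ s)
          have : 0 ≤ (2*etak k)^(k-1) * rho (kap L) P (JF m k) Φ s := by positivity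
          linarith
        · rw [ind_false h, add_zero]
          push Not at h
          have r1 := rho_le (kap_pos L) e0.le hs P (JF m k) Φ
          obtain ⟨k', rfl⟩ : ∃ k', k = k' + 1 := ⟨k - 1, by omega⟩
          rw [pow_succ]
          simp only [Nat.add_sub_cancel]
          gcongr
          linarith
    _ = (2*etak k)^(k-1) * avg (fun Φ : Fin m → Cl V k => rho (kap L) P (JF m k) Φ s) + avg (fun Φ : Fin m → Cl V k => ind (tauk k L < Fr (etak k) (kap L) P (JF m k) Φ)) := by rw [avg_add, avg_mul]
    _ ≤ _ := by gcongr

lemma geom_sum (L : ℕ) : ∑ j ∈ range L, (2:ℝ)^j ≤ 2^L := by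
  induction L with
  | zero => simp
  | succ L ih => rw [Finset.sum_range_succ, pow_succ]; linarith

lemma geom_sum2 (L : ℕ) : ∑ j ∈ range L, (1/2:ℝ)^j ≤ 2 - 2*(1/2)^L := by
  induction L with
  | zero => simp
  | succ L ih => rw [Finset.sum_range_succ, pow_succ]; linarith

lemma LB_step {k N m L M : ℕ} (g : Good k) (b : BigN k N m L) (hLB : LB k N m L M) : LB k N m L (M+1) := by
  intro Q hQ V _ hV
  rcases Q.eq_empty_or_nonempty with rfl | ⟨i, hi⟩
  · exact hLB ∅ (by simp) V hV
  have : Nonempty V := Fintype.card_pos_iff.1 (by have := b.n2; omega)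
  obtain ⟨P, hiP, rfl⟩ : ∃ P : Finset (Fin m), i ∉ P ∧ insert i P = Q := ⟨Q.erase i, by simp, Finset.insert_erase hi⟩
  rw [Finset.card_insert_of_notMem hiP] at hQ ⊢
  have hP : P.card ≤ M := by omega
  have hk := g.k10
  have e0 := etak_pos hk
  have ih := hLB P hP V hV
  have d := drift (V := V) (k := k) (Sl_pos L) e0.le L le_rfl hiP (JF m k) rfl
  change avg (fun Φ : Fin m → Cl V k => Real.log (Z (kap L) P (JF m k) Φ)) - avg (fun Φ : Fin m → Cl V k => Real.log (Z (kap L) (insert i P) (JF m k) Φ))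
    ≤ _ + 73 * avg (fun Φ : Fin m → Cl V k => Fr (etak k) (kap L) P (JF m k) Φ)
      + ∑ j ∈ range L, 3 * 2 ^ (j+1) * avg (fun Φ : Fin m → Cl V k => rho (kap L) P (JF m k) Φ (3 * 2 ^ j) ^ k) at d
  have f := avgFr g b hLB V hV P hP
  have A0 := A0k_nonneg k
  have B0 := Bk_nonneg k
  have p0 : 0 ≤ (2*etak k)^(k-1) := by positivity
  have p1 : (2*etak k)^(k-1) ≤ 1 := pow_le_one₀ (by positivity) ((two_eta hk).trans (by norm_num))
  have N0 : (0:ℝ) < N := by exact_mod_cast (by have := b.n2; omega : 0 < N)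
  have s1 : ∑ j ∈ range L, 3 * 2 ^ (j+1) * avg (fun Φ : Fin m → Cl V k => rho (kap L) P (JF m k) Φ (3 * 2 ^ j) ^ k)
      ≤ (2*etak k)^(k-1) * A0k k + 6*2^L*(Bk k+1)/(N:ℝ)^2 := by
    calc _ ≤ ∑ j ∈ range L, ((2*etak k)^(k-1) * A0k k * (1/2) * (1/2)^j + 6 * ((Bk k + 1)/(N:ℝ)^2) * 2^j) := by
          apply Finset.sum_le_sum; intro j hj
          have hj' := Finset.mem_range.1 hj
          have two1 : (1:ℝ) ≤ 2^j := one_le_pow₀ (by norm_num)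
          have R := avgRhok g b hLB V hV P hP (s := 3 * 2^j) (by linarith)
            (by gcongr; norm_num)
          have a1 : A0k k / (3*2^j)^8 ≤ A0k k * ((1/2)^j * (1/2)^j / 12) := by
            rw [div_eq_mul_inv]
            gcongr
            rw [mul_pow, mul_inv, one_div, inv_pow]
            have h1 : ((2:ℝ)^j)^2 ≤ ((2:ℝ)^j)^8 := pow_le_pow_right₀ two1 (by norm_num)
            have h2 : (((2:ℝ)^j)^8)⁻¹ ≤ (((2:ℝ)^j)^2)⁻¹ := by gcongr
            have h3 : ((2:ℝ)^j)⁻¹ * ((2:ℝ)^j)⁻¹ = (((2:ℝ)^j)^2)⁻¹ := by rw [← mul_inv, sq]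
            rw [h3]
            have h4 : 0 ≤ (((2:ℝ)^j)^8)⁻¹ := by positivity
            norm_num
            linarith
          have hh : (2:ℝ)^j * (1/2)^j = 1 := by rw [← mul_pow]; norm_num
          calc _ ≤ 3 * 2 ^ (j+1) * ((2*etak k)^(k-1) * (A0k k * ((1/2)^j * (1/2)^j / 12) + Bk k / (N:ℝ)^2) + 1/(N:ℝ)^2) := by
                refine mul_le_mul_of_nonneg_left (R.trans ?_) (by positivity)
                gcongr
            _ = (2*etak k)^(k-1) * A0k k * (1/2) * (1/2)^j * ((2:ℝ)^j * (1/2)^j) + 6 * (((2*etak k)^(k-1) * Bk k + 1)/(N:ℝ)^2) * 2^j := by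
                rw [pow_succ]; ring
            _ ≤ _ := by
                rw [hh, mul_one]
                have : (2*etak k)^(k-1) * Bk k ≤ 1 * Bk k := by gcongr
                rw [one_mul] at this
                gcongr
      _ = (2*etak k)^(k-1) * A0k k * (1/2) * ∑ j ∈ range L, (1/2:ℝ)^j + 6 * ((Bk k + 1)/(N:ℝ)^2) * ∑ j ∈ range L, (2:ℝ)^j := by
          rw [Finset.sum_add_distrib, Finset.mul_sum, Finset.mul_sum]
      _ ≤ (2*etak k)^(k-1) * A0k k * (1/2) * 2 + 6 * ((Bk k + 1)/(N:ℝ)^2) * 2^L := by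
          have g1 := geom_sum L
          have g2 := geom_sum2 L
          have : (0:ℝ) ≤ (1/2)^L := by positivity
          gcongr
          linarith
      _ = _ := by ring
  have c := g.c2
  have n8 := b.n8
  push_cast
  linarith

lemma LB_zero {k N m L : ℕ} (b : BigN k N m L) : LB k N m L 0 := by
  intro Q hQ V _ hV
  have : Q = ∅ := Finset.card_eq_zero.1 (by omega)
  subst this
  have hV0 : Nonempty V := Fintype.card_pos_iff.1 (by have := b.n2; omega)
  have : ∀ Φ : Fin m → Cl V k, Real.log (Z (kap L) ∅ (JF m k) Φ) = N * Real.log 2 := by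
    intro Φ; unfold Z W; simp [hV, Real.log_pow]
  simp only [this]
  rw [avg_const]; simp

lemma LB_all {k N m L : ℕ} (g : Good k) (b : BigN k N m L) (M : ℕ) : LB k N m L M := by
  induction M with
  | zero => exact LB_zero b
  | succ M ih => exact LB_step g b ih

end KS

namespace KS

lemma exists_sat {V : Type} [Fintype V] {k m : ℕ} {S : ℝ} (hm : m * Real.exp (-(S/2)) < 1) (Φ : Fin m → Cl V k)
    (h : ∀ i : Fin m, Real.exp (-(S/2)) * Z (Real.exp (-S)) (univ.erase i) (JF m k) Φ ≤ Z (Real.exp (-S)) univ (JF m k) Φ) :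
    ∃ σ : V → Bool, ∀ i, sat σ univ (Φ i) := by
  by_contra hc
  push Not at hc
  set κ := Real.exp (-S) with hκ
  have h0 : 0 < κ := Real.exp_pos _
  have zp := Z_pos h0 univ (JF m k) Φ
  have e1 : κ * Real.exp (S/2) = Real.exp (-(S/2)) := by rw [hκ, ← Real.exp_add]; congr 1; ring
  have e2 : Real.exp (S/2) * Real.exp (-(S/2)) = 1 := by rw [← Real.exp_add]; simp
  have w : ∀ σ : V → Bool, W κ univ (JF m k) Φ σ ≤ ∑ i : Fin m, κ * W κ (univ.erase i) (JF m k) Φ σ := by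
    intro σ
    obtain ⟨i, hi⟩ := hc σ
    have : W κ univ (JF m k) Φ σ = κ * W κ (univ.erase i) (JF m k) Φ σ := by
      have h1 := W_insert (κ := κ) (P := univ.erase i) (i := i) (by simp) (JF m k) Φ σ
      rw [Finset.insert_erase (Finset.mem_univ i)] at h1
      rw [h1]; unfold wt; rw [if_neg (by exact hi)]
    rw [this]
    exact Finset.single_le_sum (f := fun i => κ * W κ (univ.erase i) (JF m k) Φ σ) (fun j _ => (mul_pos h0 (W_pos h0 _ _ _ _)).le) (Finset.mem_univ i)
  have z : Z κ univ (JF m k) Φ ≤ ∑ i : Fin m, κ * Z κ (univ.erase i) (JF m k) Φ := by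
    calc Z κ univ (JF m k) Φ ≤ ∑ σ : V → Bool, ∑ i : Fin m, κ * W κ (univ.erase i) (JF m k) Φ σ := Finset.sum_le_sum fun σ _ => w σ
      _ = _ := by rw [Finset.sum_comm]; unfold Z; simp only [Finset.mul_sum]
  have z2 : ∑ i : Fin m, κ * Z κ (univ.erase i) (JF m k) Φ ≤ ∑ i : Fin m, Real.exp (-(S/2)) * Z κ univ (JF m k) Φ := by
    apply Finset.sum_le_sum; intro i _
    have h1 : Z κ (univ.erase i) (JF m k) Φ ≤ Real.exp (S/2) * Z κ univ (JF m k) Φ := by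
      have := mul_le_mul_of_nonneg_left (h i) (Real.exp_pos (S/2)).le
      rw [← mul_assoc, e2, one_mul] at this; exact this
    calc _ ≤ κ * (Real.exp (S/2) * Z κ univ (JF m k) Φ) := by gcongr
      _ = _ := by rw [← mul_assoc, e1]
  rw [Finset.sum_const, Finset.card_univ, Fintype.card_fin, nsmul_eq_mul, ← mul_assoc] at z2
  have : m * Real.exp (-(S/2)) * Z κ univ (JF m k) Φ < 1 * Z κ univ (JF m k) Φ := by gcongr
  linarith

lemma unsat_prob {k N m L : ℕ} (g : Good k) (b : BigN k N m L) (hm : m * Real.exp (-(Sl L/2)) < 1) (V : Type) [Fintype V] (hV : Fintype.card V = N) :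
    avg (fun Φ : Fin m → Cl V k => ind (¬ ∃ σ : V → Bool, ∀ i, sat σ univ (Φ i))) ≤ m * (A0k k / (Sl L/2)^8 + Bk k/(N:ℝ)^2) := by
  have : Nonempty V := Fintype.card_pos_iff.1 (by have := b.n2; omega)
  have Sp := Sl_pos L
  calc _ ≤ avg (fun Φ : Fin m → Cl V k => ∑ i : Fin m, ind (Z (kap L) univ (JF m k) Φ < Real.exp (-(Sl L/2)) * Z (kap L) (univ.erase i) (JF m k) Φ)) := by
        apply avg_mono; intro Φ
        apply ind_le_of
        · intro h
          by_contra hc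
          push Not at hc
          apply h
          apply exists_sat hm Φ
          intro i
          by_contra hi
          push Not at hi
          have h1 : ind (Z (kap L) univ (JF m k) Φ < Real.exp (-(Sl L/2)) * Z (kap L) (univ.erase i) (JF m k) Φ) = 1 := ind_true hi
          have h2 := Finset.single_le_sum (f := fun i : Fin m => ind (Z (kap L) univ (JF m k) Φ < Real.exp (-(Sl L/2)) * Z (kap L) (univ.erase i) (JF m k) Φ)) (fun j _ => ind_nonneg _) (Finset.mem_univ i)
          simp only [h1] at h2
          linarith
        · exact Finset.sum_nonneg fun _ _ => ind_nonneg _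
    _ = ∑ i : Fin m, avg (fun Φ : Fin m → Cl V k => ind (Z (kap L) univ (JF m k) Φ < Real.exp (-(Sl L/2)) * Z (kap L) (univ.erase i) (JF m k) Φ)) := by
        rw [avg_sum]
    _ ≤ ∑ i : Fin m, (A0k k / (Sl L/2)^8 + Bk k/(N:ℝ)^2) := by
        apply Finset.sum_le_sum; intro i _
        have st := step_prob (V := V) (κ := kap L) (kap_pos L) (P := univ.erase i) (i := i) (by simp) (JF m k) (Sl L/2)
        rw [Finset.insert_erase (Finset.mem_univ i)] at st
        refine st.trans (le_trans ?_ (Tb g b (LB_all g b m) V hV (univ.erase i) ?_ (s := Sl L/2) (by positivity) (by change _ ≤ Sl L; linarith)))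
        · apply avg_mono; intro Φ
          have r0 := rho_nonneg (κ := kap L) (univ.erase i) (JF m k) Φ (Sl L/2)
          have r1 := rho_le_one (κ := kap L) (univ.erase i) (JF m k) Φ (Sl L/2)
          change _ ^ (Finset.univ : Finset (Fin k)).card ≤ _
          rw [Finset.card_univ, Fintype.card_fin]
          simpa using pow_le_pow_of_le_one r0 r1 (by have := g.k10; omega : 1 ≤ k)
        · have := Finset.card_le_univ (univ.erase i); rwa [Fintype.card_fin] at this
    _ = _ := by rw [Finset.sum_const, Finset.card_univ, Fintype.card_fin, nsmul_eq_mul]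

end KS

namespace KS

lemma ev_exp (p : ℕ) {c ε : ℝ} (hc : 0 < c) (hε : 0 < ε) : ∀ᶠ A : ℝ in atTop, A^p * Real.exp (-(c * A)) < ε := by
  have h := (tendsto_rpow_mul_exp_neg_mul_atTop_nhds_zero p c hc).eventually (gt_mem_nhds hε)
  filter_upwards [h] with A hA
  rw [Real.rpow_natCast, neg_mul] at hA
  exact hA

set_option maxHeartbeats 1600000 in
lemma BigN_of {k : ℕ} (hk : 10 ≤ k) {r : ℝ} (hr0 : 0 < r) (hr : r ≤ 2^k * Real.log 2 - (3/2) * Real.log 2 - 1/((k:ℝ)+1)) :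
    ∀ᶠ A : ℝ in atTop, ∀ N L : ℕ, A = 2^L → A^4 ≤ N → (N:ℝ) ≤ 16 * A^4 → 
      BigN k N ⌊r * N⌋₊ L ∧ (⌊r * N⌋₊ : ℝ) * Real.exp (-(Sl L/2)) < 1 := by
  have y0 := yk_pos k
  have y1 := yk_le_one k
  have hkr : (10:ℝ) ≤ k := by exact_mod_cast hk
  have e0 := etak_pos hk
  have e1 : etak k ≤ 1 := by have := two_eta hk; norm_num at this; linarith
  have B0 := Bk_nonneg k
  have hy2 : (2:ℝ)^k * yk k = 1 := by unfold yk; rw [← mul_pow]; norm_num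
  have L1 := log2_lo
  have L2 := log2_hi
  obtain ⟨c8, hc8⟩ : ∃ c8 : ℝ, c8 = yk k^2/(4*(k:ℝ)^3) := ⟨_, rfl⟩
  have c80 : 0 < c8 := by rw [hc8]; positivity
  have y3 : 0 < yk k^3 := by positivity
  have y9 : 0 < yk k^9 := by positivity
  have y4 : 0 < yk k^4 := by positivity
  have y5 : 0 < yk k^5 := by positivity
  filter_upwards [eventually_ge_atTop 4, ev_exp 0 one_pos y5, eventually_ge_atTop (1/(yk k/(2*((k:ℝ)+1)))),
    eventually_ge_atTop (2*(1+6*2^k*k)/yk k^4), ev_exp 8 (by positivity : 0 < yk k^9/36) (by norm_num : (0:ℝ) < 1/512),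
    eventually_ge_atTop (96/yk k^3), ev_exp 12 (by positivity : 0 < yk k^3/4) (by positivity : 0 < etak k/(18*512)),
    ev_exp 0 one_pos (by positivity : 0 < c8/2/73), eventually_ge_atTop ((73+6*(Bk k+1))/(c8/2)),
    ev_exp 4 one_pos (by positivity : (0:ℝ) < 1/(2^k*16))] with A hA h3 h4 h5 h6 h7 h7' h8 h8' h9 N L hAL hN1 hN2
  simp only [pow_zero, one_mul] at h3 h8 h9
  rw [div_le_iff₀ (by positivity)] at h4 h5 h7 h8'
  rw [lt_div_iff₀ (by positivity)] at h9
  have A0 : 0 < A := by linarith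
  have A1 : 1 ≤ A := by linarith
  have S3 : Sl L = 3 * A := by unfold Sl; rw [hAL]
  have LA : (L:ℝ) ≤ A := by rw [hAL]; exact_mod_cast (Nat.lt_two_pow_self (n := L)).le
  have L0 : (0:ℝ) ≤ L := Nat.cast_nonneg _
  have A2 : A ≤ A^2 := by simpa using pow_le_pow_right₀ A1 (by norm_num : 1 ≤ 2)
  have A3 : A^2 ≤ A^3 := pow_le_pow_right₀ A1 (by norm_num)
  have A4 : A^3 ≤ A^4 := pow_le_pow_right₀ A1 (by norm_num)
  have A34 : 4 * A^3 ≤ A^4 := by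
    have : 0 < A^3 := by positivity
    have : A^4 = A^3 * A := by ring
    have := mul_le_mul_of_nonneg_left (by linarith : (4:ℝ) ≤ A) (by positivity : 0 ≤ A^3); linarith
  have A64 : 64 * A ≤ A^4 := by 
    have u1 := mul_le_mul_of_nonneg_left hA A0.le
    have u2 := mul_le_mul_of_nonneg_left hA (by positivity : 0 ≤ A^2)
    linarith
  have N0 : (0:ℝ) < N := lt_of_lt_of_le (by positivity) hN1
  have NL : A^4/2 ≤ (N:ℝ) - L := by linarith
  have N2 : (N:ℝ)^2 ≤ 256 * A^8 := by
    calc (N:ℝ)^2 ≤ (16*A^4)^2 := by gcongr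
      _ = _ := by ring
  have N2' : A^8 ≤ (N:ℝ)^2 := by
    calc A^8 = (A^4)^2 := by ring
      _ ≤ (N:ℝ)^2 := by gcongr
  have mr : (⌊r * N⌋₊ : ℝ) ≤ r * N := Nat.floor_le (by positivity)
  have r2 : r ≤ 2^k := by
    have : (0:ℝ) < 1/((k:ℝ)+1) := by positivity
    have : (0:ℝ) < 2^k := by positivity
    have := mul_le_mul_of_nonneg_left (by linarith [log2_hi] : Real.log 2 ≤ 1) this.le; linarith [log2_lo]
  have m2 : (⌊r * N⌋₊ : ℝ) ≤ 2^k * N := mr.trans (by gcongr)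
  have kE : kap L = Real.exp (-(3*A)) := by unfold kap; rw [S3]
  have tauE : tauk k L = etak k * Real.exp (-(24*A^3)) := by
    unfold tauk; rw [kE, ← Real.exp_nat_mul]
    congr 2
    unfold El; push_cast; rw [← hAL]; ring
  have tau0 : 0 < tauk k L := by rw [tauE]; positivity
  refine ⟨⟨?_, ?_, ?_, ?_, ?_, ?_, ?_, ?_, ?_⟩, ?_⟩
  · have : (N:ℝ) ≤ (El L : ℝ)^2 := by
      refine hN2.trans (le_of_eq ?_)
      unfold El; push_cast; rw [← hAL]; ring
    exact_mod_cast this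
  · have : (2:ℝ) ≤ N := by linarith
    exact_mod_cast this
  · have : (2:ℝ) * L + 2 ≤ N := by linarith
    exact_mod_cast this
  · rw [kE]
    refine le_trans (Real.exp_le_exp.2 (by linarith)) h3.le
  · have hry : r * yk k ≤ Real.log 2 - yk k * (3/2 * Real.log 2 + 1/((k:ℝ)+1)) := by
      calc r * yk k ≤ (2^k * Real.log 2 - (3/2) * Real.log 2 - 1/((k:ℝ)+1)) * yk k := by gcongr
        _ = (2^k * yk k) * Real.log 2 - yk k * (3/2 * Real.log 2 + 1/((k:ℝ)+1)) := by ring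
        _ = _ := by rw [hy2, one_mul]
    have hh : yk k * (1/((k:ℝ)+1)) = 2 * (yk k/(2*((k:ℝ)+1))) := by field_simp
    have hh2 : yk k * (1/(2*((k:ℝ)+1))) = yk k/(2*((k:ℝ)+1)) := by ring
    set h := yk k/(2*((k:ℝ)+1))
    have hp : 0 < h := by positivity
    have hw : yk k * (3/2 * Real.log 2) ≥ 0 := by positivity
    rw [mul_add, hh] at hry
    rw [mul_add, hh2]
    have h10 : A ≤ h * N := by
      have : A * 1 ≤ A^3 * (A * h) := by gcongr; linarith
      have : h * A^4 ≤ h * N := by gcongr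
      linarith
    calc (⌊r * N⌋₊ : ℝ) * yk k ≤ r * N * yk k := by gcongr
      _ = (r * yk k) * N := by ring
      _ ≤ (Real.log 2 - (yk k * (3/2 * Real.log 2) + 2 * h)) * N := by gcongr
      _ ≤ _ := by
        have : (Real.log 2 - (yk k * (3/2 * Real.log 2) + h)) * L ≤ 1 * A := by
          gcongr; linarith
        linarith
  · rw [S3]
    have h10 : (⌊r * N⌋₊ : ℝ) * (k * (2/N)) ≤ 2^k * (2 * k) := by
      calc (⌊r * N⌋₊ : ℝ) * (k * (2/N)) ≤ (2^k * N) * (k * (2/N)) := by gcongr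
        _ = _ := by field_simp
    calc L * (Real.log 2 + 3 * A * (⌊r * N⌋₊ * (k * (2 / N)))) ≤ A * (1 + 3 * A * (2^k * (2 * k))) := by gcongr; linarith
      _ ≤ A * (A + 3 * A * (2^k * (2 * k))) := by gcongr
      _ = A^2 * (2 * (1+6*2^k*k)) / 2 := by ring
      _ ≤ A^2 * (A * yk k^4)/2 := by gcongr
      _ = yk k^4 * (A^3/2) := by ring
      _ ≤ yk k^4 * ((N:ℝ) - L) := by gcongr; linarith
  · have h10 : -(yk k^9 * ((N:ℝ) - L) / (2 * Sl L^2)) ≤ -(yk k^9/36 * A) := by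
      rw [S3]
      apply neg_le_neg
      calc yk k^9/36 * A ≤ yk k^9/36 * A^2 := by gcongr
        _ = yk k^9 * (A^4/2) / (2*(3*A)^2) := by field_simp; norm_num
        _ ≤ _ := by gcongr
    refine (Real.exp_le_exp.2 h10).trans ?_
    rw [le_div_iff₀ (by positivity)]
    have : Real.exp (-(yk k^9/36 * A)) * (2 * (N:ℝ)^2) ≤ Real.exp (-(yk k^9/36 * A)) * (2 * (256 * A^8)) := by gcongr
    linarith
  · have h10 : Real.exp (-(yk k^3 * ((N:ℝ) - L))) ≤ Real.exp (-(24*A^3)) * Real.exp (-(yk k^3/4*A)) := by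
      rw [← Real.exp_add]; apply Real.exp_le_exp.2
      have q1 : yk k^3 * (A^4/2) ≤ yk k^3 * ((N:ℝ) - L) := by gcongr
      have q2 : 96 * A^3 ≤ (A * yk k^3) * A^3 := by gcongr
      have q3 : yk k^3/4 * A ≤ yk k^3/4 * A^4 := by gcongr; linarith
      have q4 : (A * yk k^3) * A^3 = yk k^3 * A^4 := by ring
      linarith
    rw [tauE, div_le_iff₀ (by positivity), div_mul_eq_mul_div, one_mul, le_div_iff₀ (by positivity)]
    have N18 : (N:ℝ) + 2 ≤ 18 * A^4 := by linarith
    calc ((N:ℝ) + 2) * Real.exp (-(yk k^3 * ((N:ℝ) - L))) * (2 * (N:ℝ)^2) 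
        ≤ (18 * A^4) * (Real.exp (-(24*A^3)) * Real.exp (-(yk k^3/4*A))) * (2 * (256 * A^8)) := by gcongr
      _ = (18*512) * (A^12 * Real.exp (-(yk k^3/4*A))) * Real.exp (-(24*A^3)) := by ring
      _ ≤ (18*512) * (etak k / (18*512)) * Real.exp (-(24*A^3)) := by gcongr
      _ = _ := by field_simp
  · rw [← hc8, tauE, ← hAL]
    have q1 : etak k * Real.exp (-(24*A^3)) ≤ 1 * Real.exp (-A) := by
      gcongr; linarith
    have A8 : A^2 ≤ (N:ℝ)^2 := (pow_le_pow_right₀ A1 (by norm_num : 2 ≤ 8)).trans N2'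
    have q2 : 1/(N:ℝ)^2 ≤ 1/A := by
      apply one_div_le_one_div_of_le A0; linarith
    have q3 : 6*A*(Bk k+1)/(N:ℝ)^2 ≤ 6*(Bk k+1) * (1/A) := by
      calc 6*A*(Bk k+1)/(N:ℝ)^2 ≤ 6*A*(Bk k+1)/A^2 := by gcongr
        _ = _ := by field_simp
    have q4 : (73+6*(Bk k+1)) * (1/A) ≤ c8/2 := by
      rw [mul_one_div, div_le_iff₀ A0]; linarith
    rw [lt_div_iff₀ (by norm_num)] at h8
    linarith
  · have h10 : Real.exp (-(Sl L/2)) ≤ Real.exp (-A) := by apply Real.exp_le_exp.2; rw [S3]; linarith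
    calc (⌊r * N⌋₊ : ℝ) * Real.exp (-(Sl L/2)) ≤ 2^k * (16 * A^4) * Real.exp (-A) := by
          have : 2^k * (N:ℝ) ≤ 2^k * (16*A^4) := by gcongr
          gcongr; exact m2.trans this
      _ = A^4 * Real.exp (-A) * (2^k * 16) := by ring
      _ < 1 := h9

lemma main_tendsto {k : ℕ} (g : Good k) {r : ℝ} (hr0 : 0 < r) (hr : r ≤ 2^k * Real.log 2 - (3/2) * Real.log 2 - 1/((k:ℝ)+1)) :
    Tendsto (fun N : ℕ => avg (fun Φ : Fin ⌊r * N⌋₊ → Cl (Fin N) k => ind (¬ ∃ σ : Fin N → Bool, ∀ i, sat σ univ (Φ i)))) atTop (nhds 0) := by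
  have logt : Tendsto (Nat.log 16) atTop atTop :=
    Filter.tendsto_atTop_atTop_of_monotone (fun a b h => Nat.log_mono_right h) (fun b => ⟨16^b, by rw [Nat.log_pow (by norm_num)]⟩)
  have powt : Tendsto (fun N : ℕ => (2:ℝ)^(Nat.log 16 N)) atTop atTop := (tendsto_pow_atTop_atTop_of_one_lt (by norm_num : (1:ℝ) < 2)).comp logt
  have A0 := A0k_nonneg k
  have B0 := Bk_nonneg k
  set C : ℝ := 2^k * 16 * (A0k k + Bk k) with hC
  have C0 : 0 ≤ C := by positivity
  have inv : Tendsto (fun N : ℕ => C * ((2:ℝ)^(Nat.log 16 N))⁻¹) atTop (nhds 0) := by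
    simpa using (tendsto_inv_atTop_zero.comp powt).const_mul C
  refine tendsto_of_tendsto_of_tendsto_of_le_of_le' tendsto_const_nhds inv (Eventually.of_forall fun N => avg_nonneg fun _ => ind_nonneg _) ?_
  filter_upwards [powt.eventually (BigN_of g.k10 hr0 hr), powt.eventually (eventually_ge_atTop 1), eventually_ge_atTop 1] with N hN hA1 hNpos
  set L := Nat.log 16 N with hL
  have b1 : (16:ℕ)^L ≤ N := Nat.pow_log_le_self 16 (by omega)
  have b2 : N < (16:ℕ)^(L+1) := Nat.lt_pow_succ_log_self (by norm_num) N
  obtain ⟨A, hA⟩ : ∃ A : ℝ, A = 2^L := ⟨_, rfl⟩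
  have A4 : A^4 = ((16:ℕ)^L : ℕ) := by
    rw [hA, ← pow_mul, mul_comm, pow_mul]; norm_num
  have c1 : A^4 ≤ N := by rw [A4]; exact_mod_cast b1
  have c2 : (N:ℝ) ≤ 16 * A^4 := by
    rw [A4]; rw [pow_succ] at b2
    have : (N:ℝ) ≤ (((16:ℕ)^L * 16 : ℕ):ℝ) := by exact_mod_cast b2.le
    push_cast at this ⊢; linarith
  rw [← hA] at hN hA1 ⊢
  obtain ⟨b, hm⟩ := hN N L hA c1 c2
  refine (unsat_prob g b hm (Fin N) (by simp)).trans ?_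
  have S3 : Sl L / 2 = 3/2 * A := by unfold Sl; rw [hA]; ring
  have Ap : 0 < A := by linarith
  rw [S3]
  have N2' : A^8 ≤ (N:ℝ)^2 := by
    calc A^8 = (A^4)^2 := by ring
      _ ≤ (N:ℝ)^2 := by gcongr
  have m2 := m_le g b
  calc (⌊r * N⌋₊ : ℝ) * (A0k k / (3/2*A)^8 + Bk k / (N:ℝ)^2) ≤ (2^k * (16 * A^4)) * (A0k k / (1 * A)^8 + Bk k / A^8) := by
        have : 2^k * (N:ℝ) ≤ 2^k * (16*A^4) := by gcongr
        gcongr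
        · exact m2.trans this
        · norm_num
    _ = C * (A^4)⁻¹ := by rw [hC]; field_simp
    _ ≤ C * A⁻¹ := by
        gcongr
        exact le_self_pow₀ hA1 (by norm_num)

end KS

namespace KS

lemma litVal_iff {n : ℕ} (σ : Assignment n) (l : Lit n) : litVal σ l = true ↔ σ l.1 = l.2 := by
  unfold litVal
  rcases l with ⟨a, b⟩
  cases b <;> simp

lemma satisfies_iff {n k m : ℕ} (σ : Assignment n) (Φ : Formula n k m) :
    Satisfies σ Φ ↔ ∀ i, sat σ univ (Φ i) := by
  unfold Satisfies sat
  simp [litVal_iff]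

lemma prF_eq {n k m : ℕ} (hn : 1 ≤ n) :
    (prF n k m fun Φ => ∃ σ : Assignment n, Satisfies σ Φ) =
      1 - avg (fun Φ : Fin m → Cl (Fin n) k => ind (¬ ∃ σ : Fin n → Bool, ∀ i, sat σ univ (Φ i))) := by
  haveI : Nonempty (Fin n) := ⟨⟨0, hn⟩⟩
  haveI : Nonempty (Fin m → Cl (Fin n) k) := ⟨fun _ _ => (Classical.arbitrary _, true)⟩
  rw [avg_ind_not, sub_sub_cancel]
  unfold prF avg ind
  simp only [satisfies_iff]
  rw [Finset.card_filter]
  push_cast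
  congr!

end KS

/-- There are `k0` and a positive sequence `eps k → 0` such that for all
`k ≥ k0` and densities `0 < r ≤ 2^k ln 2 - (3/2) ln 2 - eps k`, the random formula
`Φ_k(n, ⌊r n⌋)` is satisfiable with high probability as `n → ∞`. -/
theorem statement0 :
    ∃ (k0 : ℕ) (eps : ℕ → ℝ),
      (∀ k, 0 < eps k) ∧
      Tendsto eps atTop (nhds 0) ∧
      ∀ k : ℕ, k0 ≤ k → ∀ r : ℝ, 0 < r →
        r ≤ 2 ^ k * Real.log 2 - (3 / 2) * Real.log 2 - eps k →
        Tendsto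
          (fun n : ℕ =>
            prF n k ⌊r * (n : ℝ)⌋₊ fun Φ => ∃ σ : Assignment n, Satisfies σ Φ)
          atTop (nhds 1) := by
  obtain ⟨k0, hk0⟩ := eventually_atTop.1 KS.ev_good
  refine ⟨k0, fun k => 1 / ((k : ℝ) + 1), fun k => by positivity,
    tendsto_one_div_add_atTop_nhds_zero_nat, ?_⟩
  intro k hk r hr0 hr
  have h := (tendsto_const_nhds (x := (1 : ℝ))).sub (KS.main_tendsto (hk0 k hk) hr0 hr)
  rw [sub_zero] at h
  refine h.congr' ?_
  filter_upwards [eventually_ge_atTop 1] with n hn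
  exact (KS.prF_eq hn).symm
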